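/- arXiv:2108.09414 — 6 statements merged into one kernel-verified Lean document; each statement's English description precedes it below -/
import Mathlib

section
/- For every integer n ≥ 1, the number of partitions of n with nonnegative crank equals the number of partitions of n whose mex is odd. -/
/-- Number of parts equal to 1 in a partition. -/
def partOmega {n : ℕ} (P : Nat.Partition n) : ℕ := P.parts.count 1

/-- Number of parts strictly greater than `partOmega P`. -/
def partMu {n : ℕ} (P : Nat.Partition n) : ℕ :=
  (P.parts.filter (fun x => partOmega P < x)).card

/-- The crank of a partition: the largest part if there are no parts equal to 1,
and `μ(λ) - ω(λ)` otherwise. -/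
def crank {n : ℕ} (P : Nat.Partition n) : ℤ :=
  if partOmega P = 0 then (P.parts.sup : ℤ)
  else (partMu P : ℤ) - (partOmega P : ℤ)

/-- The mex of a partition: the smallest positive integer that is not a part. -/
noncomputable def partMex {n : ℕ} (P : Nat.Partition n) : ℕ :=
  sInf {k : ℕ | 0 < k ∧ k ∉ P.parts}

/-- Number of elements of `s` that are larger than `j`. -/
def countAbove (s : Multiset ℕ) (j : ℕ) : ℕ := s.countP (fun x => j < x)

lemma countAbove_antitone (s : Multiset ℕ) : Antitone (countAbove s) := by
  intro i j hij
  unfold countAbove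
  rw [Multiset.countP_eq_card_filter, Multiset.countP_eq_card_filter]
  exact Multiset.card_le_card
    (Multiset.monotone_filter_right s (fun x (hx : j < x) => lt_of_le_of_lt hij hx))

lemma countAbove_add (s t : Multiset ℕ) (j : ℕ) :
    countAbove (s + t) j = countAbove s j + countAbove t j := Multiset.countP_add _ _ _

lemma countAbove_eq_zero {s : Multiset ℕ} {j : ℕ} (h : ∀ x ∈ s, x ≤ j) :
    countAbove s j = 0 := by
  unfold countAbove
  rw [Multiset.countP_eq_zero]
  intro x hx
  have := h x hx
  omega

lemma countAbove_eq_card {s : Multiset ℕ} {j : ℕ} (h : ∀ x ∈ s, j < x) :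
    countAbove s j = s.card := Multiset.countP_eq_card.2 h

lemma countAbove_eq_succ_add_count (s : Multiset ℕ) (j : ℕ) :
    countAbove s j = countAbove s (j + 1) + s.count (j + 1) := by
  unfold countAbove
  induction s using Multiset.induction_on with
  | empty => simp
  | cons a s ih =>
    rw [Multiset.countP_cons, Multiset.countP_cons, Multiset.count_cons, ih]
    split_ifs <;> omega

lemma countAbove_cons (a : ℕ) (s : Multiset ℕ) (j : ℕ) :
    countAbove (a ::ₘ s) j = countAbove s j + if j < a then 1 else 0 :=
  Multiset.countP_cons _ _ _

/-- `d` is the largest index such that `s` has at least `d` elements larger than `d + k`. -/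
def IsDurfee (k : ℕ) (s : Multiset ℕ) (d : ℕ) : Prop :=
  d ≤ countAbove s (d + k) ∧ countAbove s (d + 1 + k) ≤ d

lemma IsDurfee.unique {k : ℕ} {s : Multiset ℕ} {d e : ℕ} (hd : IsDurfee k s d)
    (he : IsDurfee k s e) : d = e := by
  obtain ⟨h1, h2⟩ := hd
  obtain ⟨h3, h4⟩ := he
  rcases lt_trichotomy d e with h | h | h
  · have := countAbove_antitone s (show d + 1 + k ≤ e + k by omega)
    omega
  · exact h
  · have := countAbove_antitone s (show e + 1 + k ≤ d + k by omega)
    omega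

lemma countAbove_le_card (s : Multiset ℕ) (j : ℕ) : countAbove s j ≤ s.card :=
  Multiset.countP_le_card _ _

/-- The multisets of positive integers, with their Durfee index `d`, such that adding a part
`d + k + 1` gives a partition of `n`. -/
abbrev DurfeePair (k n : ℕ) : Type :=
  {x : Multiset ℕ × ℕ // 0 ∉ x.1 ∧ IsDurfee k x.1 x.2 ∧ x.1.sum + x.2 + k + 1 = n}

/-- The partition with a given multiset of positive parts. -/
def partitionOfParts {n : ℕ} (s : Multiset ℕ) (h0 : 0 ∉ s) (hs : s.sum = n) : Nat.Partition n where
  parts := s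
  parts_pos := fun hi => Nat.pos_of_ne_zero (fun h => h0 (h ▸ hi))
  parts_sum := hs

lemma Nat.Partition.zero_notMem_parts {n : ℕ} (P : Nat.Partition n) : 0 ∉ P.parts :=
  fun h => lt_irrefl 0 (P.parts_pos h)

lemma card_subtype_add_card_compl {α : Type*} [Finite α] (p : α → Prop) :
    Nat.card {a // p a} + Nat.card {a // ¬ p a} = Nat.card α := by
  classical
  rw [← Nat.card_sum]
  exact Nat.card_congr (Equiv.sumCompl p)

lemma crank_neg_iff {n : ℕ} (P : Nat.Partition n) :
    crank P < 0 ↔ countAbove P.parts (P.parts.count 1) < P.parts.count 1 := by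
  unfold crank partMu partOmega countAbove
  rw [Multiset.countP_eq_card_filter]
  split_ifs with h
  · simp [h]
  · omega

lemma countAbove_add_replicate_one (s : Multiset ℕ) (m : ℕ) {j : ℕ} (hj : 1 ≤ j) :
    countAbove (s + Multiset.replicate m 1) j = countAbove s j := by
  rw [countAbove_add, countAbove_eq_zero (s := Multiset.replicate m 1), add_zero]
  intro x hx
  rw [Multiset.eq_of_mem_replicate hx]
  exact hj

lemma isDurfee_zero_add_replicate_one {s : Multiset ℕ} {m d : ℕ} :
    IsDurfee 0 (s + Multiset.replicate m 1) d ↔ IsDurfee 0 s d := by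
  unfold IsDurfee
  rw [countAbove_add_replicate_one _ _ (by omega : 1 ≤ d + 1 + 0)]
  rcases Nat.eq_zero_or_pos d with rfl | h
  · simp
  · rw [countAbove_add_replicate_one _ _ (by omega)]

lemma card_crank_neg (n : ℕ) :
    Nat.card {P : Nat.Partition n // crank P < 0} = Nat.card (DurfeePair 0 n) := by
  symm
  let f : DurfeePair 0 n → {P : Nat.Partition n // crank P < 0} := fun x =>
    ⟨partitionOfParts (x.1.1 + Multiset.replicate (x.1.2 + 1) 1)
      (by
        have := x.2.1
        simp [this, Multiset.mem_replicate])
      (by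
        have := x.2.2.2
        simp
        omega), by
      rw [crank_neg_iff]
      change countAbove (x.1.1 + Multiset.replicate (x.1.2 + 1) 1)
        ((x.1.1 + Multiset.replicate (x.1.2 + 1) 1).count 1) <
        (x.1.1 + Multiset.replicate (x.1.2 + 1) 1).count 1
      have hc : (x.1.1 + Multiset.replicate (x.1.2 + 1) 1).count 1
          = x.1.1.count 1 + (x.1.2 + 1) := by simp [add_assoc]
      rw [hc, countAbove_add_replicate_one _ _ (by omega)]
      have h1 := x.2.2.1.2
      have h2 := countAbove_antitone x.1.1
        (show x.1.2 + 1 + 0 ≤ x.1.1.count 1 + (x.1.2 + 1) by omega)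
      omega⟩
  refine Nat.card_congr (Equiv.ofBijective f ⟨?_, ?_⟩)
  · rintro ⟨⟨s, d⟩, hs⟩ ⟨⟨t, e⟩, ht⟩ h
    have h' : s + Multiset.replicate (d + 1) 1 = t + Multiset.replicate (e + 1) 1 :=
      congrArg (fun P => P.1.parts) h
    have hd : d = e := by
      refine IsDurfee.unique (k := 0) (s := s + Multiset.replicate (d + 1) 1) ?_ ?_
      · exact isDurfee_zero_add_replicate_one.2 hs.2.1
      · rw [h']
        exact isDurfee_zero_add_replicate_one.2 ht.2.1
    subst hd
    have hst : s = t := by simpa using h'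
    subst hst
    rfl
  · rintro ⟨P, hP⟩
    have hneg := (crank_neg_iff P).1 hP
    set w := P.parts.count 1 with hw
    have hex : ∃ d, countAbove P.parts (d + 1 + 0) ≤ d := ⟨w - 1, by
      rw [show w - 1 + 1 + 0 = w by omega]
      omega⟩
    classical
    obtain ⟨d, hd, hmin⟩ : ∃ d, countAbove P.parts (d + 1 + 0) ≤ d ∧
        ∀ e < d, ¬ countAbove P.parts (e + 1 + 0) ≤ e :=
      ⟨Nat.find hex, Nat.find_spec hex, fun e he => Nat.find_min hex he⟩
    have hdw : d + 1 ≤ w := by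
      by_contra hlt
      refine hmin (w - 1) (by omega) ?_
      rw [show w - 1 + 1 + 0 = w by omega]
      omega
    have hle : Multiset.replicate (d + 1) 1 ≤ P.parts := Multiset.le_count_iff_replicate_le.1 hdw
    obtain ⟨r, hr⟩ := Multiset.le_iff_exists_add.1 hle
    rw [add_comm] at hr
    have hD : IsDurfee 0 P.parts d := by
      refine ⟨?_, hd⟩
      rcases d with _ | e
      · simp
      · have := hmin e (by omega)
        omega
    refine ⟨⟨(r, d), ?_, ?_, ?_⟩, ?_⟩
    · intro h
      exact P.zero_notMem_parts (by rw [hr]; simp [h])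
    · rw [hr] at hD
      exact isDurfee_zero_add_replicate_one.1 hD
    · have := P.parts_sum
      rw [hr] at this
      simp at this
      simp
      omega
    · apply Subtype.ext
      apply Nat.Partition.ext
      exact hr.symm

lemma card_durfeePair_succ (k m : ℕ) :
    Nat.card (DurfeePair (k + 1) m) =
      Nat.card {P : Nat.Partition m // ¬ ∃ d, countAbove P.parts (d + k + 1) = d} := by
  have key : ∀ (s : Multiset ℕ) (d : ℕ), IsDurfee (k + 1) s d →
      d + 1 ≤ countAbove ((d + k + 2) ::ₘ s) (d + k + 1) ∧
      countAbove ((d + k + 2) ::ₘ s) (d + 1 + k + 1) ≤ d := by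
    rintro s d ⟨h1, h2⟩
    rw [countAbove_cons, countAbove_cons, if_pos (by omega), if_neg (by omega)]
    exact ⟨by simpa [add_assoc] using h1, by simpa [add_assoc] using h2⟩
  have mono := fun (s : Multiset ℕ) (i j : ℕ) (h : i ≤ j) => countAbove_antitone s h
  let f : DurfeePair (k + 1) m →
      {P : Nat.Partition m // ¬ ∃ d, countAbove P.parts (d + k + 1) = d} := fun x =>
    ⟨partitionOfParts ((x.1.2 + k + 2) ::ₘ x.1.1)
      (by
        have := x.2.1
        simp [this])
      (by
        have := x.2.2.2
        simp
        omega), by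
      rintro ⟨e, he⟩
      change countAbove ((x.1.2 + k + 2) ::ₘ x.1.1) (e + k + 1) = e at he
      obtain ⟨h1, h2⟩ := key _ _ x.2.2.1
      rcases Nat.lt_or_ge x.1.2 e with h | h
      · have := mono ((x.1.2 + k + 2) ::ₘ x.1.1) (x.1.2 + 1 + k + 1) (e + k + 1) (by omega)
        omega
      · have := mono ((x.1.2 + k + 2) ::ₘ x.1.1) (e + k + 1) (x.1.2 + k + 1) (by omega)
        omega⟩
  refine Nat.card_congr (Equiv.ofBijective f ⟨?_, ?_⟩)
  · rintro ⟨⟨s, d⟩, hs⟩ ⟨⟨t, e⟩, ht⟩ h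
    have h' : (d + k + 2) ::ₘ s = (e + k + 2) ::ₘ t := congrArg (fun P => P.1.parts) h
    have hd : d = e := by
      obtain ⟨h1, h2⟩ := key _ _ hs.2.1
      obtain ⟨h3, h4⟩ := key _ _ ht.2.1
      simp only at h1 h2 h3 h4
      rw [← h'] at h3 h4
      refine IsDurfee.unique (k := k + 1) (s := (d + k + 2) ::ₘ s) ⟨?_, ?_⟩ ⟨?_, ?_⟩ <;>
        simp only [← add_assoc] <;> omega
    subst hd
    have hst : s = t := by simpa using h'
    subst hst
    rfl
  · rintro ⟨P, hP⟩
    have hex : ∃ d, countAbove P.parts (d + k + 1) ≤ d := ⟨P.parts.card, countAbove_le_card _ _⟩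
    classical
    obtain ⟨d, hd, hmin⟩ : ∃ d, countAbove P.parts (d + k + 1) ≤ d ∧
        ∀ e < d, ¬ countAbove P.parts (e + k + 1) ≤ e :=
      ⟨Nat.find hex, Nat.find_spec hex, fun e he => Nat.find_min hex he⟩
    have hne : countAbove P.parts (d + k + 1) ≠ d := fun h => hP ⟨d, h⟩
    rcases d with _ | d
    · omega
    have hlt := hmin d (by omega)
    have hstep := countAbove_eq_succ_add_count P.parts (d + k + 1)
    rw [show d + 1 + k + 1 = d + k + 1 + 1 by ring] at hd hne
    have hmem : d + k + 2 ∈ P.parts := Multiset.count_pos.1 (by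
      rw [show d + k + 2 = d + k + 1 + 1 by ring]
      omega)
    obtain ⟨r, hr⟩ := Multiset.exists_cons_of_mem hmem
    refine ⟨⟨(r, d), ?_, ⟨?_, ?_⟩, ?_⟩, ?_⟩
    · intro h
      exact P.zero_notMem_parts (by rw [hr]; simp [h])
    · rw [hr, countAbove_cons, if_pos (by omega)] at hlt
      simp only [← add_assoc]
      omega
    · rw [hr, countAbove_cons, if_neg (by omega)] at hd hne
      simp only [show d + 1 + (k + 1) = d + k + 1 + 1 by ring]
      omega
    · have := P.parts_sum
      rw [hr] at this
      simp at this
      simp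
      omega
    · apply Subtype.ext
      apply Nat.Partition.ext
      exact hr.symm

/-- Lower by one every element of `s` larger than `t`. -/
def lowerAbove (t : ℕ) (s : Multiset ℕ) : Multiset ℕ :=
  s.filter (fun x => ¬ t < x) + (s.filter (fun x => t < x)).map Nat.pred

lemma sum_map_pred_add_card {s : Multiset ℕ} (h : ∀ x ∈ s, 0 < x) :
    (s.map Nat.pred).sum + s.card = s.sum := by
  induction s using Multiset.induction_on with
  | empty => simp
  | cons a s ih =>
    have h1 := ih (fun x hx => h x (Multiset.mem_cons_of_mem hx))
    have h2 := h a (Multiset.mem_cons_self a s)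
    simp only [Multiset.map_cons, Multiset.sum_cons, Multiset.card_cons, Nat.pred_eq_sub_one] at *
    omega

lemma map_succ_map_pred {s : Multiset ℕ} (h : ∀ x ∈ s, 0 < x) :
    (s.map Nat.pred).map Nat.succ = s := by
  rw [Multiset.map_map]
  conv_rhs => rw [← Multiset.map_id s]
  exact Multiset.map_congr rfl (fun x hx => Nat.succ_pred_eq_of_pos (h x hx))

lemma sum_lowerAbove (t : ℕ) (s : Multiset ℕ) :
    (lowerAbove t s).sum + countAbove s t = s.sum := by
  have h := sum_map_pred_add_card (s := s.filter (fun x => t < x))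
    (fun x hx => by have := (Multiset.mem_filter.1 hx).2; omega)
  have h2 := congrArg Multiset.sum (Multiset.filter_add_not (fun x => t < x) s)
  rw [Multiset.sum_add] at h2
  unfold lowerAbove countAbove
  rw [Multiset.sum_add, Multiset.countP_eq_card_filter]
  omega

/-- A multiset bounded below by `t` is determined by its size and its elements larger than `t`. -/
lemma eq_filter_add_replicate {s : Multiset ℕ} {t : ℕ} (h : ∀ x ∈ s, t ≤ x) :
    s = s.filter (fun x => t < x) + Multiset.replicate (s.card - countAbove s t) t := by
  have h1 := Multiset.filter_add_not (fun x => t < x) s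
  have h2 : s.filter (fun x => ¬ t < x) = Multiset.replicate (s.card - countAbove s t) t := by
    rw [Multiset.eq_replicate]
    constructor
    · have := congrArg Multiset.card h1
      rw [Multiset.card_add] at this
      unfold countAbove
      rw [Multiset.countP_eq_card_filter]
      omega
    · intro x hx
      have h3 := (Multiset.mem_filter.1 hx)
      have := h x h3.1
      omega
  rw [← h2, h1]

lemma map_pred_filter_eq (t : ℕ) (s : Multiset ℕ) :
    (s.filter (fun x => t < x)).map Nat.pred =
      (lowerAbove t s).filter (fun x => t < x) +
        Multiset.replicate (countAbove s t - countAbove (lowerAbove t s) t) t := by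
  have hA : ∀ x ∈ (s.filter (fun x => t < x)).map Nat.pred, t ≤ x := by
    intro x hx
    obtain ⟨y, hy, rfl⟩ := Multiset.mem_map.1 hx
    exact Nat.le_pred_of_lt (Multiset.mem_filter.1 hy).2
  have hB : (s.filter (fun x => ¬ t < x)).filter (fun x => t < x) = 0 := by
    rw [Multiset.filter_eq_nil]
    intro x hx
    exact (Multiset.mem_filter.1 hx).2
  have hF : (lowerAbove t s).filter (fun x => t < x) =
      ((s.filter (fun x => t < x)).map Nat.pred).filter (fun x => t < x) := by
    unfold lowerAbove
    rw [Multiset.filter_add, hB, zero_add]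
  have h := eq_filter_add_replicate hA
  unfold countAbove at h ⊢
  rw [Multiset.countP_eq_card_filter _ (lowerAbove t s), hF, ← Multiset.countP_eq_card_filter]
  rwa [Multiset.card_map, ← Multiset.countP_eq_card_filter] at h

lemma lowerAbove_injective {t : ℕ} {s r : Multiset ℕ} (h : lowerAbove t s = lowerAbove t r)
    (hc : countAbove s t = countAbove r t) : s = r := by
  have hA : (s.filter (fun x => t < x)).map Nat.pred = (r.filter (fun x => t < x)).map Nat.pred := by
    rw [map_pred_filter_eq, map_pred_filter_eq, h, hc]
  have hB : s.filter (fun x => ¬ t < x) = r.filter (fun x => ¬ t < x) := by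
    unfold lowerAbove at h
    rw [hA] at h
    exact add_right_cancel h
  have hpos : ∀ u : Multiset ℕ, ∀ x ∈ u.filter (fun x => t < x), 0 < x := fun u x hx => by
    have := (Multiset.mem_filter.1 hx).2
    omega
  have hA' := congrArg (Multiset.map Nat.succ) hA
  rw [map_succ_map_pred (hpos s), map_succ_map_pred (hpos r)] at hA'
  rw [← Multiset.filter_add_not (fun x => t < x) s, hA', hB, Multiset.filter_add_not]

lemma exists_lowerAbove_eq {t d : ℕ} {r : Multiset ℕ} (h1 : countAbove r t ≤ d)
    (h2 : d ≤ countAbove r t + r.count t) (h0 : 0 ∉ r) :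
    ∃ s, lowerAbove t s = r ∧ countAbove s t = d ∧ 0 ∉ s := by
  set A := r.filter (fun x => t < x) + Multiset.replicate (d - countAbove r t) t with hA
  have hAr : A ≤ r := by
    rw [Multiset.le_iff_count]
    intro x
    rw [hA, Multiset.count_add, Multiset.count_filter, Multiset.count_replicate]
    split_ifs with h3 h4 h4
    · omega
    · omega
    · subst h4
      omega
    · omega
  obtain ⟨B, hB⟩ := Multiset.le_iff_exists_add.1 hAr
  have hBle : ∀ x ∈ B, ¬ t < x := by
    intro x hx hlt
    have h3 := congrArg (Multiset.count x) hB
    rw [hA, Multiset.count_add, Multiset.count_add, Multiset.count_filter, if_pos hlt] at h3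
    have := Multiset.count_pos.2 hx
    omega
  have hAge : ∀ x ∈ A.map Nat.succ, t < x := by
    intro x hx
    obtain ⟨y, hy, rfl⟩ := Multiset.mem_map.1 hx
    rw [hA, Multiset.mem_add] at hy
    rcases hy with hy | hy
    · exact Nat.lt_succ_of_lt (Multiset.mem_filter.1 hy).2
    · rw [Multiset.eq_of_mem_replicate hy]
      exact Nat.lt_succ_self t
  refine ⟨B + A.map Nat.succ, ?_, ?_, ?_⟩
  · unfold lowerAbove
    rw [Multiset.filter_add, Multiset.filter_add, Multiset.filter_eq_self.2 hBle,
      (Multiset.filter_eq_nil (s := B)).2 hBle, Multiset.filter_eq_self.2 hAge,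
      Multiset.filter_eq_nil.2 (fun x hx => not_not.2 (hAge x hx)), Multiset.map_add,
      Multiset.map_map]
    simp [hB, add_comm]
  · rw [countAbove_add, countAbove_eq_zero (fun x hx => not_lt.1 (hBle x hx)),
      countAbove_eq_card hAge, Multiset.card_map, hA, Multiset.card_add,
      ← Multiset.countP_eq_card_filter, Multiset.card_replicate]
    unfold countAbove at *
    omega
  · rw [Multiset.mem_add]
    rintro (h | h)
    · exact h0 (by rw [hB]; simp [h])
    · simp at h

lemma isDurfee_lowerAbove {k d : ℕ} {s : Multiset ℕ} (h : countAbove s (d + k + 1) = d) :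
    IsDurfee k (lowerAbove (d + k + 1) s) d := by
  have hle : ∀ x ∈ s.filter (fun x => ¬ d + k + 1 < x), x ≤ d + k + 1 :=
    fun x hx => not_lt.1 (Multiset.mem_filter.1 hx).2
  have hcard : ((s.filter (fun x => d + k + 1 < x)).map Nat.pred).card = d := by
    rw [Multiset.card_map, ← Multiset.countP_eq_card_filter]
    exact h
  constructor
  · unfold lowerAbove
    rw [countAbove_add, countAbove_eq_card (s := Multiset.map _ _), hcard]
    · omega
    · intro x hx
      obtain ⟨y, hy, rfl⟩ := Multiset.mem_map.1 hx
      have := (Multiset.mem_filter.1 hy).2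
      rw [Nat.pred_eq_sub_one]
      omega
  · unfold lowerAbove
    rw [show d + 1 + k = d + k + 1 by ring, countAbove_add, countAbove_eq_zero hle, zero_add]
    exact (countAbove_le_card _ _).trans hcard.le

lemma card_durfeePair (k m : ℕ) :
    Nat.card (DurfeePair k (m + k + 1)) =
      Nat.card {P : Nat.Partition m // ∃ d, countAbove P.parts (d + k + 1) = d} := by
  symm
  let f : {P : Nat.Partition m // ∃ d, countAbove P.parts (d + k + 1) = d} →
      DurfeePair k (m + k + 1) := fun P =>
    ⟨(lowerAbove (P.2.choose + k + 1) P.1.parts, P.2.choose), by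
      unfold lowerAbove
      rw [Multiset.mem_add]
      rintro (h | h)
      · exact P.1.zero_notMem_parts (Multiset.mem_filter.1 h).1
      · obtain ⟨y, hy, hy0⟩ := Multiset.mem_map.1 h
        have := (Multiset.mem_filter.1 hy).2
        rw [Nat.pred_eq_sub_one] at hy0
        omega, isDurfee_lowerAbove P.2.choose_spec, by
      have h1 := sum_lowerAbove (P.2.choose + k + 1) P.1.parts
      rw [P.2.choose_spec, P.1.parts_sum] at h1
      simp only
      omega⟩
  refine Nat.card_congr (Equiv.ofBijective f ⟨?_, ?_⟩)
  · intro P Q h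
    have h1 : P.2.choose = Q.2.choose := congrArg (fun x => x.1.2) h
    have h2 : lowerAbove (P.2.choose + k + 1) P.1.parts =
      lowerAbove (Q.2.choose + k + 1) Q.1.parts := congrArg (fun x => x.1.1) h
    have h3 := P.2.choose_spec
    have h4 := Q.2.choose_spec
    rw [← h1] at h2 h4
    exact Subtype.ext (Nat.Partition.ext (lowerAbove_injective h2 (h3.trans h4.symm)))
  · rintro ⟨⟨r, d⟩, h0, ⟨h1, h2⟩, hsum⟩
    simp only at h0 h1 h2 hsum
    rw [show d + 1 + k = d + k + 1 by ring] at h2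
    rw [countAbove_eq_succ_add_count] at h1
    obtain ⟨s, hs, hc, hs0⟩ := exists_lowerAbove_eq h2 h1 h0
    have hss := sum_lowerAbove (d + k + 1) s
    rw [hs, hc] at hss
    have hex : ∃ e, countAbove s (e + k + 1) = e := ⟨d, hc⟩
    have hd : hex.choose = d := by
      have he := hex.choose_spec
      rcases le_total hex.choose d with h | h
      · have := countAbove_antitone s (show hex.choose + k + 1 ≤ d + k + 1 by omega)
        omega
      · have := countAbove_antitone s (show d + k + 1 ≤ hex.choose + k + 1 by omega)
        omega
    refine ⟨⟨partitionOfParts s hs0 (by omega), hex⟩, ?_⟩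
    apply Subtype.ext
    change (lowerAbove (hex.choose + k + 1) s, hex.choose) = (r, d)
    rw [hd, hs]

lemma card_durfeePair_add (k m : ℕ) :
    Nat.card (DurfeePair k (m + k + 1)) + Nat.card (DurfeePair (k + 1) m) =
      Nat.card (Nat.Partition m) := by
  rw [card_durfeePair, card_durfeePair_succ]
  exact card_subtype_add_card_compl _

/-- The smallest integer larger than `k` that does not belong to `s`. -/
noncomputable def mexAbove (k : ℕ) (s : Multiset ℕ) : ℕ := sInf {j : ℕ | k < j ∧ j ∉ s}

lemma mexAbove_of_notMem {k : ℕ} {s : Multiset ℕ} (h : k + 1 ∉ s) : mexAbove k s = k + 1 := by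
  refine le_antisymm (Nat.sInf_le ⟨Nat.lt_succ_self k, h⟩) ?_
  exact (Nat.sInf_mem (s := {j : ℕ | k < j ∧ j ∉ s}) ⟨k + 1, Nat.lt_succ_self k, h⟩).1

lemma mexAbove_cons (k : ℕ) (s : Multiset ℕ) :
    mexAbove k ((k + 1) ::ₘ s) = mexAbove (k + 1) s := by
  unfold mexAbove
  congr 1
  ext j
  simp only [Set.mem_ofPred_eq, Multiset.mem_cons, not_or]
  constructor
  · rintro ⟨h1, h2, h3⟩
    exact ⟨by omega, h3⟩
  · rintro ⟨h1, h2⟩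
    exact ⟨by omega, by omega, h2⟩

lemma mem_of_even_mexAbove {k : ℕ} {s : Multiset ℕ} (h : Even (mexAbove k s + k)) : k + 1 ∈ s := by
  by_contra hk
  rw [mexAbove_of_notMem hk, Nat.even_iff] at h
  omega

lemma card_even_mexAbove_add (k m : ℕ) :
    Nat.card {P : Nat.Partition (m + k + 1) // Even (mexAbove k P.parts + k)} +
      Nat.card {P : Nat.Partition m // Even (mexAbove (k + 1) P.parts + (k + 1))} =
      Nat.card (Nat.Partition m) := by
  rw [← card_subtype_add_card_compl
    (fun P : Nat.Partition m => Even (mexAbove (k + 1) P.parts + (k + 1))), add_comm]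
  congr 1
  symm
  let f : {P : Nat.Partition m // ¬ Even (mexAbove (k + 1) P.parts + (k + 1))} →
      {P : Nat.Partition (m + k + 1) // Even (mexAbove k P.parts + k)} := fun P =>
    ⟨partitionOfParts ((k + 1) ::ₘ P.1.parts)
      (by
        have := P.1.zero_notMem_parts
        simp [this])
      (by
        rw [Multiset.sum_cons, P.1.parts_sum]
        ring), by
      change Even (mexAbove k ((k + 1) ::ₘ P.1.parts) + k)
      have := P.2
      rw [mexAbove_cons]
      rw [Nat.even_iff] at this ⊢
      omega⟩
  refine Nat.card_congr (Equiv.ofBijective f ⟨?_, ?_⟩)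
  · intro P Q h
    have h1 : (k + 1) ::ₘ P.1.parts = (k + 1) ::ₘ Q.1.parts := congrArg (fun x => x.1.parts) h
    exact Subtype.ext (Nat.Partition.ext ((Multiset.cons_inj_right _).1 h1))
  · rintro ⟨P, hP⟩
    obtain ⟨r, hr⟩ := Multiset.exists_cons_of_mem (mem_of_even_mexAbove hP)
    have hsum := P.parts_sum
    rw [hr, Multiset.sum_cons] at hsum
    refine ⟨⟨partitionOfParts r (fun h => P.zero_notMem_parts (by rw [hr]; simp [h]))
      (by omega), ?_⟩, ?_⟩
    · change ¬ Even (mexAbove (k + 1) r + (k + 1))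
      rw [hr, mexAbove_cons, Nat.even_iff] at hP
      rw [Nat.even_iff]
      omega
    · exact Subtype.ext (Nat.Partition.ext hr.symm)

lemma card_durfeePair_eq_card_even_mexAbove (n k : ℕ) :
    Nat.card (DurfeePair k n) =
      Nat.card {P : Nat.Partition n // Even (mexAbove k P.parts + k)} := by
  induction n using Nat.strong_induction_on generalizing k with
  | _ n ih =>
    rcases Nat.lt_or_ge k n with h | h
    · obtain ⟨m, rfl⟩ : ∃ m, n = m + k + 1 := ⟨n - k - 1, by omega⟩
      have h1 := card_durfeePair_add k m
      have h2 := card_even_mexAbove_add k m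
      rw [ih m (by omega) (k + 1)] at h1
      omega
    · have : IsEmpty (DurfeePair k n) := ⟨fun x => by
        have := x.2.2.2
        omega⟩
      have : IsEmpty {P : Nat.Partition n // Even (mexAbove k P.parts + k)} := ⟨fun P => by
        have h1 := Multiset.single_le_sum (fun _ _ => Nat.zero_le _) _ (mem_of_even_mexAbove P.2)
        rw [P.1.parts_sum] at h1
        omega⟩
      rw [Nat.card_of_isEmpty, Nat.card_of_isEmpty]

/-- The number of partitions of `n` with nonnegative crank equals the number of
partitions of `n` with odd mex. -/
theorem stmt_0 (n : ℕ) (hn : 1 ≤ n) :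
    Nat.card {P : Nat.Partition n // 0 ≤ crank P} =
      Nat.card {P : Nat.Partition n // Odd (partMex P)} := by
  have h1 := card_subtype_add_card_compl (fun P : Nat.Partition n => crank P < 0)
  have h2 := card_subtype_add_card_compl (fun P : Nat.Partition n => Even (partMex P))
  simp only [not_lt, Nat.not_even_iff_odd] at h1 h2
  have h3 : Nat.card {P : Nat.Partition n // crank P < 0} =
      Nat.card {P : Nat.Partition n // Even (partMex P)} :=
    (card_crank_neg n).trans (card_durfeePair_eq_card_even_mexAbove n 0)
  omega
end

section
/- For all integers n ≥ 2 and j ≥ 0, the number of partitions λ of n with crank(λ) ≥ j equals the alternating sum ∑_{k≥0} (−1)^k p(n − k(k+1)/2 − j(k+1)), where p(m) is the number of partitions of m and p(m) = 0 for m < 0 (the sum has finitely many nonzero terms). -/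
/-- The partition-counting function, extended by `0` to negative arguments. -/
noncomputable def pZ (m : ℤ) : ℤ :=
  if 0 ≤ m then (Nat.card (Nat.Partition m.toNat) : ℤ) else 0

open PowerSeries

/-- The number of multisets of positive integers with sum `n` that satisfy `S`. -/
noncomputable def multisetCount (S : Multiset ℕ → Prop) (n : ℕ) : ℕ :=
  {m : Multiset ℕ | (∀ x ∈ m, 0 < x) ∧ m.sum = n ∧ S m}.ncard

/-- The generating function, by sum, of the multisets of positive integers that satisfy `S`. -/
noncomputable def multisetGF (S : Multiset ℕ → Prop) : ℤ⟦X⟧ :=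
  PowerSeries.mk fun n => (multisetCount S n : ℤ)

theorem natCard_partition_eq_multisetCount (S : Multiset ℕ → Prop) (n : ℕ) :
    Nat.card {P : Nat.Partition n // S P.parts} = multisetCount S n := by
  rw [multisetCount, ← Nat.card_coe_set_eq]
  exact Nat.card_congr
    { toFun := fun P => ⟨P.1.parts, fun x hx => P.1.parts_pos hx, P.1.parts_sum, P.2⟩
      invFun := fun m => ⟨⟨m.1, fun {x} hx => m.2.1 x hx, m.2.2.1⟩, m.2.2.2⟩
      left_inv := fun _ => rfl
      right_inv := fun _ => rfl }

theorem finite_multiset_of_sum (S : Multiset ℕ → Prop) (n : ℕ) :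
    {m : Multiset ℕ | (∀ x ∈ m, 0 < x) ∧ m.sum = n ∧ S m}.Finite :=
  (Set.finite_range fun P : Nat.Partition n => P.parts).subset
    fun m hm => ⟨⟨m, fun {x} hx => hm.1 x hx, hm.2.1⟩, rfl⟩

theorem multisetCount_congr {S T : Multiset ℕ → Prop} {n : ℕ}
    (h : ∀ m : Multiset ℕ, (∀ x ∈ m, 0 < x) → m.sum = n → (S m ↔ T m)) :
    multisetCount S n = multisetCount T n := by
  unfold multisetCount
  congr 1
  ext m
  exact and_congr_right fun hp => and_congr_right fun hs => h m hp hs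

theorem multisetGF_congr {S T : Multiset ℕ → Prop}
    (h : ∀ m : Multiset ℕ, (∀ x ∈ m, 0 < x) → (S m ↔ T m)) : multisetGF S = multisetGF T := by
  ext n
  simp only [multisetGF, coeff_mk]
  rw [multisetCount_congr fun m hp _ => h m hp]

theorem multisetCount_eq_zero {S : Multiset ℕ → Prop} {n : ℕ}
    (h : ∀ m : Multiset ℕ, (∀ x ∈ m, 0 < x) → m.sum = n → ¬ S m) : multisetCount S n = 0 := by
  rw [multisetCount, Set.ncard_eq_zero (finite_multiset_of_sum S n)]
  ext m
  simpa using h m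

theorem multisetCount_split (S Q : Multiset ℕ → Prop) (n : ℕ) :
    multisetCount S n =
      multisetCount (fun m => Q m ∧ S m) n + multisetCount (fun m => ¬ Q m ∧ S m) n := by
  unfold multisetCount
  rw [← Set.ncard_union_eq _ (finite_multiset_of_sum _ n) (finite_multiset_of_sum _ n)]
  · congr 1
    ext m
    simp only [Set.mem_ofPred_eq, Set.mem_union]
    tauto
  · rw [Set.disjoint_left]
    rintro m ⟨_, _, hQ, _⟩ ⟨_, _, hQ', _⟩
    exact hQ' hQ

theorem multisetGF_split (S Q : Multiset ℕ → Prop) :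
    multisetGF S = multisetGF (fun m => Q m ∧ S m) + multisetGF (fun m => ¬ Q m ∧ S m) := by
  ext n
  simp only [multisetGF, coeff_mk, map_add]
  exact_mod_cast multisetCount_split S Q n

theorem multisetCount_eq_sum (S : Multiset ℕ → Prop) (f : Multiset ℕ → ℕ) (n N : ℕ)
    (hN : ∀ m : Multiset ℕ, (∀ x ∈ m, 0 < x) → m.sum = n → f m < N) :
    multisetCount S n = ∑ w ∈ Finset.range N, multisetCount (fun m => f m = w ∧ S m) n := by
  have key : ∀ M : ℕ, multisetCount S n =
      ∑ w ∈ Finset.range M, multisetCount (fun m => f m = w ∧ S m) n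
        + multisetCount (fun m => M ≤ f m ∧ S m) n := by
    intro M
    induction M with
    | zero => simp
    | succ M ih =>
      rw [ih, Finset.sum_range_succ, add_assoc,
        multisetCount_split (fun m => M ≤ f m ∧ S m) (fun m => f m = M)]
      congr 2
      · exact multisetCount_congr fun m _ _ => by grind
      · exact multisetCount_congr fun m _ _ => by grind
  rw [key N, multisetCount_eq_zero, add_zero]
  intro m hp hs h
  exact absurd (hN m hp hs) (by omega)

/-- An injection that raises the sum by `d` multiplies generating functions by `X ^ d`. -/
theorem multisetGF_of_bijOn {S T : Multiset ℕ → Prop} {d : ℕ} (g : Multiset ℕ → Multiset ℕ)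
    (hg : Function.Injective g) (hsum : ∀ m, S m → (g m).sum = m.sum + d)
    (hmap : ∀ m, (∀ x ∈ m, 0 < x) → S m → (∀ x ∈ g m, 0 < x) ∧ T (g m))
    (hsurj : ∀ m, (∀ x ∈ m, 0 < x) → T m → ∃ m', (∀ x ∈ m', 0 < x) ∧ S m' ∧ g m' = m) :
    multisetGF T = X ^ d * multisetGF S := by
  ext n
  rw [coeff_X_pow_mul']
  simp only [multisetGF, coeff_mk]
  split_ifs with hd
  · congr 1
    unfold multisetCount
    refine Eq.trans ?_ (Set.ncard_image_of_injective _ hg)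
    congr 1
    ext m
    constructor
    · rintro ⟨hp, hs, hT⟩
      obtain ⟨m', hp', hS', rfl⟩ := hsurj m hp hT
      have := hsum m' hS'
      exact ⟨m', ⟨hp', by omega, hS'⟩, rfl⟩
    · rintro ⟨m', ⟨hp', hs', hS'⟩, rfl⟩
      have := hsum m' hS'
      exact ⟨(hmap m' hp' hS').1, by omega, (hmap m' hp' hS').2⟩
  · rw [multisetCount_eq_zero, Nat.cast_zero]
    intro m hp hs hT
    obtain ⟨m', _, hS', rfl⟩ := hsurj m hp hT
    have := hsum m' hS'
    omega

theorem multisetGF_mem_and (S : Multiset ℕ → Prop) {v : ℕ} (hv : 0 < v) :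
    multisetGF (fun m => v ∈ m ∧ S m) = X ^ v * multisetGF (fun m => S (v ::ₘ m)) := by
  refine multisetGF_of_bijOn (fun m => v ::ₘ m) (fun _ _ h => (Multiset.cons_inj_right v).1 h) ?_ ?_ ?_
  · intro m _
    simp [add_comm]
  · intro m hp hS
    refine ⟨?_, Multiset.mem_cons_self v m, hS⟩
    simpa using ⟨hv, hp⟩
  · rintro m hp ⟨hvm, hS⟩
    obtain ⟨m', rfl⟩ := Multiset.exists_cons_of_mem hvm
    exact ⟨m', fun x hx => hp x (Multiset.mem_cons_of_mem hx), hS, rfl⟩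

/-- If membership in `S` is insensitive to parts `v`, then forbidding parts `v` multiplies
the generating function by `1 - X ^ v`. -/
theorem multisetGF_notMem_and {S : Multiset ℕ → Prop} {v : ℕ} (hv : 0 < v)
    (h : ∀ m, S (v ::ₘ m) ↔ S m) :
    multisetGF (fun m => v ∉ m ∧ S m) = (1 - X ^ v) * multisetGF S := by
  have h1 := multisetGF_split S (fun m => v ∈ m)
  rw [multisetGF_mem_and S hv, multisetGF_congr fun m _ => h m] at h1
  linear_combination -h1

theorem one_sub_X_pow_ne_zero {v : ℕ} (hv : 0 < v) : (1 - X ^ v : ℤ⟦X⟧) ≠ 0 := by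
  intro h
  have := congrArg (coeff 0) h
  simp [hv.ne'] at this

/-- The generating function of the partitions with parts at most `k`. -/
noncomputable def boundedGF (k : ℕ) : ℤ⟦X⟧ := multisetGF fun m => ∀ x ∈ m, x ≤ k

theorem multisetGF_eq_zero_multiset : multisetGF (fun m => m = 0) = 1 := by
  ext n
  simp only [multisetGF, coeff_mk, coeff_one]
  split_ifs with hn
  · subst hn
    rw [multisetCount, show {m : Multiset ℕ | (∀ x ∈ m, 0 < x) ∧ m.sum = 0 ∧ m = 0} = {0} by
      ext m
      simp only [Set.mem_ofPred_eq, Set.mem_singleton_iff]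
      constructor
      · tauto
      · rintro rfl
        simp]
    simp
  · rw [multisetCount_eq_zero, Nat.cast_zero]
    rintro m _ hs rfl
    simp at hs
    omega

theorem boundedGF_zero : boundedGF 0 = 1 := by
  rw [boundedGF, ← multisetGF_eq_zero_multiset]
  refine multisetGF_congr fun m hp => ⟨fun h => ?_, fun h => by simp [h]⟩
  refine Multiset.eq_zero_of_forall_notMem fun x hx => ?_
  have := hp x hx
  have := h x hx
  omega

theorem one_sub_mul_boundedGF_succ (k : ℕ) :
    (1 - X ^ (k + 1)) * boundedGF (k + 1) = boundedGF k := by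
  rw [boundedGF, ← multisetGF_notMem_and (Nat.add_one_pos k) (by simp)]
  refine multisetGF_congr fun m _ => ?_
  constructor
  · rintro ⟨h1, h2⟩ x hx
    have := h2 x hx
    have : x ≠ k + 1 := by rintro rfl; exact h1 hx
    omega
  · intro h
    exact ⟨fun h1 => by have := h _ h1; omega, fun x hx => (h x hx).trans k.le_succ⟩

theorem multisetGF_lt_and_card (w r : ℕ) :
    multisetGF (fun m => (∀ x ∈ m, w < x) ∧ m.card = r) =
      X ^ (r * w) * multisetGF fun m => m.card = r := by
  refine multisetGF_of_bijOn (Multiset.map (· + w))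
    (Multiset.map_injective (add_left_injective w)) ?_ ?_ ?_
  · rintro m rfl
    simp [Multiset.sum_map_add]
  · rintro m hp rfl
    simp only [Multiset.mem_map, forall_exists_index, and_imp, Multiset.card_map, and_true]
    constructor
    · rintro _ y hy rfl
      have := hp y hy
      omega
    · rintro _ y hy rfl
      have := hp y hy
      omega
  · rintro m hp ⟨hw, hr⟩
    refine ⟨m.map (· - w), ?_, by simpa using hr, ?_⟩
    · simp only [Multiset.mem_map, forall_exists_index, and_imp]
      rintro _ y hy rfl
      have := hw y hy
      omega
    · rw [Multiset.map_map]
      conv_rhs => rw [← Multiset.map_id m]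
      refine Multiset.map_congr rfl fun x hx => ?_
      have := hw x hx
      simp
      omega

theorem multisetGF_card (r : ℕ) : multisetGF (fun m => m.card = r) = X ^ r * boundedGF r := by
  induction r with
  | zero =>
    rw [boundedGF_zero, pow_zero, one_mul, ← multisetGF_eq_zero_multiset]
    exact multisetGF_congr fun m _ => Multiset.card_eq_zero
  | succ r ih =>
    have h1 := multisetGF_split (fun m => m.card = r + 1) (fun m => 1 ∈ m)
    have h2 : multisetGF (fun m => 1 ∉ m ∧ m.card = r + 1) =
        multisetGF (fun m => (∀ x ∈ m, 1 < x) ∧ m.card = r + 1) := by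
      refine multisetGF_congr fun m hp => and_congr_left fun _ => ⟨fun h x hx => ?_, ?_⟩
      · have := hp x hx
        have : x ≠ 1 := fun h' => h (h' ▸ hx)
        omega
      · intro h h'
        exact absurd (h 1 h') (lt_irrefl 1)
    have h3 : multisetGF (fun m => (1 ::ₘ m).card = r + 1) = multisetGF fun m => m.card = r :=
      multisetGF_congr fun m _ => by simp
    rw [multisetGF_mem_and _ one_pos, h2, multisetGF_lt_and_card, h3, ih,
      ← one_sub_mul_boundedGF_succ] at h1
    refine mul_left_cancel₀ (one_sub_X_pow_ne_zero (Nat.add_one_pos r)) ?_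
    rw [mul_one] at h1
    linear_combination h1

theorem multisetGF_card_filter_lt (w r : ℕ) :
    multisetGF (fun m => (m.filter (w < ·)).card = r) =
      X ^ (r * (w + 1)) * boundedGF w * boundedGF r := by
  have key : ∀ v ≤ w,
      multisetGF (fun m => (∀ x ∈ m, x ≤ v ∨ w < x) ∧ (m.filter (w < ·)).card = r) =
        X ^ (r * (w + 1)) * boundedGF v * boundedGF r := by
    intro v
    induction v with
    | zero =>
      intro _
      rw [multisetGF_congr (T := fun m => (∀ x ∈ m, w < x) ∧ m.card = r),
        multisetGF_lt_and_card, multisetGF_card, boundedGF_zero]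
      · ring
      · intro m hp
        constructor
        · rintro ⟨h1, h2⟩
          have h3 : ∀ x ∈ m, w < x := fun x hx => by
            have := hp x hx
            have := h1 x hx
            omega
          rw [Multiset.filter_eq_self.2 h3] at h2
          exact ⟨h3, h2⟩
        · rintro ⟨h1, h2⟩
          rw [Multiset.filter_eq_self.2 h1]
          exact ⟨fun x hx => Or.inr (h1 x hx), h2⟩
    | succ v ih =>
      intro hv
      refine mul_left_cancel₀ (one_sub_X_pow_ne_zero (Nat.add_one_pos v)) ?_
      rw [← multisetGF_notMem_and (Nat.add_one_pos v)]
      · have h1 := ih (by omega)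
        rw [← one_sub_mul_boundedGF_succ] at h1
        rw [multisetGF_congr fun m _ => ?_]
        · linear_combination h1
        · rw [← and_assoc]
          refine and_congr_left fun _ => ⟨?_, ?_⟩
          · rintro ⟨h1, h2⟩ x hx
            have := h2 x hx
            have : x ≠ v + 1 := by rintro rfl; exact h1 hx
            omega
          · intro h
            refine ⟨fun h1 => ?_, fun x hx => ?_⟩
            · have := h _ h1
              omega
            · have := h x hx
              omega
      · intro m
        have : ¬ w < v + 1 := by omega
        simp [this]
  rw [← key w le_rfl]
  refine multisetGF_congr fun m _ => ?_
  have : ∀ x ∈ m, x ≤ w ∨ w < x := fun x _ => le_or_gt x w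
  tauto

theorem multisetGF_count_one_and {S : Multiset ℕ → Prop} (h : ∀ m, S (1 ::ₘ m) ↔ S m) (w : ℕ) :
    multisetGF (fun m => m.count 1 = w ∧ S m) = X ^ w * (1 - X) * multisetGF S := by
  induction w with
  | zero =>
    have := multisetGF_notMem_and one_pos h
    rw [pow_one] at this
    rw [pow_zero, one_mul, ← this]
    exact multisetGF_congr fun m _ => by rw [Multiset.count_eq_zero]
  | succ w ih =>
    have h1 := multisetGF_mem_and (fun m => m.count 1 = w + 1 ∧ S m) one_pos
    have h2 : multisetGF (fun m => (1 ::ₘ m).count 1 = w + 1 ∧ S (1 ::ₘ m)) =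
        multisetGF fun m => m.count 1 = w ∧ S m :=
      multisetGF_congr fun m _ => by simp [h]
    rw [h2, ih] at h1
    rw [multisetGF_congr (T := fun m => 1 ∈ m ∧ m.count 1 = w + 1 ∧ S m), h1]
    · ring
    · intro m _
      have : m.count 1 = w + 1 → 1 ∈ m := fun h => by
        rw [← Multiset.count_pos]
        omega
      tauto

/-- The summand `X ^ (w² + j w + a w) / ((X; X)_w (X; X)_{w + j})`. -/
noncomputable def durfeeTerm (j a w : ℕ) : ℤ⟦X⟧ :=
  X ^ (w * w + j * w + a * w) * boundedGF w * boundedGF (w + j)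

theorem coeff_X_pow_mul_eq_zero (f : ℤ⟦X⟧) {n d : ℕ} (h : n < d) : coeff n (X ^ d * f) = 0 := by
  rw [coeff_X_pow_mul', if_neg (by omega)]

theorem coeff_durfeeTerm_eq_zero {j a n w : ℕ} (h : n < w) : coeff n (durfeeTerm j a w) = 0 := by
  rw [durfeeTerm, mul_assoc]
  exact coeff_X_pow_mul_eq_zero _ (by nlinarith [Nat.zero_le (j * w), Nat.zero_le (a * w)])

open scoped PowerSeries.WithPiTopology

theorem summable_of_coeff_eq_zero {f : ℕ → ℤ⟦X⟧} (hf : ∀ n w, n < w → coeff n (f w) = 0) :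
    Summable f := by
  rw [WithPiTopology.summable_iff_summable_coeff]
  exact fun n => summable_of_ne_finset_zero (s := Finset.range (n + 1))
    fun w hw => hf n w (by simpa using hw)

theorem coeff_tsum_eq_sum_range {f : ℕ → ℤ⟦X⟧} (hf : ∀ n w, n < w → coeff n (f w) = 0) (n : ℕ) :
    coeff n (∑' w, f w) = ∑ w ∈ Finset.range (n + 1), coeff n (f w) := by
  have h := (WithPiTopology.hasSum_iff_hasSum_coeff ℤ).1 (summable_of_coeff_eq_zero hf).hasSum n
  rw [← h.tsum_eq]
  exact tsum_eq_sum fun w hw => hf n w (by simpa using hw)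

theorem summable_durfeeTerm (j a : ℕ) : Summable (durfeeTerm j a) :=
  summable_of_coeff_eq_zero fun _ _ => coeff_durfeeTerm_eq_zero

theorem tsum_sub_tsum_of_succ {f g h : ℕ → ℤ⟦X⟧} (hf : Summable f) (hg : Summable g) (hh : Summable h)
    (c : ℤ⟦X⟧) (h0 : f 0 = g 0) (hs : ∀ w, f (w + 1) - g (w + 1) = c * h w) :
    ∑' w, f w - ∑' w, g w = c * ∑' w, h w := by
  rw [hf.tsum_eq_zero_add, hg.tsum_eq_zero_add, h0, add_sub_add_left_eq_sub,
    ← ((summable_nat_add_iff 1).2 hf).tsum_sub ((summable_nat_add_iff 1).2 hg),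
    ← hh.tsum_mul_left]
  exact tsum_congr hs

theorem tsum_sub_tsum {f g h : ℕ → ℤ⟦X⟧} (hf : Summable f) (hg : Summable g) (hh : Summable h)
    (c : ℤ⟦X⟧) (hs : ∀ w, f w - g w = c * h w) :
    ∑' w, f w - ∑' w, g w = c * ∑' w, h w := by
  rw [← hf.tsum_sub hg, ← hh.tsum_mul_left]
  exact tsum_congr hs

/-- The series `∑ X ^ (w² + j w + a w) / ((X; X)_w (X; X)_{w + j})`. -/
noncomputable def durfeeSeries (j a : ℕ) : ℤ⟦X⟧ := ∑' w, durfeeTerm j a w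

theorem durfeeSeries_zero_sub_one (j : ℕ) :
    durfeeSeries j 0 - durfeeSeries j 1 = X ^ (j + 1) * durfeeSeries (j + 1) 1 := by
  refine tsum_sub_tsum_of_succ (summable_durfeeTerm _ _) (summable_durfeeTerm _ _)
    (summable_durfeeTerm _ _) _ (by simp [durfeeTerm]) fun w => ?_
  have h := one_sub_mul_boundedGF_succ w
  simp only [durfeeTerm]
  rw [show w + (j + 1) = w + 1 + j by ring]
  linear_combination X ^ ((w + 1) * (w + 1) + j * (w + 1)) * boundedGF (w + 1 + j) * h

theorem durfeeSeries_one_sub_two (j : ℕ) :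
    durfeeSeries j 1 - durfeeSeries j 2 = X ^ (j + 2) * durfeeSeries (j + 1) 2 := by
  refine tsum_sub_tsum_of_succ (summable_durfeeTerm _ _) (summable_durfeeTerm _ _)
    (summable_durfeeTerm _ _) _ (by simp [durfeeTerm]) fun w => ?_
  have h := one_sub_mul_boundedGF_succ w
  simp only [durfeeTerm]
  rw [show w + (j + 1) = w + 1 + j by ring]
  linear_combination X ^ ((w + 1) * (w + 1) + (j + 1) * (w + 1)) * boundedGF (w + 1 + j) * h

theorem durfeeSeries_succ_one_sub_two (j : ℕ) :
    durfeeSeries (j + 1) 1 - durfeeSeries j 2 = X ^ (j + 1) * durfeeSeries (j + 1) 2 := by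
  refine tsum_sub_tsum (summable_durfeeTerm _ _) (summable_durfeeTerm _ _)
    (summable_durfeeTerm _ _) _ fun w => ?_
  have h := one_sub_mul_boundedGF_succ (w + j)
  simp only [durfeeTerm, ← add_assoc]
  linear_combination X ^ (w * w + j * w + 2 * w) * boundedGF w * h

theorem one_sub_X_mul_durfeeSeries_two (j : ℕ) :
    (1 - X) * durfeeSeries j 2 = durfeeSeries j 1 - X * durfeeSeries (j + 1) 1 := by
  linear_combination X * durfeeSeries_succ_one_sub_two j - durfeeSeries_one_sub_two j

theorem durfeeSeries_zero_sub_succ (j : ℕ) :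
    durfeeSeries j 0 - durfeeSeries (j + 1) 0 =
      -X ^ (j + 1) * (durfeeSeries (j + 1) 0 - durfeeSeries (j + 2) 0) := by
  let K : ℕ → ℤ⟦X⟧ := fun w => X ^ (w * w + j * w) * boundedGF w * boundedGF (w + j + 1)
  have hK : Summable K := by
    refine summable_of_coeff_eq_zero fun n w hnw => ?_
    simp only [K]
    rw [mul_assoc]
    exact coeff_X_pow_mul_eq_zero _ (by nlinarith [Nat.zero_le (j * w)])
  have h1 : ∑' w, K w - durfeeSeries (j + 1) 0 = X ^ (j + 1) * durfeeSeries (j + 2) 0 := by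
    refine tsum_sub_tsum_of_succ hK (summable_durfeeTerm _ _)
      (summable_durfeeTerm _ _) _ (by simp [durfeeTerm, K]) fun w => ?_
    have h := one_sub_mul_boundedGF_succ w
    simp only [durfeeTerm, K]
    rw [show w + (j + 2) = w + 1 + j + 1 by ring, show w + 1 + (j + 1) = w + 1 + j + 1 by ring]
    linear_combination X ^ ((w + 1) * (w + 1) + j * (w + 1)) * boundedGF (w + 1 + j + 1) * h
  have h2 : ∑' w, K w - durfeeSeries j 0 = X ^ (j + 1) * durfeeSeries (j + 1) 0 := by
    refine tsum_sub_tsum hK (summable_durfeeTerm _ _) (summable_durfeeTerm _ _) _ fun w => ?_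
    have h := one_sub_mul_boundedGF_succ (w + j)
    simp only [durfeeTerm, K, ← add_assoc]
    linear_combination X ^ (w * w + j * w) * boundedGF w * h
  linear_combination h1 - h2

theorem durfeeSeries_succ_zero (j : ℕ) : durfeeSeries (j + 1) 0 = durfeeSeries j 0 := by
  have key : ∀ n i, coeff n (durfeeSeries i 0 - durfeeSeries (i + 1) 0) = 0 := by
    intro n
    induction n using Nat.strong_induction_on with
    | _ n ih =>
      intro i
      rw [durfeeSeries_zero_sub_succ, neg_mul, map_neg, coeff_X_pow_mul', neg_eq_zero]
      split_ifs with h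
      · exact ih _ (by omega) (i + 1)
      · rfl
  exact (sub_eq_zero.1 (PowerSeries.ext fun n => by simpa using key n j)).symm

/-- The generating function of all partitions. -/
noncomputable def partitionGF : ℤ⟦X⟧ := multisetGF fun _ => True

/-- The Durfee rectangle identity. -/
theorem durfeeSeries_zero (j : ℕ) : durfeeSeries j 0 = partitionGF := by
  have hconst : ∀ i, durfeeSeries i 0 = durfeeSeries 0 0 := fun i => by
    induction i with
    | zero => rfl
    | succ i ih => rw [durfeeSeries_succ_zero, ih]
  ext n
  rw [hconst j, ← hconst n, durfeeSeries,
    coeff_tsum_eq_sum_range fun _ _ => coeff_durfeeTerm_eq_zero, Finset.sum_range_succ',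
    Finset.sum_eq_zero, zero_add]
  · simp only [durfeeTerm, mul_zero, add_zero, zero_add, pow_zero, one_mul, boundedGF_zero]
    simp only [partitionGF, multisetGF, boundedGF, coeff_mk]
    congr 1
    refine multisetCount_congr fun m _ hs => ?_
    simp only [iff_true]
    exact fun x hx => hs ▸ Multiset.le_sum_of_mem hx
  · intro w _
    rw [durfeeTerm, mul_assoc]
    exact coeff_X_pow_mul_eq_zero _ (by nlinarith [Nat.zero_le (n * w), Nat.zero_le (w * w)])

theorem durfeeSeries_one_eq_sum (j K : ℕ) :
    durfeeSeries j 1 =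
      ∑ k ∈ Finset.range K, (-1) ^ k * (X ^ (k * (k + 1) / 2 + j * k) * partitionGF) +
        (-1) ^ K * (X ^ (K * (K + 1) / 2 + j * K) * durfeeSeries (j + K) 1) := by
  induction K with
  | zero => simp
  | succ K ih =>
    have h := durfeeSeries_zero_sub_one (j + K)
    rw [durfeeSeries_zero] at h
    have he : (K + 1) * (K + 1 + 1) / 2 = K * (K + 1) / 2 + (K + 1) := by
      rw [show (K + 1) * (K + 1 + 1) = K * (K + 1) + (K + 1) * 2 by ring]
      exact Nat.add_mul_div_right _ _ two_pos
    rw [ih, Finset.sum_range_succ, he, ← add_assoc j K 1]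
    linear_combination -(-1) ^ K * X ^ (K * (K + 1) / 2 + j * K) * h

theorem pZ_sub_eq_coeff (n d : ℕ) : pZ ((n : ℤ) - d) = coeff n (X ^ d * partitionGF) := by
  rw [pZ, coeff_X_pow_mul']
  by_cases h : d ≤ n
  · rw [if_pos (by omega), if_pos h, show ((n : ℤ) - d).toNat = n - d by omega, partitionGF,
      multisetGF, coeff_mk, ← natCard_partition_eq_multisetCount]
    exact congrArg _ (Nat.card_congr (Equiv.subtypeUnivEquiv fun _ => trivial).symm)
  · rw [if_neg (by omega), if_neg h]

theorem coeff_X_pow_mul_durfeeSeries_one (n j : ℕ) :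
    coeff n (X ^ j * durfeeSeries j 1) = ∑ k ∈ Finset.range (n + 1),
      (-1) ^ k * pZ ((n : ℤ) - (k * (k + 1) / 2 : ℕ) - (j * (k + 1) : ℕ)) := by
  have hneg : ∀ k : ℕ, ((-1) ^ k : ℤ⟦X⟧) = C ((-1) ^ k) := fun k => by simp
  rw [durfeeSeries_one_eq_sum j (n + 1), mul_add, map_add, Finset.mul_sum, map_sum]
  have h0 : coeff n (X ^ j * ((-1) ^ (n + 1) * (X ^ ((n + 1) * (n + 1 + 1) / 2 + j * (n + 1)) *
      durfeeSeries (j + (n + 1)) 1))) = 0 := by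
    rw [mul_left_comm, hneg, coeff_C_mul, ← mul_assoc, ← pow_add, coeff_X_pow_mul_eq_zero, mul_zero]
    have : (n + 1) * 2 / 2 ≤ (n + 1) * (n + 1 + 1) / 2 ∨ n = 0 := by
      rcases n with _ | n
      · exact Or.inr rfl
      · exact Or.inl (Nat.div_le_div_right (Nat.mul_le_mul_left _ (by omega)))
    rcases this with h | rfl
    · omega
    · simp
  rw [h0, add_zero]
  refine Finset.sum_congr rfl fun k _ => ?_
  rw [mul_left_comm, hneg, coeff_C_mul, ← mul_assoc, ← pow_add, sub_sub, ← Nat.cast_add,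
    pZ_sub_eq_coeff, show j + (k * (k + 1) / 2 + j * k) = k * (k + 1) / 2 + j * (k + 1) by
      rw [mul_add_one j k]
      omega]

/-- The crank of a multiset of positive integers. -/
def multisetCrank (m : Multiset ℕ) : ℤ :=
  if m.count 1 = 0 then (m.sup : ℤ)
  else ((m.filter (fun x => m.count 1 < x)).card : ℤ) - (m.count 1 : ℤ)

theorem multisetGF_sup {j : ℕ} (hj : 0 < j) :
    multisetGF (fun m => m.sup = j) = X ^ j * boundedGF j := by
  have h := multisetGF_mem_and (fun m => ∀ x ∈ m, x ≤ j) hj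
  have h2 : multisetGF (fun m => ∀ x ∈ j ::ₘ m, x ≤ j) = boundedGF j :=
    multisetGF_congr fun m _ => by simp
  rw [h2] at h
  rw [← h]
  refine multisetGF_congr fun m hp => ⟨?_, ?_⟩
  · rintro rfl
    refine ⟨?_, fun x hx => Multiset.le_sup hx⟩
    clear h h2 hp
    induction m using Multiset.induction with
    | empty => simp at hj
    | cons a m ih =>
      rw [Multiset.sup_cons] at hj ⊢
      rcases le_total m.sup a with h | h
      · simp [sup_eq_left.2 h]
      · rw [sup_eq_right.2 h] at hj ⊢
        exact Multiset.mem_cons_of_mem (ih hj)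
  · rintro ⟨hjm, hle⟩
    exact le_antisymm (Multiset.sup_le.2 hle) (Multiset.le_sup hjm)

theorem multisetCount_no_ones_and_sup {n : ℕ} (hn : 2 ≤ n) (j : ℕ) :
    (multisetCount (fun m => m.count 1 = 0 ∧ m.sup = j) n : ℤ) =
      coeff n (X ^ j * ((1 - X) * durfeeTerm j 2 0)) := by
  have ht : durfeeTerm j 2 0 = boundedGF j := by simp [durfeeTerm, boundedGF_zero]
  rw [ht]
  match j with
  | 0 =>
    rw [boundedGF_zero, multisetCount_eq_zero]
    · simp [coeff_one, coeff_X, show n ≠ 0 by omega, show n ≠ 1 by omega]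
    · rintro m hp hs ⟨_, h⟩
      have : m = 0 := Multiset.eq_zero_of_forall_notMem fun x hx => by
        have := hp x hx
        have := Multiset.le_sup hx
        omega
      subst this
      simp at hs
      omega
  | 1 =>
    have h1 := one_sub_mul_boundedGF_succ 0
    rw [zero_add, pow_one, boundedGF_zero] at h1
    rw [h1, multisetCount_eq_zero]
    · simp [coeff_X, show n ≠ 1 by omega]
    · rintro m hp hs ⟨h1, h⟩
      rw [Multiset.count_eq_zero] at h1
      have : m = 0 := Multiset.eq_zero_of_forall_notMem fun x hx => by
        have := hp x hx
        have := Multiset.le_sup hx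
        obtain rfl : x = 1 := by omega
        exact h1 hx
      subst this
      simp at h
  | j + 2 =>
    have h := multisetGF_count_one_and (S := fun m => m.sup = j + 2) (fun m => by simp; omega) 0
    rw [multisetGF_sup (by omega)] at h
    rw [show X ^ (j + 2) * ((1 - X) * boundedGF (j + 2)) =
      multisetGF (fun m => m.count 1 = 0 ∧ m.sup = j + 2) by rw [h]; ring, multisetGF, coeff_mk]

theorem multisetCount_count_one_and_crank {n : ℕ} (hn : 2 ≤ n) (j w : ℕ) :
    (multisetCount (fun m => m.count 1 = w ∧ multisetCrank m = j) n : ℤ) =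
      coeff n (X ^ j * ((1 - X) * durfeeTerm j 2 w)) := by
  rcases Nat.eq_zero_or_pos w with rfl | hw
  · rw [← multisetCount_no_ones_and_sup hn]
    congr 1
    refine multisetCount_congr fun m _ _ => and_congr_right fun h => ?_
    simp [multisetCrank, h]
  · have h := multisetGF_count_one_and (S := fun m => (m.filter (w < ·)).card = w + j)
      (fun m => by simp [show ¬ w < 1 by omega]) w
    rw [multisetGF_card_filter_lt] at h
    rw [show X ^ j * ((1 - X) * durfeeTerm j 2 w) =
      multisetGF (fun m => m.count 1 = w ∧ (m.filter (w < ·)).card = w + j) by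
        rw [h, durfeeTerm]; ring, multisetGF, coeff_mk]
    congr 1
    refine multisetCount_congr fun m _ _ => and_congr_right fun h => ?_
    simp only [multisetCrank, h, if_neg hw.ne']
    omega

theorem card_le_sum_of_pos {m : Multiset ℕ} (hp : ∀ x ∈ m, 0 < x) : m.card ≤ m.sum := by
  simpa using Multiset.card_nsmul_le_sum (a := 1) hp

theorem multisetCount_crank_eq {n : ℕ} (hn : 2 ≤ n) (j : ℕ) :
    (multisetCount (fun m => multisetCrank m = j) n : ℤ) =
      coeff n (X ^ j * ((1 - X) * durfeeSeries j 2)) := by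
  have hle : ∀ m : Multiset ℕ, (∀ x ∈ m, 0 < x) → m.sum = n → m.count 1 < n + 1 := by
    rintro m hp rfl
    exact Nat.lt_succ_of_le ((Multiset.count_le_card 1 m).trans (card_le_sum_of_pos hp))
  have hs : X ^ j * ((1 - X) * durfeeSeries j 2) =
      ∑' w, X ^ j * ((1 - X) * durfeeTerm j 2 w) := by
    rw [((summable_durfeeTerm j 2).mul_left _).tsum_mul_left, (summable_durfeeTerm j 2).tsum_mul_left,
      durfeeSeries]
  rw [hs, coeff_tsum_eq_sum_range, multisetCount_eq_sum _ (fun m => m.count 1) n (n + 1) hle,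
    Nat.cast_sum]
  · exact Finset.sum_congr rfl fun w _ => multisetCount_count_one_and_crank hn j w
  · intro n w hnw
    rw [durfeeTerm, show X ^ j * ((1 - X) * (X ^ (w * w + j * w + 2 * w) * boundedGF w *
      boundedGF (w + j))) = X ^ (w * w + j * w + 2 * w + j) *
        ((1 - X) * boundedGF w * boundedGF (w + j)) by ring]
    exact coeff_X_pow_mul_eq_zero _ (by nlinarith [Nat.zero_le (j * w), Nat.zero_le (w * w)])

theorem multisetCrank_le_sum {m : Multiset ℕ} (hp : ∀ x ∈ m, 0 < x) :
    multisetCrank m ≤ m.sum := by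
  rw [multisetCrank]
  split_ifs
  · exact_mod_cast Multiset.sup_le.2 fun x hx => Multiset.le_sum_of_mem hx
  · have h1 := Multiset.card_le_card (Multiset.filter_le (fun x => m.count 1 < x) m)
    have h2 := card_le_sum_of_pos hp
    omega

theorem multisetCount_le_crank {n : ℕ} (hn : 2 ≤ n) (j : ℕ) :
    (multisetCount (fun m => (j : ℤ) ≤ multisetCrank m) n : ℤ) =
      coeff n (X ^ j * durfeeSeries j 1) := by
  by_cases hj : n < j
  · rw [coeff_X_pow_mul_eq_zero _ hj, multisetCount_eq_zero, Nat.cast_zero]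
    intro m hp hs h
    have := multisetCrank_le_sum hp
    omega
  · have ih := multisetCount_le_crank hn (j + 1)
    have h := one_sub_X_mul_durfeeSeries_two j
    have h2 : X ^ j * durfeeSeries j 1 =
        X ^ j * ((1 - X) * durfeeSeries j 2) + X ^ (j + 1) * durfeeSeries (j + 1) 1 := by
      linear_combination -X ^ j * h
    rw [h2, map_add, ← ih, ← multisetCount_crank_eq hn,
      multisetCount_split _ (fun m => multisetCrank m = j), Nat.cast_add]
    congr 2
    · exact multisetCount_congr fun m _ _ => by omega
    · exact multisetCount_congr fun m _ _ => by push_cast; omega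
  termination_by n + 1 - j

/-- The number of partitions of `n` with crank at least `j` equals the alternating sum
`∑_{k ≥ 0} (-1)^k p(n - k(k+1)/2 - j(k+1))`; all terms with `k > n` vanish. -/
theorem stmt_1 (n j : ℕ) (hn : 2 ≤ n) :
    (Nat.card {P : Nat.Partition n // (j : ℤ) ≤ crank P} : ℤ) =
      ∑ k ∈ Finset.range (n + 1),
        (-1) ^ k * pZ ((n : ℤ) - (k * (k + 1) / 2 : ℕ) - (j * (k + 1) : ℕ)) := by
  rw [← coeff_X_pow_mul_durfeeSeries_one, ← multisetCount_le_crank hn,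
    ← natCard_partition_eq_multisetCount]
  rfl
end

section
/- For every integer n ≥ 0, the alternating sum ∑_{k≥0} (−1)^{k(k+1)/2} p(n − k(k+1)/2) equals the number of partitions of n into distinct even parts. -/
open Finset PowerSeries
open scoped PowerSeries.WithPiTopology

/-- Shanks' finite form of Gauss' identity for the triangular theta series, cleared of
denominators. -/
theorem prod_one_sub_odd_pow_mul_sum_pow_triangular {R : Type*} [CommRing R] (q : R) (n : ℕ) :
    (∏ r ∈ range n, (1 - q ^ (2 * r + 1))) * ∑ k ∈ range (2 * n), q ^ (k * (k + 1) / 2) =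
      ∑ s ∈ range n, (∏ r ∈ Ico s n, (1 - q ^ (2 * r + 2))) *
        (∏ r ∈ range s, (1 - q ^ (2 * r + 1))) * q ^ (s * (2 * n + 1)) := by
  induction n with
  | zero => simp
  | succ n ih =>
    set D : ℕ → R := fun s ↦ ∏ r ∈ range s, (1 - q ^ (2 * r + 1)) with hD
    set g : ℕ → R := fun s ↦ (∏ r ∈ Ico s n, (1 - q ^ (2 * r + 2))) * D s *
      q ^ (s * (2 * n + 1)) * (1 - q ^ (2 * s)) with hg
    have hD_succ (s : ℕ) : D (s + 1) = D s * (1 - q ^ (2 * s + 1)) := prod_range_succ _ _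
    have hT₁ : 2 * n * (2 * n + 1) / 2 = n * (2 * n + 1) := by
      rw [mul_assoc, Nat.mul_div_cancel_left _ two_pos]
    have hT₂ : (2 * n + 1) * (2 * n + 1 + 1) / 2 = (2 * n + 1) * (n + 1) := by
      rw [show (2 * n + 1) * (2 * n + 1 + 1) = 2 * ((2 * n + 1) * (n + 1)) by ring,
        Nat.mul_div_cancel_left _ two_pos]
    have hterm (s : ℕ) (hs : s ∈ range n) :
        (∏ r ∈ Ico s (n + 1), (1 - q ^ (2 * r + 2))) * D s * q ^ (s * (2 * (n + 1) + 1)) =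
          (1 - q ^ (2 * n + 1)) * ((∏ r ∈ Ico s n, (1 - q ^ (2 * r + 2))) * D s *
            q ^ (s * (2 * n + 1))) + (g (s + 1) - g s) := by
      have hs := mem_range.mp hs
      simp only [hg]
      rw [prod_Ico_succ_top hs.le, prod_eq_prod_Ico_succ_bot hs, hD_succ]
      ring
    have htel : ∑ s ∈ range n, (g (s + 1) - g s) = D n * q ^ (n * (2 * n + 1)) *
        (1 - q ^ (2 * n)) := by
      rw [sum_range_sub]
      simp [hg]
    rw [sum_range_succ, sum_congr rfl hterm, sum_add_distrib, ← mul_sum, ← ih, htel,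
      show 2 * (n + 1) = 2 * n + 1 + 1 by ring, sum_range_succ, sum_range_succ, hT₁, hT₂,
      prod_range_succ]
    simp only [Nat.Ico_succ_singleton, prod_singleton, hD]
    ring

/-- The generating function of partitions into distinct parts satisfying `p`. -/
theorem hasProd_powerSeriesMk_card_distinct_restricted (p : ℕ → Prop) [DecidablePred p] :
    HasProd (fun i ↦ if p (i + 1) then 1 + (X : ℤ⟦X⟧) ^ (i + 1) else 1)
      (PowerSeries.mk fun n ↦
        (#{P : Nat.Partition n | P.parts.Nodup ∧ ∀ x ∈ P.parts, p x} : ℤ)) := by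
  convert! Nat.Partition.hasProd_genFun (fun i c ↦ if p i ∧ c < 2 then (1 : ℤ) else 0) using 1
  · ext1 i
    rw [tsum_eq_single 0 (fun j hj ↦ by
      rw [if_neg (by lia)]
      exact zero_smul ℤ ((X : ℤ⟦X⟧) ^ ((i + 1) * (j + 1))))]
    by_cases h : p (i + 1)
    · rw [if_pos h, if_pos ⟨h, by simp⟩, zero_add, mul_one]
      exact congrArg (1 + ·) (one_smul ℤ ((X : ℤ⟦X⟧) ^ (i + 1))).symm
    · rw [if_neg h, if_neg fun h' ↦ h h'.1]
      exact ((congrArg (1 + ·) (zero_smul ℤ ((X : ℤ⟦X⟧) ^ ((i + 1) * (0 + 1))))).trans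
        (add_zero _)).symm
  · ext n
    simp only [coeff_mk, Nat.Partition.coeff_genFun, Finsupp.prod, prod_boole, sum_boole]
    congr 2
    ext P
    simp only [mem_filter, mem_univ, true_and, Multiset.toFinsupp_support, Multiset.mem_toFinset,
      Multiset.toFinsupp_apply, Multiset.nodup_iff_count_le_one]
    refine ⟨fun h i hi ↦ ⟨h.2 i hi, Nat.lt_succ_of_le (h.1 i)⟩, fun h ↦ ⟨fun i ↦ ?_,
      fun i hi ↦ (h i hi).1⟩⟩
    by_cases hi : i ∈ P.parts
    · exact Nat.le_of_lt_succ (h i hi).2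
    · simp [Multiset.count_eq_zero_of_notMem hi]

theorem powerSeriesMk_card_partition_mul_tprod :
    (PowerSeries.mk fun n ↦ (Fintype.card (Nat.Partition n) : ℤ)) *
      ∏' i, (1 - (X : ℤ⟦X⟧) ^ (i + 1)) = 1 := by
  have h := Nat.Partition.hasProd_powerSeriesMk_card_restricted ℤ (fun _ ↦ True)
  have h' := h.mul (WithPiTopology.multipliable_one_sub_X_pow ℤ).hasProd
  simp only [if_true, pow_mul] at h'
  simp only [WithPiTopology.tsum_pow_mul_one_sub_of_constantCoeff_eq_zero (R := ℤ)
    (show constantCoeff ((X : ℤ⟦X⟧) ^ (_ + 1)) = 0 by simp)] at h'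
  have := h'.unique hasProd_one
  simpa [Nat.Partition.restricted] using this

theorem le_triangular (k : ℕ) : k ≤ k * (k + 1) / 2 := by
  rw [Nat.le_div_iff_mul_le two_pos]
  nlinarith [Nat.le_mul_self k]

theorem summable_neg_X_pow_triangular :
    Summable fun k : ℕ ↦ (-X : ℤ⟦X⟧) ^ (k * (k + 1) / 2) := by
  apply WithPiTopology.summable_of_tendsto_order_atTop_nhds_top
  refine ENat.tendsto_nhds_top_iff_natCast_lt.mpr fun n ↦
    Filter.eventually_atTop.mpr ⟨n + 1, fun m hm ↦ ?_⟩
  rw [order_pow, order_neg, order_X, nsmul_one, Nat.cast_lt]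
  exact lt_of_lt_of_le hm (le_triangular m)

theorem hasProd_even_one_sub_X_pow :
    HasProd (fun i ↦ if Even (i + 1) then 1 - (X : ℤ⟦X⟧) ^ (i + 1) else 1)
      ((∏' i, (1 - (X : ℤ⟦X⟧) ^ (i + 1))) * PowerSeries.mk fun n ↦
        (#{P : Nat.Partition n | P.parts.Nodup ∧ ∀ x ∈ P.parts, True} : ℤ)) := by
  have hinj : Function.Injective fun i : ℕ ↦ 2 * i + 1 := fun i j h ↦ by simpa using h
  rw [← hinj.hasProd_iff fun i hi ↦ if_neg fun ⟨r, hr⟩ ↦ hi ⟨r - 1, by grind⟩]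
  convert! (WithPiTopology.multipliable_one_sub_X_pow ℤ).hasProd.mul
    (hasProd_powerSeriesMk_card_distinct_restricted fun _ ↦ True) using 2 with i
  rw [Function.comp_apply, if_pos (by grind), if_pos trivial]
  ring

theorem distinct_even_mul_distinct_odd :
    (PowerSeries.mk fun n ↦
        (#{P : Nat.Partition n | P.parts.Nodup ∧ ∀ x ∈ P.parts, Even x} : ℤ)) *
      (PowerSeries.mk fun n ↦
        (#{P : Nat.Partition n | P.parts.Nodup ∧ ∀ x ∈ P.parts, ¬ Even x} : ℤ)) =
    PowerSeries.mk fun n ↦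
        (#{P : Nat.Partition n | P.parts.Nodup ∧ ∀ x ∈ P.parts, True} : ℤ) := by
  refine HasProd.unique ?_ (hasProd_powerSeriesMk_card_distinct_restricted fun _ ↦ True)
  convert! (hasProd_powerSeriesMk_card_distinct_restricted (Even ·)).mul
    (hasProd_powerSeriesMk_card_distinct_restricted (¬ Even ·)) using 2 with i
  split_ifs <;> simp_all

/-- Gauss' identity for the triangular theta series at `-X`. -/
theorem card_distinct_odd_mul_tsum_neg_X_pow_triangular :
    (PowerSeries.mk fun n ↦
        (#{P : Nat.Partition n | P.parts.Nodup ∧ ∀ x ∈ P.parts, ¬ Even x} : ℤ)) *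
      ∑' k : ℕ, (-X : ℤ⟦X⟧) ^ (k * (k + 1) / 2) =
    (∏' i, (1 - (X : ℤ⟦X⟧) ^ (i + 1))) * PowerSeries.mk fun n ↦
      (#{P : Nat.Partition n | P.parts.Nodup ∧ ∀ x ∈ P.parts, True} : ℤ) := by
  have htwo : Filter.Tendsto (fun n : ℕ ↦ 2 * n) Filter.atTop Filter.atTop :=
    Filter.tendsto_id.const_mul_atTop' two_pos
  have hO := (hasProd_powerSeriesMk_card_distinct_restricted
    (fun i ↦ ¬ Even i)).tendsto_prod_nat.comp htwo
  have hψ := summable_neg_X_pow_triangular.hasSum.tendsto_sum_nat.comp htwo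
  have hN := hasProd_even_one_sub_X_pow.tendsto_prod_nat.comp htwo
  refine tendsto_nhds_unique (hO.mul hψ) ?_
  rw [WithPiTopology.tendsto_iff_coeff_tendsto] at hN ⊢
  refine fun d ↦ (hN d).congr' (Filter.eventually_atTop.mpr ⟨d + 1, fun n hn ↦ ?_⟩)
  have hodd (n : ℕ) : ∏ i ∈ range (2 * n), (if ¬ Even (i + 1) then 1 + (X : ℤ⟦X⟧) ^ (i + 1) else 1) =
      ∏ r ∈ range n, (1 - (-X : ℤ⟦X⟧) ^ (2 * r + 1)) := by
    induction n with
    | zero => simp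
    | succ n ih =>
      rw [show 2 * (n + 1) = 2 * n + 1 + 1 by ring, prod_range_succ, prod_range_succ, ih,
        prod_range_succ, if_pos (by grind), if_neg (by grind), mul_one,
        Odd.neg_pow (by simp), sub_neg_eq_add]
  have heven (n : ℕ) : ∏ i ∈ range (2 * n), (if Even (i + 1) then 1 - (X : ℤ⟦X⟧) ^ (i + 1) else 1) =
      ∏ r ∈ range n, (1 - (-X : ℤ⟦X⟧) ^ (2 * r + 2)) := by
    induction n with
    | zero => simp
    | succ n ih =>
      rw [show 2 * (n + 1) = 2 * n + 1 + 1 by ring, prod_range_succ, prod_range_succ, ih,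
        prod_range_succ, if_neg (by grind), if_pos (by grind), mul_one,
        Even.neg_pow (by grind)]
  obtain ⟨m, rfl⟩ : ∃ m, n = m + 1 := ⟨n - 1, by lia⟩
  simp only [Function.comp_apply]
  rw [hodd, heven, prod_one_sub_odd_pow_mul_sum_pow_triangular, sum_range_succ', map_add, map_sum,
    sum_eq_zero fun s _ ↦ ?_]
  · simp
  · rw [neg_pow X, mul_left_comm, ← mul_assoc, mul_comm, coeff_X_pow_mul', if_neg]
    nlinarith

/-- The convolution of the partition function with the alternating triangular theta series is
the generating function of partitions into distinct even parts. -/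
theorem card_partition_mul_tsum_neg_X_pow_triangular :
    (PowerSeries.mk fun n ↦ (Fintype.card (Nat.Partition n) : ℤ)) *
      ∑' k : ℕ, (-X : ℤ⟦X⟧) ^ (k * (k + 1) / 2) =
    PowerSeries.mk fun n ↦
      (#{P : Nat.Partition n | P.parts.Nodup ∧ ∀ x ∈ P.parts, Even x} : ℤ) := by
  have hne : (PowerSeries.mk fun n ↦
      (#{P : Nat.Partition n | P.parts.Nodup ∧ ∀ x ∈ P.parts, ¬ Even x} : ℤ)) ≠ 0 := fun h ↦ by
    simpa using congrArg (coeff 0) h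
  refine mul_right_cancel₀ hne ?_
  rw [mul_assoc, mul_comm (∑' k : ℕ, _), card_distinct_odd_mul_tsum_neg_X_pow_triangular,
    ← mul_assoc, powerSeriesMk_card_partition_mul_tprod, one_mul,
    distinct_even_mul_distinct_odd]

/-- The alternating sum `∑_{k ≥ 0} (-1)^{k(k+1)/2} p(n - k(k+1)/2)` (all terms with
`k > n` vanish) equals the number of partitions of `n` into distinct even parts. -/
theorem stmt_5 (n : ℕ) :
    (∑ k ∈ Finset.range (n + 1),
        (-1) ^ (k * (k + 1) / 2) * pZ ((n : ℤ) - (k * (k + 1) / 2 : ℕ))) =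
      (Nat.card {P : Nat.Partition n // P.parts.Nodup ∧ ∀ x ∈ P.parts, Even x} : ℤ) := by
  rw [Nat.card_eq_fintype_card, Fintype.card_subtype]
  have hsum := WithPiTopology.hasSum_iff_hasSum_coeff ℤ |>.mp
    (summable_neg_X_pow_triangular.hasSum.mul_left
      (PowerSeries.mk fun n ↦ (Fintype.card (Nat.Partition n) : ℤ))) n
  rw [card_partition_mul_tsum_neg_X_pow_triangular, coeff_mk] at hsum
  have hterm (k : ℕ) : coeff n ((PowerSeries.mk fun n ↦ (Fintype.card (Nat.Partition n) : ℤ)) *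
      (-X : ℤ⟦X⟧) ^ (k * (k + 1) / 2)) =
      (-1) ^ (k * (k + 1) / 2) * pZ ((n : ℤ) - (k * (k + 1) / 2 : ℕ)) := by
    generalize k * (k + 1) / 2 = t
    have hC : (-1 : ℤ⟦X⟧) ^ t = C ((-1) ^ t) := by simp
    rw [neg_pow, mul_left_comm, hC, coeff_C_mul, coeff_mul_X_pow', pZ]
    congr 1
    by_cases h : t ≤ n
    · rw [if_pos h, if_pos (by lia), coeff_mk, Nat.card_eq_fintype_card,
        show ((n : ℤ) - t).toNat = n - t by lia]
    · rw [if_neg h, if_neg (by lia)]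
  simp only [hterm] at hsum
  refine HasSum.unique (hasSum_sum_of_ne_finset_zero fun k hk ↦ ?_) hsum
  have hkn : n < k := by simpa [Nat.lt_succ_iff] using hk
  have := le_triangular k
  rw [pZ, if_neg (by lia), mul_zero]
end

section
/- For every integer n ≥ 0, twice the number of partitions of n whose mex is congruent to 1 modulo 4 equals A(n) + B(n), where A(n) is the number of triples (d, α, β) with d ≥ 0 an integer, α and β partitions each having at most d parts, and d(d+1) + |α| + |β| = n; and B(n) is the number of pairs (d, γ) with d ≥ 0 an integer and γ a partition into even parts each at most 2d with d(d+1) + |γ| = n. -/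
/-- `A n` is the number of triples `(d, α, β)` where `α` and `β` are partitions each with
at most `d` parts and `d(d+1) + |α| + |β| = n`.  A partition of unrestricted weight is
represented by its multiset of (positive) parts. -/
noncomputable def A (n : ℕ) : ℕ :=
  Nat.card {t : ℕ × Multiset ℕ × Multiset ℕ //
    (∀ x ∈ t.2.1, 0 < x) ∧ (∀ x ∈ t.2.2, 0 < x) ∧
    Multiset.card t.2.1 ≤ t.1 ∧ Multiset.card t.2.2 ≤ t.1 ∧
    t.1 * (t.1 + 1) + t.2.1.sum + t.2.2.sum = n}

/-- `B n` is the number of pairs `(d, γ)` where `γ` is a partition into even parts each at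
most `2d` and `d(d+1) + |γ| = n`. -/
noncomputable def B (n : ℕ) : ℕ :=
  Nat.card {t : ℕ × Multiset ℕ //
    (∀ x ∈ t.2, 0 < x ∧ Even x ∧ x ≤ 2 * t.1) ∧
    t.1 * (t.1 + 1) + t.2.sum = n}

open Finset

/-- The `j`-th triangular number. -/
def triangular (j : ℕ) : ℕ := ∑ i ∈ range j, (i + 1)

theorem triangular_succ (j : ℕ) : triangular (j + 1) = triangular j + (j + 1) :=
  sum_range_succ _ _

theorem le_triangular_s8 (j : ℕ) : j ≤ triangular j := by
  induction j with
  | zero => simp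
  | succ j ih => rw [triangular_succ]; omega

theorem triangular_two_mul_add_one (n : ℕ) :
    triangular (2 * n + 1) = (n + 1) * (2 * n + 1) := by
  induction n with
  | zero => simp [triangular]
  | succ n ih =>
    rw [show 2 * (n + 1) + 1 = 2 * n + 1 + 1 + 1 by ring, triangular_succ, triangular_succ, ih]
    ring

section Nilpotent

variable {R : Type*} [CommRing R] {q : R} {N : ℕ}

/-- In a nilpotent variable, the series over Durfee rectangles of shape `d × (d + m)`. -/
theorem sum_durfee_rectangle (hq : q ^ N = 0) (hN : 0 < N) {e : ℕ → R} (he₀ : e 0 = 1)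
    (he : ∀ i, e (i + 1) * (1 - q ^ (i + 1)) = e i) {m : ℕ} (hm : m ≤ N) :
    ∑ d ∈ range N, q ^ (d ^ 2 + m * d) * e d * e (d + m) = e N := by
  obtain ⟨M, rfl⟩ := Nat.exists_eq_add_of_lt hN
  simp only [zero_add] at *
  set F : ℕ → R := fun m ↦ ∑ d ∈ range (M + 1), q ^ (d ^ 2 + m * d) * e d * e (d + m) with hF
  have hrec (m : ℕ) : F m - F (m + 1) = -q ^ (m + 1) * (F (m + 1) - F (m + 2)) := by
    have h₁ : F m - F (m + 1) =
        ∑ d ∈ range (M + 1), q ^ (d ^ 2 + m * d) * (e d * (1 - q ^ d)) * e (d + m + 1) -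
        q ^ (m + 1) * ∑ d ∈ range (M + 1), q ^ (d ^ 2 + (m + 1) * d) * e d * e (d + m + 1) := by
      simp only [hF, mul_sum, ← sum_sub_distrib]
      refine sum_congr rfl fun d _ ↦ ?_
      rw [← he (d + m), ← add_assoc]
      ring
    have h₂ : ∑ d ∈ range (M + 1), q ^ (d ^ 2 + m * d) * (e d * (1 - q ^ d)) * e (d + m + 1) =
        q ^ (m + 1) * ∑ d ∈ range (M + 1), q ^ (d ^ 2 + (m + 2) * d) * e d * e (d + m + 2) := by
      rw [sum_range_succ', sum_range_succ, mul_add]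
      have h₃ : q ^ (m + 1) * (q ^ (M ^ 2 + (m + 2) * M) * e M * e (M + m + 2)) = 0 := by
        rw [← mul_assoc, ← mul_assoc, ← pow_add,
          pow_eq_zero_of_le (by nlinarith) hq, zero_mul, zero_mul]
      rw [h₃, mul_sum]
      simp only [pow_zero, sub_self, mul_zero, zero_mul, add_zero]
      refine sum_congr rfl fun d _ ↦ ?_
      rw [he d, show d + 1 + m + 1 = d + m + 2 by ring]
      ring
    rw [h₁, h₂]
    simp only [hF, mul_sum, ← sum_sub_distrib]
    refine sum_congr rfl fun d _ ↦ ?_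
    rw [← add_assoc d, ← add_assoc d]
    ring
  have hzero (k : ℕ) : ∀ m, M + 1 ≤ m + k → F m = F (m + 1) := by
    induction k with
    | zero =>
      intro m h
      rw [← sub_eq_zero, hrec, pow_eq_zero_of_le (by omega) hq]
      ring
    | succ k ih =>
      intro m h
      rw [← sub_eq_zero, hrec, sub_eq_zero.2 (ih (m + 1) (by omega)), mul_zero]
  have hconst (k : ℕ) : F m = F (m + k) := by
    induction k with
    | zero => rfl
    | succ k ih => rw [ih, hzero (M + 1) (m + k) (by omega), add_assoc]
  change F m = _
  rw [hconst (M + 1 - m), Nat.add_sub_cancel' hm, hF]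
  simp only
  rw [sum_range_succ', sum_eq_zero]
  · simp [he₀]
  · intro d _
    rw [pow_eq_zero_of_le (by nlinarith) hq, zero_mul, zero_mul]

theorem sum_alternating_triangular (hq : q ^ N = 0) (hN : 0 < N) {e : ℕ → R} (he₀ : e 0 = 1)
    (he : ∀ i, e (i + 1) * (1 - q ^ (i + 1)) = e i) {J : ℕ} (hJ : N ≤ J) :
    ∑ d ∈ range N, q ^ (d * (d + 1)) * e d * e d =
      e N * ∑ j ∈ range J, (-1) ^ j * q ^ triangular j := by
  set H : ℕ → R := fun j ↦ ∑ d ∈ range N, q ^ (d ^ 2 + (j + 1) * d) * e d * e (d + j) with hH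
  have hrec (j : ℕ) (hj : j < N) : H j = e N - q ^ (j + 1) * H (j + 1) := by
    rw [← sum_durfee_rectangle hq hN he₀ he (show j + 1 ≤ N by omega)]
    simp only [hH, mul_sum, ← sum_sub_distrib]
    refine sum_congr rfl fun d _ ↦ ?_
    rw [← he (d + j), ← add_assoc]
    ring
  have hsum (j : ℕ) (hj : j ≤ N) : H 0 =
      e N * ∑ i ∈ range j, (-1) ^ i * q ^ triangular i + (-1) ^ j * q ^ triangular j * H j := by
    induction j with
    | zero => simp [triangular]
    | succ j ih =>
      rw [ih (by omega), hrec j (by omega), sum_range_succ, triangular_succ]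
      ring
  have h₀ : H 0 = ∑ d ∈ range N, q ^ (d * (d + 1)) * e d * e d := by
    simp only [hH]
    refine sum_congr rfl fun d _ ↦ ?_
    rw [add_zero]
    ring
  rw [← h₀, hsum N le_rfl, pow_eq_zero_of_le (le_triangular_s8 N) hq, mul_zero,
    zero_mul, add_zero]
  congr 1
  refine sum_subset (range_subset_range.2 hJ) fun j _ hj ↦ ?_
  rw [pow_eq_zero_of_le ((not_lt.1 (mt mem_range.2 hj)).trans (le_triangular_s8 j)) hq,
    mul_zero]

theorem sum_even_parts_eq_prod (hq : q ^ N = 0) (hN : 0 < N) {b : ℕ → R} (hb₀ : b 0 = 1)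
    (hb : ∀ i, b (i + 1) * (1 - q ^ (2 * (i + 1))) = b i) :
    ∑ d ∈ range N, q ^ (d * (d + 1)) * b d = ∏ i ∈ range N, (1 + q ^ (2 * (i + 1))) := by
  obtain ⟨M, rfl⟩ := Nat.exists_eq_add_of_lt hN
  simp only [zero_add] at *
  set F : ℕ → R := fun m ↦ ∑ d ∈ range (M + 1), q ^ (d ^ 2 + (2 * m + 1) * d) * b d with hF
  have hrec (m : ℕ) : F m = (1 + q ^ (2 * (m + 1))) * F (m + 1) := by
    have h₁ : F m - F (m + 1) =
        ∑ d ∈ range (M + 1), q ^ (d ^ 2 + (2 * m + 1) * d) * (b d * (1 - q ^ (2 * d))) := by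
      simp only [hF, ← sum_sub_distrib]
      refine sum_congr rfl fun d _ ↦ ?_
      ring
    have h₂ : F m - F (m + 1) = q ^ (2 * (m + 1)) * F (m + 1) := by
      rw [h₁]
      simp only [hF]
      have h₃ : q ^ (2 * (m + 1)) * (q ^ (M ^ 2 + (2 * (m + 1) + 1) * M) * b M) = 0 := by
        rw [← mul_assoc, ← pow_add, pow_eq_zero_of_le (by nlinarith) hq, zero_mul]
      rw [sum_range_succ', sum_range_succ, mul_add, h₃, mul_sum]
      simp only [mul_zero, pow_zero, sub_self, add_zero]
      refine sum_congr rfl fun d _ ↦ ?_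
      rw [hb d]
      ring
    linear_combination h₂
  have hprod (m : ℕ) : F 0 = (∏ i ∈ range m, (1 + q ^ (2 * (i + 1)))) * F m := by
    induction m with
    | zero => simp
    | succ m ih => rw [ih, hrec m, prod_range_succ, mul_assoc]
  have h₀ : F 0 = ∑ d ∈ range (M + 1), q ^ (d * (d + 1)) * b d := by
    simp only [hF]
    refine sum_congr rfl fun d _ ↦ ?_
    ring
  have hlast : F (M + 1) = 1 := by
    simp only [hF]
    rw [sum_range_succ', sum_eq_zero]
    · simp [hb₀]
    · intro d _
      rw [pow_eq_zero_of_le (by nlinarith) hq, zero_mul]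
  rw [← h₀, hprod (M + 1), hlast, mul_one]

/-- The finite form, due to Shanks, of the identity of Gauss for triangular numbers. -/
theorem sum_pow_triangular_eq (q : R) {c : ℕ → R} (hc : ∀ i, c i * (1 - q ^ (2 * i + 1)) = 1)
    (n : ℕ) :
    ∑ j ∈ range (2 * n + 1), q ^ triangular j =
      ∑ s ∈ range (n + 1),
        (∏ i ∈ Ico s n, (1 - q ^ (2 * i + 2)) * c i) * q ^ (s * (2 * n + 1)) := by
  induction n with
  | zero => simp [triangular]
  | succ n ih =>
    set r : ℕ → R := fun s ↦ ∏ i ∈ Ico s n, (1 - q ^ (2 * i + 2)) * c i with hr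
    have hrs (s : ℕ) (hs : s < n) :
        r s * (1 - q ^ (2 * s + 1)) = r (s + 1) * (1 - q ^ (2 * s + 2)) := by
      simp only [hr]
      rw [prod_eq_prod_Ico_succ_bot hs]
      linear_combination (1 - q ^ (2 * s + 2)) *
        (∏ i ∈ Ico (s + 1) n, (1 - q ^ (2 * i + 2)) * c i) * hc s
    have htel (j : ℕ) (hj : j ≤ n) :
        ∑ s ∈ range j, (r s * ((1 - q ^ (2 * n + 2)) * c n) * q ^ (s * (2 * n + 3)) -
          r s * q ^ (s * (2 * n + 1))) = c n * r j * q ^ (j * (2 * n + 1)) * (1 - q ^ (2 * j)) := by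
      induction j with
      | zero => simp
      | succ j ihj =>
        rw [sum_range_succ, ihj (by omega)]
        linear_combination c n * q ^ ((j + 1) * (2 * n + 1)) * hrs j (by omega)
          + r j * q ^ (j * (2 * n + 1)) * hc n
    have hrn : r n = 1 := by simp [hr]
    have htop := htel n le_rfl
    rw [sum_sub_distrib] at htop
    rw [show 2 * (n + 1) + 1 = 2 * n + 1 + 1 + 1 by ring, sum_range_succ, sum_range_succ, ih,
      sum_range_succ _ (n + 1), Ico_self, prod_empty, triangular_succ (2 * n + 1),
      triangular_two_mul_add_one]
    have hsplit : ∑ s ∈ range (n + 1), (∏ i ∈ Ico s (n + 1), (1 - q ^ (2 * i + 2)) * c i) *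
          q ^ (s * (2 * n + 1 + 1 + 1)) =
        ∑ s ∈ range (n + 1), r s * ((1 - q ^ (2 * n + 2)) * c n) * q ^ (s * (2 * n + 3)) := by
      refine sum_congr rfl fun s hs ↦ ?_
      rw [prod_Ico_succ_top (by simpa [Nat.lt_succ_iff] using hs)]
    rw [hsplit, sum_range_succ, sum_range_succ, hrn, Ico_self, prod_empty]
    rw [hrn] at htop
    linear_combination -htop - q ^ (n * (2 * n + 1)) * (1 + q ^ (2 * n + 1)) * hc n

theorem prod_one_add_pow_eq (hq : q ^ N = 0) {e : ℕ → R} (he₀ : e 0 = 1)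
    (he : ∀ i, e (i + 1) * (1 - q ^ (i + 1)) = e i) :
    ∏ i ∈ range N, (1 + q ^ (2 * (i + 1))) =
      e N * ∑ j ∈ range (2 * N + 1), (-1) ^ triangular j * q ^ triangular j := by
  have hunit (i : ℕ) : ∃ c, c * (1 + q ^ (2 * i + 1)) = 1 := by
    have hnil : IsNilpotent (q ^ (2 * i + 1)) := IsNilpotent.pow_of_pos ⟨N, hq⟩ (by omega)
    obtain ⟨c, hc⟩ := hnil.isUnit_one_add.exists_left_inv
    exact ⟨c, hc⟩
  choose c hc using hunit
  have hshanks := sum_pow_triangular_eq (-q) (c := c)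
    (fun i ↦ by rw [Odd.neg_pow ⟨i, rfl⟩, sub_neg_eq_add, hc]) N
  simp only [neg_pow q] at hshanks
  rw [hshanks, sum_range_succ', sum_eq_zero, zero_add, zero_mul, pow_zero, one_mul, pow_zero,
    mul_one, Nat.Ico_zero_eq_range]
  · have heN (n : ℕ) : e n * ∏ i ∈ range n, (1 - q ^ (i + 1)) = 1 := by
      induction n with
      | zero => simp [he₀]
      | succ n ih => rw [prod_range_succ, ← mul_assoc, mul_right_comm, he, ih]
    have hpair (n : ℕ) : ∏ i ∈ range (2 * n), (1 + q ^ (i + 1)) =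
        ∏ i ∈ range n, (1 + q ^ (2 * i + 1)) * (1 + q ^ (2 * (i + 1))) := by
      induction n with
      | zero => simp
      | succ n ih =>
        rw [show 2 * (n + 1) = 2 * n + 1 + 1 by ring, prod_range_succ, prod_range_succ, ih,
          prod_range_succ]
        ring
    have hlong : ∏ i ∈ range (2 * N), (1 + q ^ (i + 1)) = ∏ i ∈ range N, (1 + q ^ (i + 1)) := by
      symm
      refine prod_subset (range_subset_range.2 (by omega)) fun i _ hi ↦ ?_
      rw [pow_eq_zero_of_le (by simp at hi; omega) hq, add_zero]
    have hsq : ∏ i ∈ range N, (1 - q ^ (2 * (i + 1))) =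
        (∏ i ∈ range N, (1 - q ^ (i + 1))) * ∏ i ∈ range N, (1 + q ^ (i + 1)) := by
      rw [← prod_mul_distrib]
      exact prod_congr rfl fun i _ ↦ by ring
    have hcprod : (∏ i ∈ range N, c i) * ∏ i ∈ range N, (1 + q ^ (2 * i + 1)) = 1 := by
      rw [← prod_mul_distrib]
      exact prod_eq_one fun i _ ↦ hc i
    have hmain : ∏ i ∈ range N, (1 - (-1) ^ (2 * i + 2) * q ^ (2 * i + 2)) * c i =
        (∏ i ∈ range N, (1 - q ^ (2 * (i + 1)))) * ∏ i ∈ range N, c i := by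
      rw [← prod_mul_distrib]
      refine prod_congr rfl fun i _ ↦ ?_
      rw [Even.neg_one_pow ⟨i + 1, by ring⟩, one_mul]
      rfl
    rw [hmain, hsq, ← hlong, hpair, prod_mul_distrib]
    linear_combination -(∏ i ∈ range N, (1 + q ^ (2 * (i + 1)))) * heN N -
      (e N * ∏ i ∈ range N, (1 - q ^ (i + 1))) * (∏ i ∈ range N, (1 + q ^ (2 * (i + 1)))) * hcprod
  · intro s _
    rw [pow_eq_zero_of_le (by nlinarith) hq, mul_zero, mul_zero]

end Nilpotent

section GeneratingFunction

open PowerSeries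

open Classical in
/-- The partitions of `m`, as multisets, that lie in `S`. -/
noncomputable def partitionsIn (S : Set (Multiset ℕ)) (m : ℕ) : Finset (Multiset ℕ) :=
  (univ.filter fun P : Nat.Partition m ↦ P.parts ∈ S).image Nat.Partition.parts

theorem mem_partitionsIn {S : Set (Multiset ℕ)} {m : ℕ} {x : Multiset ℕ} :
    x ∈ partitionsIn S m ↔ (∀ i ∈ x, 0 < i) ∧ x.sum = m ∧ x ∈ S := by
  classical
  simp only [partitionsIn, mem_image, mem_filter, mem_univ, true_and]
  constructor
  · rintro ⟨P, hP, rfl⟩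
    exact ⟨fun i hi ↦ P.parts_pos hi, P.parts_sum, hP⟩
  · rintro ⟨h₀, hs, hx⟩
    exact ⟨⟨x, @h₀, hs⟩, hx, rfl⟩

theorem card_partitionsIn (S : Set (Multiset ℕ)) (m : ℕ) [DecidablePred (· ∈ S)] :
    #(partitionsIn S m) = #(univ.filter fun P : Nat.Partition m ↦ P.parts ∈ S) := by
  classical
  rw [partitionsIn, card_image_of_injective _ fun P Q h ↦ Nat.Partition.ext h]
  congr

/-- The generating function of the partitions that lie in `S`. -/
noncomputable def partitionSeries (S : Set (Multiset ℕ)) : ℤ⟦X⟧ :=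
  PowerSeries.mk fun m ↦ (#(partitionsIn S m) : ℤ)

theorem partitionSeries_eq_one {S : Set (Multiset ℕ)}
    (h : ∀ x : Multiset ℕ, (∀ i ∈ x, 0 < i) → (x ∈ S ↔ x = 0)) : partitionSeries S = 1 := by
  ext m
  rw [partitionSeries, coeff_mk, coeff_one]
  split_ifs with hm
  · subst hm
    have : partitionsIn S 0 = {0} := by
      ext x
      rw [mem_partitionsIn, mem_singleton]
      constructor
      · rintro ⟨h₀, -, hx⟩
        exact (h x h₀).1 hx
      · rintro rfl
        exact ⟨by simp, by simp, (h 0 (by simp)).2 rfl⟩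
    simp [this]
  · have : partitionsIn S m = ∅ := by
      refine eq_empty_of_forall_notMem fun x hx ↦ ?_
      obtain ⟨h₀, hs, hx⟩ := mem_partitionsIn.1 hx
      rw [(h x h₀).1 hx] at hs
      exact hm (by simpa using hs.symm)
    simp [this]

theorem partitionSeries_eq_add {S S' T : Set (Multiset ℕ)} {k : ℕ} (φ : Multiset ℕ → Multiset ℕ)
    (hsub : S' ⊆ S)
    (hφ : ∀ x ∈ T, (∀ i ∈ x, 0 < i) →
      (∀ i ∈ φ x, 0 < i) ∧ φ x ∈ S ∧ φ x ∉ S' ∧ (φ x).sum = x.sum + k)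
    (hinj : ∀ x ∈ T, (∀ i ∈ x, 0 < i) → ∀ y ∈ T, (∀ i ∈ y, 0 < i) → φ x = φ y → x = y)
    (hsurj : ∀ y ∈ S, y ∉ S' → (∀ i ∈ y, 0 < i) → ∃ x ∈ T, (∀ i ∈ x, 0 < i) ∧ φ x = y) :
    partitionSeries S = partitionSeries S' + X ^ k * partitionSeries T := by
  classical
  ext m
  simp only [partitionSeries, map_add, coeff_mk, coeff_X_pow_mul']
  have hdiff : #(partitionsIn S m \ partitionsIn S' m) =
      if k ≤ m then #(partitionsIn T (m - k)) else 0 := by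
    split_ifs with hk
    · symm
      refine card_bij (fun x _ ↦ φ x) ?_ ?_ ?_
      · intro x hx
        obtain ⟨h₀, hs, hx⟩ := mem_partitionsIn.1 hx
        obtain ⟨h₁, h₂, h₃, h₄⟩ := hφ x hx h₀
        simp only [mem_sdiff, mem_partitionsIn]
        exact ⟨⟨h₁, by omega, h₂⟩, fun h ↦ h₃ h.2.2⟩
      · intro x hx y hy h
        rw [mem_partitionsIn] at hx hy
        exact hinj x hx.2.2 hx.1 y hy.2.2 hy.1 h
      · intro y hy
        simp only [mem_sdiff, mem_partitionsIn] at hy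
        obtain ⟨x, hx, h₀, rfl⟩ := hsurj y hy.1.2.2 (fun h ↦ hy.2 ⟨hy.1.1, hy.1.2.1, h⟩) hy.1.1
        have := (hφ x hx h₀).2.2.2
        exact ⟨x, mem_partitionsIn.2 ⟨h₀, by omega, hx⟩, rfl⟩
    · rw [card_eq_zero]
      refine eq_empty_of_forall_notMem fun y hy ↦ ?_
      simp only [mem_sdiff, mem_partitionsIn] at hy
      obtain ⟨x, hx, h₀, rfl⟩ := hsurj y hy.1.2.2 (fun h ↦ hy.2 ⟨hy.1.1, hy.1.2.1, h⟩) hy.1.1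
      have := (hφ x hx h₀).2.2.2
      omega
  have hle : partitionsIn S' m ⊆ partitionsIn S m := by
    intro x hx
    rw [mem_partitionsIn] at hx ⊢
    exact ⟨hx.1, hx.2.1, hsub hx.2.2⟩
  rw [← card_sdiff_add_card_eq_card hle, hdiff]
  push_cast
  ring

/-- The multisets with at most `d` elements. -/
def cardLE (d : ℕ) : Set (Multiset ℕ) := {x | Multiset.card x ≤ d}

/-- The multisets of even numbers that are at most `2 * d`. -/
def evenLE (d : ℕ) : Set (Multiset ℕ) := {x | ∀ i ∈ x, Even i ∧ i ≤ 2 * d}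

/-- The multisets that contain each of `1, …, j`. -/
def containsUpTo (j : ℕ) : Set (Multiset ℕ) := {x | ∀ i < j, i + 1 ∈ x}

theorem partitionSeries_cardLE_zero : partitionSeries (cardLE 0) = 1 :=
  partitionSeries_eq_one fun x _ ↦ by simp [cardLE]

theorem partitionSeries_evenLE_zero : partitionSeries (evenLE 0) = 1 := by
  refine partitionSeries_eq_one fun x h₀ ↦ ⟨fun hx ↦ ?_, ?_⟩
  · refine Multiset.eq_zero_of_forall_notMem fun i hi ↦ ?_
    have := (hx i hi).2
    have := h₀ i hi
    omega
  · rintro rfl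
    simp [evenLE]

theorem partitionSeries_cardLE_succ (d : ℕ) :
    partitionSeries (cardLE (d + 1)) * (1 - X ^ (d + 1)) = partitionSeries (cardLE d) := by
  suffices h : partitionSeries (cardLE (d + 1)) =
      partitionSeries (cardLE d) + X ^ (d + 1) * partitionSeries (cardLE (d + 1)) by
    linear_combination h
  have hinv (x : Multiset ℕ) (hx : ∀ i ∈ x, 0 < i) (k : ℕ) :
      ((x.map (· + 1) + Multiset.replicate k 1).map (· - 1)).filter (0 < ·) = x := by
    simp only [Multiset.map_add, Multiset.map_map, Function.comp_def, Nat.add_sub_cancel,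
      Multiset.map_id', Multiset.map_replicate, Multiset.filter_add]
    rw [Multiset.filter_eq_self.2 hx, Multiset.filter_eq_nil.2, add_zero]
    intro i hi
    simp [Multiset.eq_of_mem_replicate hi]
  refine partitionSeries_eq_add
    (fun x ↦ x.map (· + 1) + Multiset.replicate (d + 1 - Multiset.card x) 1) ?_ ?_ ?_ ?_
  · intro x hx
    exact le_trans hx (Nat.le_succ d)
  · intro x hx h₀
    have hx : Multiset.card x ≤ d + 1 := hx
    refine ⟨?_, ?_, ?_, ?_⟩
    · intro i hi
      rcases Multiset.mem_add.1 hi with hi | hi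
      · obtain ⟨a, -, rfl⟩ := Multiset.mem_map.1 hi
        omega
      · simp [Multiset.eq_of_mem_replicate hi]
    · simp only [cardLE, Set.mem_ofPred_eq, Multiset.card_add, Multiset.card_map,
        Multiset.card_replicate]
      omega
    · simp only [cardLE, Set.mem_ofPred_eq, Multiset.card_add, Multiset.card_map,
        Multiset.card_replicate]
      omega
    · simp only [Multiset.sum_add, Multiset.sum_map_add, Multiset.map_id', Multiset.map_const',
        Multiset.sum_replicate, smul_eq_mul, mul_one]
      omega
  · intro x _ hx y _ hy h
    have := congrArg (fun z ↦ (z.map (· - 1)).filter (0 < ·)) h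
    simpa only [hinv x hx, hinv y hy] using this
  · intro y hy hy' h₀
    have hcard : Multiset.card y = d + 1 := by
      simp only [cardLE, Set.mem_ofPred_eq] at hy hy'
      omega
    set z := y.map (· - 1) with hz
    have hzy : z.map (· + 1) = y := by
      rw [hz, Multiset.map_map]
      conv_rhs => rw [← Multiset.map_id y]
      refine Multiset.map_congr rfl fun i hi ↦ ?_
      have := h₀ i hi
      simp only [Function.comp, id]
      omega
    have hsplit : z = z.filter (0 < ·) + Multiset.replicate (z.count 0) 0 := by
      conv_lhs => rw [← Multiset.filter_add_not (0 < ·) z]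
      congr 1
      rw [← Multiset.filter_eq']
      exact Multiset.filter_congr fun i _ ↦ by omega
    have hzcard : Multiset.card (z.filter (0 < ·)) + z.count 0 = d + 1 := by
      have := congrArg Multiset.card hsplit
      rw [Multiset.card_add, Multiset.card_replicate, hz, Multiset.card_map, hcard] at this
      exact this.symm
    refine ⟨z.filter (0 < ·), ?_, fun i hi ↦ (Multiset.mem_filter.1 hi).2, ?_⟩
    · simp only [cardLE, Set.mem_ofPred_eq]
      omega
    · rw [show d + 1 - Multiset.card (z.filter (0 < ·)) = z.count 0 by omega]
      conv_rhs => rw [← hzy, hsplit, Multiset.map_add, Multiset.map_replicate]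

theorem partitionSeries_evenLE_succ (d : ℕ) :
    partitionSeries (evenLE (d + 1)) * (1 - X ^ (2 * (d + 1))) = partitionSeries (evenLE d) := by
  suffices h : partitionSeries (evenLE (d + 1)) =
      partitionSeries (evenLE d) + X ^ (2 * (d + 1)) * partitionSeries (evenLE (d + 1)) by
    linear_combination h
  refine partitionSeries_eq_add (fun x ↦ (2 * (d + 1)) ::ₘ x) ?_ ?_ ?_ ?_
  · intro x hx i hi
    have := hx i hi
    exact ⟨this.1, by omega⟩
  · intro x hx h₀
    refine ⟨?_, ?_, ?_, ?_⟩
    · intro i hi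
      rcases Multiset.mem_cons.1 hi with rfl | hi
      · omega
      · exact h₀ i hi
    · intro i hi
      rcases Multiset.mem_cons.1 hi with rfl | hi
      · exact ⟨even_two_mul _, le_rfl⟩
      · exact hx i hi
    · intro h
      have := (h _ (Multiset.mem_cons_self _ _)).2
      omega
    · rw [Multiset.sum_cons, add_comm]
  · intro x _ _ y _ _ h
    exact (Multiset.cons_inj_right _).1 h
  · intro y hy hy' h₀
    have hmem : 2 * (d + 1) ∈ y := by
      by_contra hmem
      refine hy' fun i hi ↦ ⟨(hy i hi).1, ?_⟩
      obtain ⟨⟨k, rfl⟩, hle⟩ := hy i hi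
      have : k + k ≠ 2 * (d + 1) := fun h ↦ hmem (h ▸ hi)
      omega
    exact ⟨y.erase (2 * (d + 1)), fun i hi ↦ hy i (Multiset.mem_of_mem_erase hi),
      fun i hi ↦ h₀ i (Multiset.mem_of_mem_erase hi), Multiset.cons_erase hmem⟩

theorem partitionSeries_containsUpTo (j : ℕ) :
    partitionSeries (containsUpTo j) = X ^ triangular j * partitionSeries Set.univ := by
  have hempty : partitionSeries ∅ = 0 := by
    ext m
    have : partitionsIn ∅ m = ∅ := by
      ext x
      simp [mem_partitionsIn]
    simp [partitionSeries, this]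
  have hle {y : Multiset ℕ} (hy : y ∈ containsUpTo j) : (range j).val.map (· + 1) ≤ y := by
    refine (Multiset.le_iff_subset ?_).2 fun i hi ↦ ?_
    · exact (range j).nodup.map (add_left_injective 1)
    · obtain ⟨a, ha, rfl⟩ := Multiset.mem_map.1 hi
      exact hy a (by simpa using ha)
  rw [partitionSeries_eq_add (S := containsUpTo j) (S' := ∅) (T := Set.univ) (k := triangular j)
    (fun x ↦ x + (range j).val.map (· + 1)) (Set.empty_subset _), hempty, zero_add]
  · intro x _ h₀
    refine ⟨?_, ?_, Set.notMem_empty _, ?_⟩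
    · intro i hi
      rcases Multiset.mem_add.1 hi with hi | hi
      · exact h₀ i hi
      · obtain ⟨a, -, rfl⟩ := Multiset.mem_map.1 hi
        omega
    · intro i hi
      exact Multiset.mem_add.2 (.inr (Multiset.mem_map.2 ⟨i, by simpa using hi, rfl⟩))
    · rw [Multiset.sum_add]
      rfl
  · intro x _ _ y _ _ h
    exact add_right_cancel h
  · intro y hy _ h₀
    exact ⟨y - (range j).val.map (· + 1), Set.mem_univ _,
      fun i hi ↦ h₀ i (Multiset.mem_of_le (Multiset.sub_le_self _ _) hi),
      Multiset.sub_add_cancel (hle hy)⟩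

theorem partitionsIn_cardLE_eq {m N : ℕ} (h : m ≤ N) :
    partitionsIn (cardLE N) m = partitionsIn Set.univ m := by
  ext x
  simp only [mem_partitionsIn, Set.mem_univ, and_true]
  refine ⟨fun hx ↦ ⟨hx.1, hx.2.1⟩, fun hx ↦ ⟨hx.1, hx.2, ?_⟩⟩
  have := Multiset.card_nsmul_le_sum (s := x) (a := 1) hx.1
  simp only [smul_eq_mul, mul_one] at this
  change Multiset.card x ≤ N
  omega

theorem A_eq_coeff {n N : ℕ} (hN : n < N) :
    (A n : ℤ) = coeff n (∑ d ∈ range N, X ^ (d * (d + 1)) * partitionSeries (cardLE d) *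
      partitionSeries (cardLE d)) := by
  classical
  set U := ((range N).filter fun d ↦ d * (d + 1) ≤ n).sigma fun d ↦
    (antidiagonal (n - d * (d + 1))).sigma fun p ↦
      partitionsIn (cardLE d) p.1 ×ˢ partitionsIn (cardLE d) p.2 with hU
  have hA : A n = #U := by
    have hinj : Set.InjOn (fun u : (_ : ℕ) × (_ : ℕ × ℕ) × (Multiset ℕ × Multiset ℕ) ↦
        (u.1, u.2.2)) U := by
      rintro ⟨d, ⟨a, b⟩, α, β⟩ hu ⟨d', ⟨a', b'⟩, α', β'⟩ hu' h
      simp only [hU, mem_coe, mem_sigma, mem_product, mem_partitionsIn] at hu hu'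
      simp only [Prod.mk.injEq] at h
      obtain ⟨rfl, rfl, rfl⟩ := h
      obtain rfl := hu.2.2.1.2.1.symm.trans hu'.2.2.1.2.1
      obtain rfl := hu.2.2.2.2.1.symm.trans hu'.2.2.2.2.1
      rfl
    rw [← card_image_of_injOn hinj]
    refine Nat.subtype_card _ fun t ↦ ?_
    obtain ⟨d, α, β⟩ := t
    simp only [hU, mem_image, mem_sigma, mem_filter, mem_range, HasAntidiagonal.mem_antidiagonal,
      mem_product, mem_partitionsIn, Sigma.exists, Prod.exists, Prod.mk.injEq, cardLE,
      Set.mem_ofPred_eq]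
    constructor
    · rintro ⟨d, a, b, α, β, h, rfl, rfl, rfl⟩
      exact ⟨h.2.2.1.1, h.2.2.2.1, h.2.2.1.2.2, h.2.2.2.2.2, by omega⟩
    · rintro ⟨h₁, h₂, h₃, h₄, h₅⟩
      have : d ≤ d * (d + 1) := Nat.le_mul_of_pos_right _ (by omega)
      exact ⟨d, α.sum, β.sum, α, β, ⟨⟨by omega, by omega⟩, by omega, ⟨h₁, rfl, h₃⟩, h₂, rfl, h₄⟩,
        rfl, rfl, rfl⟩
  rw [hA, hU, card_sigma, map_sum, sum_filter, Nat.cast_sum]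
  refine sum_congr rfl fun d _ ↦ ?_
  rw [mul_assoc, coeff_X_pow_mul']
  split_ifs
  · simp [card_sigma, coeff_mul, partitionSeries]
  · rfl

theorem B_eq_coeff {n N : ℕ} (hN : n < N) :
    (B n : ℤ) = coeff n (∑ d ∈ range N, X ^ (d * (d + 1)) * partitionSeries (evenLE d)) := by
  classical
  set U := ((range N).filter fun d ↦ d * (d + 1) ≤ n).sigma fun d ↦
    partitionsIn (evenLE d) (n - d * (d + 1)) with hU
  have hB : B n = #U := by
    have hinj : Set.InjOn (fun u : (_ : ℕ) × Multiset ℕ ↦ (u.1, u.2)) U := by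
      rintro ⟨d, γ⟩ _ ⟨d', γ'⟩ _ h
      simp only [Prod.mk.injEq] at h
      obtain ⟨rfl, rfl⟩ := h
      rfl
    rw [← card_image_of_injOn hinj]
    refine Nat.subtype_card _ fun t ↦ ?_
    obtain ⟨d, γ⟩ := t
    simp only [hU, mem_image, mem_sigma, mem_filter, mem_range, mem_partitionsIn, Sigma.exists,
      Prod.mk.injEq, evenLE, Set.mem_ofPred_eq]
    constructor
    · rintro ⟨d, γ, h, rfl, rfl⟩
      exact ⟨fun i hi ↦ ⟨h.2.1 i hi, h.2.2.2 i hi⟩, by omega⟩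
    · rintro ⟨h₁, h₂⟩
      have : d ≤ d * (d + 1) := Nat.le_mul_of_pos_right _ (by omega)
      exact ⟨d, γ, ⟨⟨by omega, by omega⟩, fun i hi ↦ (h₁ i hi).1, by omega,
        fun i hi ↦ (h₁ i hi).2⟩, rfl, rfl⟩
  rw [hB, hU, card_sigma, map_sum, sum_filter, Nat.cast_sum]
  refine sum_congr rfl fun d _ ↦ ?_
  rw [coeff_X_pow_mul']
  split_ifs
  · simp [partitionSeries]
  · rfl

theorem mem_containsUpTo_iff_lt_partMex {n : ℕ} (P : Nat.Partition n) (j : ℕ) :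
    P.parts ∈ containsUpTo j ↔ j < partMex P := by
  have hne : {k : ℕ | 0 < k ∧ k ∉ P.parts}.Nonempty :=
    ⟨n + 1, by omega, fun h ↦ by have := P.le_of_mem_parts h; omega⟩
  obtain ⟨hpos, hnot⟩ := Nat.sInf_mem hne
  constructor
  · intro h
    by_contra! hle
    obtain ⟨k, hk⟩ := Nat.exists_eq_succ_of_ne_zero hpos.ne'
    rw [hk] at hnot
    exact hnot (h k (by unfold partMex at hle; omega))
  · intro h i hi
    by_contra hmem
    have := Nat.sInf_le (s := {k : ℕ | 0 < k ∧ k ∉ P.parts}) ⟨Nat.succ_pos i, hmem⟩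
    unfold partMex at h
    omega

theorem partMex_le {n : ℕ} (P : Nat.Partition n) : partMex P ≤ n + 1 :=
  Nat.sInf_le ⟨by omega, fun h ↦ by have := P.le_of_mem_parts h; omega⟩

theorem sum_neg_one_pow_add_neg_one_pow_triangular (m : ℕ) :
    ∑ j ∈ range m, ((-1 : ℤ) ^ j + (-1) ^ triangular j) = if m % 4 = 1 then 2 else 0 := by
  induction m using Nat.strong_induction_on with
  | _ m ih =>
    match m with
    | 0 => simp
    | 1 => simp [triangular]
    | 2 => simp [sum_range_succ, triangular]
    | 3 => simp [sum_range_succ, triangular]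
    | m + 4 =>
      simp only [sum_range_succ _ (m + 3), sum_range_succ _ (m + 2), sum_range_succ _ (m + 1),
        sum_range_succ _ m, ih m (by omega), Nat.add_mod_right, triangular_succ]
      rcases neg_one_pow_eq_or ℤ m with h | h <;> simp only [pow_succ, pow_add, h] <;> ring

theorem two_mul_card_partMex_eq_coeff {n J : ℕ} (hJ : n < J) :
    (2 * Nat.card {P : Nat.Partition n // partMex P % 4 = 1} : ℤ) =
      coeff n (partitionSeries Set.univ *
        ∑ j ∈ range J, ((-1) ^ j * X ^ triangular j + (-1) ^ triangular j * X ^ triangular j)) := by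
  classical
  have hcoeff (j : ℕ) : coeff n (partitionSeries Set.univ *
      ((-1) ^ j * X ^ triangular j + (-1) ^ triangular j * X ^ triangular j)) =
        ∑ P : Nat.Partition n, if j < partMex P then (-1 : ℤ) ^ j + (-1) ^ triangular j else 0 := by
    have : partitionSeries Set.univ *
        ((-1) ^ j * X ^ triangular j + (-1) ^ triangular j * X ^ triangular j) =
          C ((-1 : ℤ) ^ j + (-1) ^ triangular j) * partitionSeries (containsUpTo j) := by
      rw [partitionSeries_containsUpTo]
      simp only [map_add, map_pow, map_neg, map_one]
      ring
    rw [this, coeff_C_mul, partitionSeries, coeff_mk, card_partitionsIn, ← sum_filter, sum_const,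
      nsmul_eq_mul, mul_comm]
    simp only [mem_containsUpTo_iff_lt_partMex]
  rw [mul_sum, map_sum, sum_congr rfl fun j _ ↦ hcoeff j, sum_comm, Nat.card_eq_fintype_card,
    Fintype.card_subtype, card_filter, Nat.cast_sum, mul_sum]
  refine sum_congr rfl fun P _ ↦ ?_
  have hfilter : (range J).filter (· < partMex P) = range (partMex P) := by
    ext j
    have := partMex_le P
    simp only [mem_filter, mem_range]
    omega
  rw [← sum_filter, hfilter, sum_neg_one_pow_add_neg_one_pow_triangular]
  split_ifs <;> simp

end GeneratingFunction

/-- Twice the number of partitions of `n` with mex congruent to `1` modulo `4` equals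
`A(n) + B(n)`. -/
theorem stmt_8 (n : ℕ) :
    2 * Nat.card {P : Nat.Partition n // partMex P % 4 = 1} = A n + B n := by
  suffices h : (2 * Nat.card {P : Nat.Partition n // partMex P % 4 = 1} : ℤ) = A n + B n by
    exact_mod_cast h
  set N := n + 1 with hN
  rw [two_mul_card_partMex_eq_coeff (show n < 2 * N + 1 by omega), A_eq_coeff (Nat.lt_succ_self n),
    B_eq_coeff (Nat.lt_succ_self n), ← map_add, ← sub_eq_zero, ← map_sub]
  refine PowerSeries.X_pow_dvd_iff.1 ?_ n (Nat.lt_succ_self n)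
  rw [← Ideal.mem_span_singleton, ← Ideal.Quotient.eq]
  set I : Ideal (PowerSeries ℤ) := Ideal.span {PowerSeries.X ^ (n + 1)} with hI
  set π := Ideal.Quotient.mk I with hπ
  set q := π PowerSeries.X with hq_def
  have hq : q ^ N = 0 := by
    rw [hq_def, ← map_pow]
    exact Ideal.Quotient.eq_zero_iff_mem.2 (Ideal.mem_span_singleton_self _)
  set e : ℕ → PowerSeries ℤ ⧸ I := fun d ↦ π (partitionSeries (cardLE d)) with he_def
  set b : ℕ → PowerSeries ℤ ⧸ I := fun d ↦ π (partitionSeries (evenLE d)) with hb_def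
  have he₀ : e 0 = 1 := by simp only [he_def, partitionSeries_cardLE_zero, map_one]
  have hb₀ : b 0 = 1 := by simp only [hb_def, partitionSeries_evenLE_zero, map_one]
  have he (i : ℕ) : e (i + 1) * (1 - q ^ (i + 1)) = e i := by
    simp only [he_def, ← partitionSeries_cardLE_succ i, map_mul, map_sub, map_one, map_pow, hq_def]
  have hb (i : ℕ) : b (i + 1) * (1 - q ^ (2 * (i + 1))) = b i := by
    simp only [hb_def, ← partitionSeries_evenLE_succ i, map_mul, map_sub, map_one, map_pow, hq_def]
  have hp : π (partitionSeries Set.univ) = e N := by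
    refine Ideal.Quotient.eq.2 (Ideal.mem_span_singleton.2 (PowerSeries.X_pow_dvd_iff.2 ?_))
    intro m hm
    simp [partitionSeries, partitionsIn_cardLE_eq (show m ≤ N by omega)]
  have hA := sum_alternating_triangular hq (Nat.succ_pos n) he₀ he (show N ≤ 2 * N + 1 by omega)
  have hB := (sum_even_parts_eq_prod hq (Nat.succ_pos n) hb₀ hb).trans
    (prod_one_add_pow_eq hq he₀ he)
  simp only [map_mul, map_sum, map_add, map_pow, map_neg, map_one, hp]
  rw [sum_add_distrib, mul_add]
  exact congrArg₂ (· + ·) hA.symm hB.symm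
end

section
/- For every integer n ≥ 0, twice the number of partitions of n whose mex is congruent to 3 modulo 4 equals A(n) − B(n), where A(n) is the number of triples (d, α, β) with d ≥ 0 an integer, α and β partitions each having at most d parts, and d(d+1) + |α| + |β| = n; and B(n) is the number of pairs (d, γ) with d ≥ 0 an integer and γ a partition into even parts each at most 2d with d(d+1) + |γ| = n. -/
namespace MexMod

/-- Multisets of positive integers bounded by `d`, with sum `k`. -/
def boundedParts (d k : ℕ) : Set (Multiset ℕ) :=
  {s | (∀ x ∈ s, 0 < x ∧ x ≤ d) ∧ s.sum = k}

/-- Multisets of natural numbers with exactly `d` elements, with sum `k`. -/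
def exactParts (d k : ℕ) : Set (Multiset ℕ) :=
  {s | Multiset.card s = d ∧ s.sum = k}

/-- Multisets of at most `d` positive integers, with sum `k`. -/
def fewParts (d k : ℕ) : Set (Multiset ℕ) :=
  {s | (∀ x ∈ s, 0 < x) ∧ Multiset.card s ≤ d ∧ s.sum = k}

/-- Multisets of positive integers with sum `k` are the same as partitions of `k`. -/
def partitionEquiv (k : ℕ) :
    Nat.Partition k ≃ {s : Multiset ℕ // (∀ x ∈ s, 0 < x) ∧ s.sum = k} where
  toFun P := ⟨P.parts, fun _ hx => P.parts_pos hx, P.parts_sum⟩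
  invFun s := ⟨s.1, fun hx => s.2.1 _ hx, s.2.2⟩
  left_inv _ := rfl
  right_inv _ := rfl

lemma finite_positive_sum (k : ℕ) :
    {s : Multiset ℕ | (∀ x ∈ s, 0 < x) ∧ s.sum = k}.Finite :=
  (Finite.of_equiv _ (partitionEquiv k) :
    Finite {s : Multiset ℕ // (∀ x ∈ s, 0 < x) ∧ s.sum = k})

lemma boundedParts_finite (d k : ℕ) : (boundedParts d k).Finite :=
  (finite_positive_sum k).subset fun _ hs => ⟨fun x hx => (hs.1 x hx).1, hs.2⟩

lemma fewParts_finite (d k : ℕ) : (fewParts d k).Finite :=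
  (finite_positive_sum k).subset fun _ hs => ⟨hs.1, hs.2.2⟩

lemma fewParts_bijOn (d k : ℕ) :
    Set.BijOn (fun s => s + Multiset.replicate (d - Multiset.card s) 0)
      (fewParts d k) (exactParts d k) := by
  have hfilter : ∀ (s : Multiset ℕ) (j : ℕ), (∀ x ∈ s, 0 < x) →
      (s + Multiset.replicate j 0).filter (0 < ·) = s := by
    intro s j hs
    rw [Multiset.filter_add, Multiset.filter_eq_self.2 hs,
      Multiset.filter_eq_nil.2 (fun x hx => by simp [Multiset.eq_of_mem_replicate hx]), add_zero]
  refine ⟨?_, ?_, ?_⟩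
  · rintro s ⟨-, h2, h3⟩
    refine ⟨?_, ?_⟩
    · simp; omega
    · simpa using h3
  · rintro s ⟨h1, -⟩ t ⟨h1', -⟩ h
    rw [← hfilter s _ h1, ← hfilter t _ h1']
    exact congrArg _ h
  · rintro t ⟨h1, h2⟩
    have hsplit := Multiset.filter_add_not (0 < ·) t
    have hz : t.filter (fun x => ¬ 0 < x) =
        Multiset.replicate (Multiset.card (t.filter (fun x => ¬ 0 < x))) 0 :=
      Multiset.eq_replicate.2 ⟨rfl, fun b hb => by
        have := (Multiset.mem_filter.1 hb).2; omega⟩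
    have hc := congrArg Multiset.card hsplit
    rw [Multiset.card_add, h1] at hc
    refine ⟨t.filter (0 < ·), ⟨fun x hx => (Multiset.mem_filter.1 hx).2, by omega, ?_⟩, ?_⟩
    · have hsum := congrArg Multiset.sum hsplit
      rw [Multiset.sum_add, hz] at hsum
      simpa [h2] using hsum
    · dsimp only
      rw [show d - Multiset.card (t.filter (0 < ·)) =
        Multiset.card (t.filter (fun x => ¬ 0 < x)) by omega, ← hz, hsplit]

lemma exactParts_finite (d k : ℕ) : (exactParts d k).Finite :=
  (fewParts_bijOn d k).image_eq ▸ (fewParts_finite d k).image _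

lemma ncard_boundedParts_zero (k : ℕ) :
    (boundedParts 0 k).ncard = if k = 0 then 1 else 0 := by
  have h : boundedParts 0 k = {s | s = 0 ∧ k = 0} := by
    ext s
    constructor
    · rintro ⟨h, h'⟩
      have : s = 0 := Multiset.eq_zero_of_forall_notMem fun x hx => by have := h x hx; omega
      subst this
      exact ⟨rfl, by simpa using h'.symm⟩
    · rintro ⟨rfl, rfl⟩
      exact ⟨by simp, by simp⟩
  rw [h]
  split_ifs with hk <;> simp [hk]

lemma ncard_exactParts_zero (k : ℕ) :
    (exactParts 0 k).ncard = if k = 0 then 1 else 0 := by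
  have h : exactParts 0 k = {s | s = 0 ∧ k = 0} := by
    ext s
    constructor
    · rintro ⟨h, h'⟩
      obtain rfl := Multiset.card_eq_zero.1 h
      exact ⟨rfl, by simpa using h'.symm⟩
    · rintro ⟨rfl, rfl⟩
      exact ⟨by simp, by simp⟩
  rw [h]
  split_ifs with hk <;> simp [hk]

lemma ncard_boundedParts_succ (d k : ℕ) :
    (boundedParts (d + 1) k).ncard = (boundedParts d k).ncard +
      if d + 1 ≤ k then (boundedParts (d + 1) (k - (d + 1))).ncard else 0 := by
  have hun : boundedParts (d + 1) k = boundedParts d k ∪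
      {s | s ∈ boundedParts (d + 1) k ∧ d + 1 ∈ s} := by
    ext s
    constructor
    · intro hs
      by_cases hd : d + 1 ∈ s
      · exact Or.inr ⟨hs, hd⟩
      · refine Or.inl ⟨fun x hx => ?_, hs.2⟩
        have := hs.1 x hx
        have : x ≠ d + 1 := fun h => hd (h ▸ hx)
        omega
    · rintro (hs | hs)
      · exact ⟨fun x hx => by have := hs.1 x hx; omega, hs.2⟩
      · exact hs.1
  have hdisj : Disjoint (boundedParts d k) {s | s ∈ boundedParts (d + 1) k ∧ d + 1 ∈ s} := by
    rw [Set.disjoint_left]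
    rintro s hs ⟨-, hd⟩
    have := hs.1 _ hd
    omega
  rw [hun, Set.ncard_union_eq hdisj (boundedParts_finite _ _)
    ((boundedParts_finite (d + 1) k).subset fun _ h => h.1)]
  congr 1
  split_ifs with hk
  · rw [← Set.ncard_image_of_injective (boundedParts (d + 1) (k - (d + 1)))
      (fun _ _ h => (Multiset.cons_inj_right (d + 1)).1 h)]
    congr 1
    ext s
    constructor
    · rintro ⟨hs, hd⟩
      obtain ⟨t, rfl⟩ := Multiset.exists_cons_of_mem hd
      have h2 := hs.2
      rw [Multiset.sum_cons] at h2
      exact ⟨t, ⟨fun x hx => hs.1 x (Multiset.mem_cons_of_mem hx), by omega⟩, rfl⟩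
    · rintro ⟨t, ht, rfl⟩
      refine ⟨⟨fun x hx => ?_, ?_⟩, Multiset.mem_cons_self _ _⟩
      · rcases Multiset.mem_cons.1 hx with rfl | hx
        · omega
        · exact ht.1 x hx
      · rw [Multiset.sum_cons, ht.2]; omega
  · rw [Set.ncard_eq_zero ((boundedParts_finite (d + 1) k).subset fun _ h => h.1),
      Set.eq_empty_iff_forall_notMem]
    rintro s ⟨hs, hd⟩
    have := Multiset.le_sum_of_mem hd
    have := hs.2
    omega

lemma ncard_exactParts_succ (d k : ℕ) :
    (exactParts (d + 1) k).ncard = (exactParts d k).ncard +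
      if d + 1 ≤ k then (exactParts (d + 1) (k - (d + 1))).ncard else 0 := by
  have hun : exactParts (d + 1) k = (Multiset.cons 0) '' exactParts d k ∪
      {s | s ∈ exactParts (d + 1) k ∧ 0 ∉ s} := by
    ext s
    constructor
    · intro hs
      by_cases hd : 0 ∈ s
      · obtain ⟨t, rfl⟩ := Multiset.exists_cons_of_mem hd
        refine Or.inl ⟨t, ⟨?_, ?_⟩, rfl⟩
        · simpa using hs.1
        · simpa using hs.2
      · exact Or.inr ⟨hs, hd⟩
    · rintro (⟨t, ht, rfl⟩ | hs)
      · exact ⟨by simpa using ht.1, by simpa using ht.2⟩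
      · exact hs.1
  have hdisj : Disjoint ((Multiset.cons 0) '' exactParts d k)
      {s | s ∈ exactParts (d + 1) k ∧ 0 ∉ s} := by
    rw [Set.disjoint_left]
    rintro _ ⟨s, -, rfl⟩ ⟨-, hd⟩
    simp at hd
  rw [hun, Set.ncard_union_eq hdisj ((exactParts_finite _ _).image _)
    ((exactParts_finite (d + 1) k).subset fun _ h => h.1),
    Set.ncard_image_of_injective _ (fun _ _ h => (Multiset.cons_inj_right 0).1 h)]
  congr 1
  have hsum : ∀ t : Multiset ℕ, (t.map Nat.succ).sum = t.sum + Multiset.card t := by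
    intro t
    induction t using Multiset.induction_on with
    | empty => simp
    | cons a t ih => simp only [Multiset.map_cons, Multiset.sum_cons, ih, Multiset.card_cons]; omega
  split_ifs with hk
  · rw [← Set.ncard_image_of_injective (exactParts (d + 1) (k - (d + 1)))
      (Multiset.map_injective Nat.succ_injective)]
    congr 1
    ext s
    constructor
    · rintro ⟨hs, hd⟩
      have hmap : (s.map Nat.pred).map Nat.succ = s := by
        rw [Multiset.map_map]
        conv_rhs => rw [← Multiset.map_id s]
        refine Multiset.map_congr rfl fun x hx => Nat.succ_pred ?_
        rintro rfl
        exact hd hx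
      have h2 := hsum (s.map Nat.pred)
      rw [hmap, Multiset.card_map, hs.1, hs.2] at h2
      exact ⟨s.map Nat.pred, ⟨by rw [Multiset.card_map, hs.1], by omega⟩, hmap⟩
    · rintro ⟨t, ht, rfl⟩
      refine ⟨⟨by rw [Multiset.card_map, ht.1], ?_⟩, by simp⟩
      rw [hsum, ht.1, ht.2]; omega
  · rw [Set.ncard_eq_zero ((exactParts_finite (d + 1) k).subset fun _ h => h.1),
      Set.eq_empty_iff_forall_notMem]
    rintro s ⟨hs, hd⟩
    have := Multiset.card_nsmul_le_sum (s := s) (a := 1) fun x hx =>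
      Nat.one_le_iff_ne_zero.2 fun h => hd (h ▸ hx)
    rw [hs.1, hs.2, smul_eq_mul] at this
    omega

lemma ncard_fewParts (d k : ℕ) : (fewParts d k).ncard = (boundedParts d k).ncard := by
  rw [(fewParts_bijOn d k).ncard_eq]
  induction d generalizing k with
  | zero => rw [ncard_exactParts_zero, ncard_boundedParts_zero]
  | succ d ihd =>
    induction k using Nat.strong_induction_on with
    | _ k ihk =>
      rw [ncard_exactParts_succ, ncard_boundedParts_succ, ihd]
      split_ifs with h
      · rw [ihk _ (by omega)]
      · rfl

open PowerSeries in
/-- The generating function of partitions with parts at most `d`. -/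
noncomputable def boundedGF (d : ℕ) : ℤ⟦X⟧ :=
  mk fun k => ((boundedParts d k).ncard : ℤ)

open PowerSeries in
/-- The generating function of partitions with even parts at most `2 * d`. -/
noncomputable def evenBoundedGF (d : ℕ) : ℤ⟦X⟧ :=
  mk fun k => if Even k then ((boundedParts d (k / 2)).ncard : ℤ) else 0

/-- The triangular number `1 + ⋯ + d`. -/
def tri (d : ℕ) : ℕ := ∑ i ∈ Finset.range (d + 1), i

lemma tri_zero : tri 0 = 0 := rfl

lemma tri_succ (d : ℕ) : tri (d + 1) = tri d + (d + 1) := Finset.sum_range_succ _ _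

lemma two_mul_tri (d : ℕ) : 2 * tri d = d * (d + 1) := by
  have := Finset.sum_range_id_mul_two (d + 1)
  rw [Nat.add_sub_cancel] at this
  rw [tri, mul_comm, this, mul_comm]

lemma tri_mono : Monotone tri := monotone_nat_of_le_succ fun d => by rw [tri_succ]; omega

lemma le_tri (d : ℕ) : d ≤ tri d := by
  cases d with
  | zero => exact Nat.zero_le _
  | succ d => rw [tri_succ]; omega

section Series

open PowerSeries

/-- The generating function of sets of `d` positive integers. -/
noncomputable def distinctGF (d : ℕ) : ℤ⟦X⟧ := X ^ tri d * boundedGF d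

/-- The generating function of sets of `d` positive even integers. -/
noncomputable def evenDistinctGF (d : ℕ) : ℤ⟦X⟧ := X ^ (2 * tri d) * evenBoundedGF d

lemma boundedGF_zero : boundedGF 0 = 1 := by
  ext k
  rw [boundedGF, coeff_mk, ncard_boundedParts_zero, coeff_one]
  split_ifs <;> rfl

lemma boundedGF_succ (d : ℕ) :
    boundedGF (d + 1) = boundedGF d + X ^ (d + 1) * boundedGF (d + 1) := by
  ext k
  rw [map_add, coeff_X_pow_mul', boundedGF, boundedGF, coeff_mk, coeff_mk, coeff_mk,
    ncard_boundedParts_succ]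
  split_ifs <;> simp

lemma evenBoundedGF_zero : evenBoundedGF 0 = 1 := by
  ext k
  rw [evenBoundedGF, coeff_mk, ncard_boundedParts_zero, coeff_one]
  by_cases hk : k = 0
  · simp [hk]
  · rw [if_neg hk]
    split_ifs with h h'
    · obtain ⟨j, rfl⟩ := h
      omega
    · rfl
    · rfl

lemma evenBoundedGF_succ (d : ℕ) :
    evenBoundedGF (d + 1) = evenBoundedGF d + X ^ (2 * (d + 1)) * evenBoundedGF (d + 1) := by
  ext k
  rw [map_add, coeff_X_pow_mul', evenBoundedGF, evenBoundedGF, coeff_mk, coeff_mk, coeff_mk]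
  rcases Nat.even_or_odd' k with ⟨j, rfl | rfl⟩
  · have h1 : (2 * j - 2 * (d + 1)) / 2 = j - (d + 1) := by omega
    have h2 : Even (2 * j - 2 * (d + 1)) := ⟨j - (d + 1), by omega⟩
    rw [if_pos (even_two_mul j), if_pos (even_two_mul j), if_pos h2, h1,
      Nat.mul_div_cancel_left _ two_pos, ncard_boundedParts_succ]
    by_cases h : d + 1 ≤ j
    · rw [if_pos h, if_pos (by omega)]; push_cast; rfl
    · rw [if_neg h, if_neg (by omega)]; push_cast; rfl
  · have h1 : ¬ Even (2 * j + 1) := by simp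
    rw [if_neg h1, if_neg h1]
    split_ifs with h h'
    · obtain ⟨i, hi⟩ := h'
      omega
    · rfl
    · rfl

lemma distinctGF_zero : distinctGF 0 = 1 := by
  rw [distinctGF, boundedGF_zero, tri_zero, pow_zero, one_mul]

lemma distinctGF_succ (d : ℕ) :
    distinctGF (d + 1) = X ^ (d + 1) * (distinctGF (d + 1) + distinctGF d) := by
  simp only [distinctGF, tri_succ]
  conv_lhs => rw [boundedGF_succ]
  ring

lemma evenDistinctGF_zero : evenDistinctGF 0 = 1 := by
  rw [evenDistinctGF, evenBoundedGF_zero, tri_zero, mul_zero, pow_zero, one_mul]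

lemma evenDistinctGF_succ (d : ℕ) :
    evenDistinctGF (d + 1) = X ^ (2 * (d + 1)) * (evenDistinctGF (d + 1) + evenDistinctGF d) := by
  simp only [evenDistinctGF, tri_succ]
  conv_lhs => rw [evenBoundedGF_succ]
  ring

lemma coeff_distinctGF_mul (a b n : ℕ) (h : n < tri b) :
    coeff n (distinctGF a * distinctGF b) = 0 := by
  rw [show distinctGF a * distinctGF b = X ^ tri b * (distinctGF a * boundedGF b) by
    rw [distinctGF, distinctGF]; ring, coeff_X_pow_mul', if_neg (by omega)]

/-- The generating function of pairs of sets of positive integers whose sizes differ by `m`. -/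
noncomputable def pairGF (m : ℕ) : ℤ⟦X⟧ :=
  mk fun n => ∑ d ∈ Finset.range (n + 1), coeff n (distinctGF d * distinctGF (d + m))

lemma coeff_pairGF {n N : ℕ} (m : ℕ) (h : n < N) :
    coeff n (pairGF m) =
      ∑ d ∈ Finset.range N, coeff n (distinctGF d * distinctGF (d + m)) := by
  rw [pairGF, coeff_mk]
  refine Finset.sum_subset (Finset.range_subset_range.2 h) fun d _ hd => ?_
  refine coeff_distinctGF_mul _ _ _ ?_
  have := le_tri (d + m)
  rw [Finset.mem_range] at hd
  omega

lemma pairGF_partial_shift (m N : ℕ) :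
    ∑ d ∈ Finset.range (N + 1), distinctGF d * distinctGF (d + (m + 1)) +
      ∑ d ∈ Finset.range N, distinctGF d * distinctGF (d + (m + 2)) =
    X ^ (m + 1) * (∑ d ∈ Finset.range (N + 1), distinctGF d * distinctGF (d + m) +
      ∑ d ∈ Finset.range (N + 1), distinctGF d * distinctGF (d + (m + 1))) := by
  induction N with
  | zero =>
    simp only [zero_add, Finset.sum_range_one, Finset.sum_range_zero, add_zero]
    linear_combination distinctGF 0 * distinctGF_succ m
  | succ N ih =>
    rw [Finset.sum_range_succ _ (N + 1),
      Finset.sum_range_succ (fun d => distinctGF d * distinctGF (d + (m + 2))) N,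
      Finset.sum_range_succ (fun d => distinctGF d * distinctGF (d + m)) (N + 1)]
    have h1 := distinctGF_succ N
    have h2 := distinctGF_succ (N + m + 1)
    rw [show N + 1 + (m + 1) = N + m + 1 + 1 by ring, show N + (m + 2) = N + m + 1 + 1 by ring,
      show N + 1 + m = N + m + 1 by ring]
    linear_combination ih + (distinctGF (N + 1) + distinctGF N) * h2 -
      X ^ (m + 1) * (distinctGF (N + m + 1) + distinctGF (N + m + 1 + 1)) * h1

lemma pairGF_shift (m : ℕ) :
    pairGF (m + 1) + pairGF (m + 2) = X ^ (m + 1) * (pairGF m + pairGF (m + 1)) := by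
  ext n
  have h := congrArg (coeff n) (pairGF_partial_shift m (n + 1))
  rw [coeff_X_pow_mul', map_add] at h ⊢
  rw [coeff_pairGF (m + 1) (show n < n + 1 + 1 by omega),
    coeff_pairGF (m + 2) (show n < n + 1 by omega), ← map_sum, ← map_sum, h]
  refine if_congr Iff.rfl ?_ rfl
  rw [map_add, map_add, coeff_pairGF m (show n - (m + 1) < n + 1 + 1 by omega),
    coeff_pairGF (m + 1) (show n - (m + 1) < n + 1 + 1 by omega), map_sum, map_sum]

lemma pairGF_add_pairGF_succ (m : ℕ) :
    pairGF m + pairGF (m + 1) = X ^ tri m * (pairGF 0 + pairGF 1) := by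
  induction m with
  | zero => simp [tri_zero]
  | succ m ih => rw [pairGF_shift, ih, tri_succ]; ring

lemma coeff_pairGF_eq_zero {n m : ℕ} (h : n < tri m) : coeff n (pairGF m) = 0 := by
  rw [pairGF, coeff_mk]
  refine Finset.sum_eq_zero fun d _ => coeff_distinctGF_mul _ _ _ ?_
  exact h.trans_le (tri_mono (by omega))

lemma coeff_pairGF_zero_add_one (n : ℕ) :
    coeff n (pairGF 0 + pairGF 1) = ((boundedParts n n).ncard : ℤ) := by
  have h := congrArg (coeff (n + tri n)) (pairGF_add_pairGF_succ n)
  rw [coeff_X_pow_mul, map_add, coeff_pairGF_eq_zero (m := n + 1) (by rw [tri_succ]; omega),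
    add_zero] at h
  rw [← h, pairGF, coeff_mk, Finset.sum_range_succ', Finset.sum_eq_zero, zero_add,
    distinctGF_zero, one_mul, zero_add, distinctGF, coeff_X_pow_mul, boundedGF, coeff_mk]
  intro d _
  refine coeff_distinctGF_mul _ _ _ ?_
  refine lt_of_lt_of_le ?_ (tri_mono (show n + 1 ≤ d + 1 + n by omega))
  rw [tri_succ]; omega

/-- The generating function of sets of positive integers, with a variable marking the size. -/
noncomputable def sizeGF : ℤ⟦X⟧⟦X⟧ := mk distinctGF

lemma sizeGF_eq : sizeGF = (1 + C (X : ℤ⟦X⟧) * X) * rescale (X : ℤ⟦X⟧) sizeGF := by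
  ext1 d
  rw [add_mul, one_mul, map_add, mul_assoc, coeff_C_mul, coeff_rescale]
  cases d with
  | zero => simp
  | succ d =>
    rw [coeff_succ_X_mul, coeff_rescale, sizeGF, coeff_mk, coeff_mk]
    linear_combination distinctGF_succ d

lemma coeff_sizeGF_mul_neg (d : ℕ) :
    coeff (2 * d) (sizeGF * rescale (-1 : ℤ⟦X⟧) sizeGF) = (-1) ^ d * evenDistinctGF d := by
  set V := sizeGF * rescale (-1 : ℤ⟦X⟧) sizeGF with hV
  have hneg : rescale (-1 : ℤ⟦X⟧) sizeGF =
      (1 - C (X : ℤ⟦X⟧) * X) * rescale (X : ℤ⟦X⟧) (rescale (-1 : ℤ⟦X⟧) sizeGF) := by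
    conv_lhs => rw [sizeGF_eq]
    rw [map_mul, rescale_rescale, rescale_rescale, mul_comm (X : ℤ⟦X⟧)]
    congr 1
    ext1 k
    rcases k with _ | _ | k <;> simp [coeff_rescale, coeff_one]
  have hfun : V = rescale (X : ℤ⟦X⟧) V - C ((X : ℤ⟦X⟧) ^ 2) * (X ^ 2 * rescale (X : ℤ⟦X⟧) V) := by
    conv_lhs => rw [hV, hneg]
    conv_lhs => enter [1]; rw [sizeGF_eq]
    rw [hV, map_mul, map_pow]
    ring
  induction d with
  | zero =>
    rw [hV, mul_zero, coeff_mul, Finset.Nat.antidiagonal_zero, Finset.sum_singleton, coeff_rescale]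
    simp [sizeGF, distinctGF_zero, evenDistinctGF_zero]
  | succ d ih =>
    have h := congrArg (coeff (2 * d + 2)) hfun
    rw [map_sub, coeff_C_mul, coeff_X_pow_mul, coeff_rescale, coeff_rescale, ih] at h
    have hne : (1 : ℤ⟦X⟧) - X ^ (2 * d + 2) ≠ 0 := by
      intro h0
      have := congrArg (coeff 0) h0
      simp at this
    refine mul_left_cancel₀ hne ?_
    have he := evenDistinctGF_succ d
    rw [show 2 * (d + 1) = 2 * d + 2 by ring] at he ⊢
    linear_combination h + (-1) ^ (d + 1) * (-1) * he

end Series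

lemma sum_signed_antidiagonal_eq (h : ℕ → ℕ → ℤ) (hsymm : ∀ a b, h a b = h b a) (d : ℕ) :
    (-1) ^ d * ∑ p ∈ Finset.HasAntidiagonal.antidiagonal (2 * d), (-1) ^ p.2 * h p.1 p.2 =
      h d d + 2 * ∑ j ∈ Finset.range d, (-1) ^ (j + 1) * h (d - (j + 1)) (d + (j + 1)) := by
  have hsq : ∀ k : ℕ, (-1 : ℤ) ^ k * (-1) ^ k = 1 := fun k => by
    rw [← mul_pow]; norm_num
  rw [Finset.Nat.sum_antidiagonal_eq_sum_range_succ (fun a b => (-1 : ℤ) ^ b * h a b),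
    show (2 * d).succ = d + (1 + d) by omega, Finset.sum_range_add, Finset.sum_range_add,
    Finset.sum_range_one, ← Finset.sum_range_reflect, mul_add, mul_add, Finset.mul_sum,
    Finset.mul_sum, two_mul (∑ j ∈ Finset.range d, _)]
  have h1 : ∀ j ∈ Finset.range d, (-1 : ℤ) ^ d * ((-1) ^ (2 * d - (d - 1 - j)) *
      h (d - 1 - j) (2 * d - (d - 1 - j))) =
      (-1) ^ (j + 1) * h (d - (j + 1)) (d + (j + 1)) := by
    intro j hj
    rw [Finset.mem_range] at hj
    rw [show 2 * d - (d - 1 - j) = d + (j + 1) by omega,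
      show d - 1 - j = d - (j + 1) by omega, pow_add _ d]
    linear_combination (-1) ^ (j + 1) * h (d - (j + 1)) (d + (j + 1)) * hsq d
  have h2 : ∀ j ∈ Finset.range d, (-1 : ℤ) ^ d * ((-1) ^ (2 * d - (d + (1 + j))) *
      h (d + (1 + j)) (2 * d - (d + (1 + j)))) =
      (-1) ^ (j + 1) * h (d - (j + 1)) (d + (j + 1)) := by
    intro j hj
    rw [Finset.mem_range] at hj
    rw [show 2 * d - (d + (1 + j)) = d - (j + 1) by omega, add_comm 1 j,
      hsymm (d + (j + 1))]
    obtain ⟨i, rfl⟩ := Nat.exists_eq_add_of_lt hj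
    rw [show j + i + 1 - (j + 1) = i by omega, show j + i + 1 = i + (j + 1) by ring, pow_add]
    linear_combination (-1) ^ (j + 1) * h i (i + (j + 1) + (j + 1)) * hsq i
  have h3 : (-1 : ℤ) ^ d * ((-1) ^ (2 * d - (d + 0)) *
      h (d + 0) (2 * d - (d + 0))) = h d d := by
    rw [show 2 * d - (d + 0) = d by omega, add_zero, ← mul_assoc, hsq, one_mul]
  rw [Finset.sum_congr rfl h1, Finset.sum_congr rfl h2, h3]
  ring

lemma sum_signed_antidiagonal (h : ℕ → ℕ → ℤ) (N : ℕ) (hsymm : ∀ a b, h a b = h b a)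
    (hsupp : ∀ a b, N ≤ b → h a b = 0) :
    ∑ d ∈ Finset.range N,
        (-1) ^ d * ∑ p ∈ Finset.HasAntidiagonal.antidiagonal (2 * d), (-1) ^ p.2 * h p.1 p.2 =
      ∑ d ∈ Finset.range N, h d d + 2 * ∑ j ∈ Finset.range N,
        (-1) ^ (j + 1) * ∑ d ∈ Finset.range N, h d (d + 2 * (j + 1)) := by
  rw [Finset.sum_congr rfl fun d _ => sum_signed_antidiagonal_eq h hsymm d,
    Finset.sum_add_distrib, ← Finset.mul_sum]
  congr 2
  rw [Finset.sum_comm' (t' := Finset.range N) (s' := fun j => Finset.Ico (j + 1) N)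
    (by intro x y; simp only [Finset.mem_range, Finset.mem_Ico]; omega)]
  refine Finset.sum_congr rfl fun j hj => ?_
  rw [Finset.mem_range] at hj
  rw [Finset.mul_sum, Finset.sum_Ico_eq_sum_range]
  have hext : ∑ k ∈ Finset.range (N - (j + 1)), (-1) ^ (j + 1) * h k (k + 2 * (j + 1)) =
      ∑ k ∈ Finset.range N, (-1) ^ (j + 1) * h k (k + 2 * (j + 1)) := by
    refine Finset.sum_subset (Finset.range_subset_range.2 (by omega)) fun k _ hk => ?_
    rw [Finset.mem_range] at hk
    rw [hsupp _ _ (by omega), mul_zero]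
  rw [← hext]
  refine Finset.sum_congr rfl fun k _ => ?_
  rw [show j + 1 + k - (j + 1) = k by omega, show j + 1 + k + (j + 1) = k + 2 * (j + 1) by ring]

open PowerSeries in
lemma sum_coeff_evenDistinctGF {n N : ℕ} (hN : n < N) :
    ∑ d ∈ Finset.range N, coeff n (evenDistinctGF d) = coeff n (pairGF 0) +
      2 * ∑ j ∈ Finset.range N, (-1) ^ (j + 1) * coeff n (pairGF (2 * (j + 1))) := by
  have h := sum_signed_antidiagonal (fun a b => coeff n (distinctGF a * distinctGF b)) N
    (fun a b => by rw [mul_comm])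
    (fun a b hb => coeff_distinctGF_mul a b n (by have := le_tri b; omega))
  simp only [coeff_pairGF _ hN]
  refine Eq.trans (Finset.sum_congr rfl fun d _ => ?_) h
  have hd : evenDistinctGF d =
      (-1) ^ d * coeff (2 * d) (sizeGF * rescale (-1 : ℤ⟦X⟧) sizeGF) := by
    rw [coeff_sizeGF_mul_neg, ← mul_assoc, ← mul_pow]; norm_num
  have hC : ∀ k : ℕ, ((-1) ^ k : ℤ⟦X⟧) = C ((-1 : ℤ) ^ k) := fun k => by simp
  rw [hd, hC, coeff_C_mul, coeff_mul, map_sum]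
  congr 1
  refine Finset.sum_congr rfl fun p _ => ?_
  rw [coeff_rescale, hC, sizeGF, coeff_mk, coeff_mk, mul_left_comm, coeff_C_mul]

lemma ncard_eq_sum_fiber {α ι : Type*} (S : Set α) (f : α → ι) (I : Finset ι)
    (hI : ∀ x ∈ S, f x ∈ I) (hfin : ∀ i ∈ I, {x | x ∈ S ∧ f x = i}.Finite) :
    S.ncard = ∑ i ∈ I, {x | x ∈ S ∧ f x = i}.ncard := by
  classical
  have hS : S.Finite := (I.finite_toSet.biUnion hfin).subset fun x hx =>
    Set.mem_biUnion (hI x hx) ⟨hx, rfl⟩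
  rw [Set.ncard_eq_toFinset_card S hS, Finset.card_eq_sum_card_fiberwise (f := f) (t := I)
    (fun x hx => hI x (hS.mem_toFinset.1 hx))]
  refine Finset.sum_congr rfl fun i _ => ?_
  rw [← Set.ncard_coe_finset]
  congr 1
  ext x
  simp

open PowerSeries in
lemma A_eq_coeff (n : ℕ) : (A n : ℤ) = coeff n (pairGF 0) := by
  set S : Set (ℕ × Multiset ℕ × Multiset ℕ) := {t | (∀ x ∈ t.2.1, 0 < x) ∧ (∀ x ∈ t.2.2, 0 < x) ∧
    Multiset.card t.2.1 ≤ t.1 ∧ Multiset.card t.2.2 ≤ t.1 ∧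
    t.1 * (t.1 + 1) + t.2.1.sum + t.2.2.sum = n} with hS
  have hA : A n = S.ncard := Nat.card_coe_set_eq S
  have hfib : ∀ d : ℕ, ∀ p : ℕ × ℕ, 2 * tri d + p.1 + p.2 = n →
      {t | t ∈ S ∧ (⟨t.1, t.2.1.sum, t.2.2.sum⟩ : Σ _ : ℕ, ℕ × ℕ) = ⟨d, p⟩} =
        (fun q => (d, q)) '' (fewParts d p.1 ×ˢ fewParts d p.2) := by
    rintro d ⟨i, j⟩ hij
    rw [two_mul_tri] at hij
    ext ⟨d', α, β⟩
    constructor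
    · rintro ⟨⟨h1, h2, h3, h4, -⟩, heq⟩
      simp only [Sigma.mk.injEq, heq_eq_eq, Prod.mk.injEq] at heq
      obtain ⟨rfl, rfl, rfl⟩ := heq
      exact ⟨(α, β), ⟨⟨h1, h3, rfl⟩, ⟨h2, h4, rfl⟩⟩, rfl⟩
    · rintro ⟨⟨α', β'⟩, ⟨⟨h1, h3, h5⟩, ⟨h2, h4, h6⟩⟩, heq⟩
      simp only [Prod.mk.injEq] at heq h1 h2 h3 h4 h5 h6 hij
      obtain ⟨rfl, rfl, rfl⟩ := heq
      subst h5 h6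
      exact ⟨⟨h1, h2, h3, h4, hij⟩, rfl⟩
  have hmem : ∀ d : ℕ, ∀ p : ℕ × ℕ,
      p ∈ (if 2 * tri d ≤ n then Finset.HasAntidiagonal.antidiagonal (n - 2 * tri d) else ∅) ↔
        2 * tri d + p.1 + p.2 = n := by
    intro d p
    split_ifs with h
    · rw [Finset.HasAntidiagonal.mem_antidiagonal]; omega
    · simp only [Finset.notMem_empty, false_iff]; omega
  rw [hA, ncard_eq_sum_fiber S (fun t => (⟨t.1, t.2.1.sum, t.2.2.sum⟩ : Σ _ : ℕ, ℕ × ℕ))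
    ((Finset.range (n + 1)).sigma fun d =>
      if 2 * tri d ≤ n then Finset.HasAntidiagonal.antidiagonal (n - 2 * tri d) else ∅),
    Finset.sum_sigma,
    coeff_pairGF 0 (Nat.lt_succ_self n)]
  · push_cast
    refine Finset.sum_congr rfl fun d _ => ?_
    rw [Finset.sum_congr rfl fun p hp => by rw [hfib d p ((hmem d p).1 hp),
      Set.ncard_image_of_injective _ (Prod.mk_right_injective d), Set.ncard_prod,
      ncard_fewParts, ncard_fewParts]]
    rw [add_zero, show distinctGF d * distinctGF d =
      X ^ (2 * tri d) * (boundedGF d * boundedGF d) by rw [distinctGF]; ring, coeff_X_pow_mul']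
    split_ifs
    · rw [coeff_mul]
      refine Finset.sum_congr rfl fun p _ => ?_
      simp [boundedGF]
    · rfl
  · rintro ⟨d, α, β⟩ ⟨-, -, -, -, h⟩
    rw [Finset.mem_sigma, hmem, two_mul_tri, Finset.mem_range]
    simp only at h ⊢
    have := two_mul_tri d
    have := le_tri d
    exact ⟨by omega, h⟩
  · rintro ⟨d, p⟩ hp
    rw [Finset.mem_sigma, hmem] at hp
    rw [hfib d p hp.2]
    exact ((fewParts_finite _ _).prod (fewParts_finite _ _)).image _

lemma sum_map_two_mul (s : Multiset ℕ) : (s.map (2 * ·)).sum = 2 * s.sum :=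
  Multiset.sum_map_mul_left.trans (by rw [Multiset.map_id'])

open PowerSeries in
lemma B_eq_coeff (n : ℕ) :
    (B n : ℤ) = ∑ d ∈ Finset.range (n + 1), coeff n (evenDistinctGF d) := by
  set S : Set (ℕ × Multiset ℕ) := {t | (∀ x ∈ t.2, 0 < x ∧ Even x ∧ x ≤ 2 * t.1) ∧
    t.1 * (t.1 + 1) + t.2.sum = n} with hS
  have hB : B n = S.ncard := Nat.card_coe_set_eq S
  have hfib : ∀ d : ℕ, {t | t ∈ S ∧ t.1 = d} =
      if 2 * tri d ≤ n ∧ Even (n - 2 * tri d) then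
        (fun s => (d, s.map (2 * ·))) '' boundedParts d ((n - 2 * tri d) / 2) else ∅ := by
    intro d
    have key : ∀ t : ℕ × Multiset ℕ, t ∈ {t | t ∈ S ∧ t.1 = d} ↔
        ∃ s : Multiset ℕ, (∀ x ∈ s, 0 < x ∧ x ≤ d) ∧
          2 * tri d + 2 * s.sum = n ∧ (d, s.map (2 * ·)) = t := by
      rintro ⟨d', γ⟩
      constructor
      · rintro ⟨⟨h1, h2⟩, rfl⟩
        simp only at h1 h2
        have hmap : (γ.map (· / 2)).map (2 * ·) = γ := by
          rw [Multiset.map_map]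
          conv_rhs => rw [← Multiset.map_id γ]
          exact Multiset.map_congr rfl fun x hx => Nat.two_mul_div_two_of_even (h1 x hx).2.1
        refine ⟨γ.map (· / 2), fun x hx => ?_, ?_, by rw [hmap]⟩
        · obtain ⟨y, hy, rfl⟩ := Multiset.mem_map.1 hx
          obtain ⟨h3, ⟨z, rfl⟩, h5⟩ := h1 y hy
          omega
        · rw [two_mul_tri, ← sum_map_two_mul, hmap, h2]
      · rintro ⟨s, h1, h2, heq⟩
        simp only [Prod.mk.injEq] at heq
        obtain ⟨rfl, rfl⟩ := heq
        refine ⟨⟨fun x hx => ?_, ?_⟩, rfl⟩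
        · obtain ⟨y, hy, rfl⟩ := Multiset.mem_map.1 hx
          have := h1 y hy
          exact ⟨by omega, even_two_mul y, by simp only; omega⟩
        · rw [← two_mul_tri]
          simp only [sum_map_two_mul, h2]
    ext t
    rw [key]
    split_ifs with h
    · obtain ⟨h1, j, hj⟩ := h
      constructor
      · rintro ⟨s, h1, h2, rfl⟩
        exact ⟨s, ⟨h1, by omega⟩, rfl⟩
      · rintro ⟨s, ⟨h1, h2⟩, rfl⟩
        exact ⟨s, h1, by omega, rfl⟩
    · simp only [Set.mem_empty_iff_false, iff_false]
      rintro ⟨s, -, h2, -⟩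
      exact h ⟨by omega, s.sum, by omega⟩
  rw [hB, ncard_eq_sum_fiber S Prod.fst (Finset.range (n + 1))]
  · push_cast
    refine Finset.sum_congr rfl fun d _ => ?_
    rw [hfib, evenDistinctGF, coeff_X_pow_mul', evenBoundedGF, coeff_mk]
    have hinj : Function.Injective fun s : Multiset ℕ => (d, s.map (2 * ·)) := fun s t h =>
      Multiset.map_injective (fun a b hab => Nat.eq_of_mul_eq_mul_left two_pos hab)
        (Prod.mk_right_injective d h)
    by_cases h1 : 2 * tri d ≤ n
    · by_cases h2 : Even (n - 2 * tri d)
      · rw [if_pos ⟨h1, h2⟩, if_pos h1, if_pos h2, Set.ncard_image_of_injective _ hinj]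
      · rw [if_neg fun h => h2 h.2, if_pos h1, if_neg h2, Set.ncard_empty, Nat.cast_zero]
    · rw [if_neg fun h => h1 h.1, if_neg h1, Set.ncard_empty, Nat.cast_zero]
  · rintro ⟨d, γ⟩ ⟨-, h⟩
    simp only [Finset.mem_range] at h ⊢
    have := two_mul_tri d
    have := le_tri d
    omega
  · intro d _
    rw [hfib]
    split_ifs
    · exact (boundedParts_finite _ _).image _
    · exact Set.finite_empty

lemma lt_partMex_iff {n : ℕ} (P : Nat.Partition n) (k : ℕ) :
    k < partMex P ↔ ∀ i, 0 < i → i ≤ k → i ∈ P.parts := by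
  constructor
  · intro h i hi hik
    by_contra hc
    exact Nat.notMem_of_lt_sInf (lt_of_le_of_lt hik h) ⟨hi, hc⟩
  · intro h
    have hne : {k : ℕ | 0 < k ∧ k ∉ P.parts}.Nonempty :=
      ⟨n + 1, Nat.succ_pos n, fun hn => by
        have := Multiset.le_sum_of_mem hn
        rw [P.parts_sum] at this
        omega⟩
    obtain ⟨h1, h2⟩ := Nat.sInf_mem hne
    by_contra hc
    exact h2 (h _ h1 (not_lt.1 hc))

lemma partMex_le {n : ℕ} (P : Nat.Partition n) : partMex P ≤ n + 1 := by
  by_contra hc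
  have := Multiset.le_sum_of_mem
    ((lt_partMex_iff P (n + 1)).1 (not_le.1 hc) (n + 1) (Nat.succ_pos n) le_rfl)
  rw [P.parts_sum] at this
  omega

lemma sum_Icc_one (k : ℕ) : (Finset.Icc 1 k).val.sum = tri k := by
  induction k with
  | zero => rfl
  | succ k ih =>
    have h := Finset.sum_Icc_succ_top (show 1 ≤ k + 1 by omega) (fun i : ℕ => i)
    rw [Finset.sum_eq_multiset_sum, Finset.sum_eq_multiset_sum, Multiset.map_id',
      Multiset.map_id', ih] at h
    rw [h, tri_succ]

open PowerSeries in
lemma ncard_lt_partMex (n k : ℕ) :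
    (({P : Nat.Partition n | k < partMex P}.ncard : ℕ) : ℤ) =
      coeff n (pairGF k) + coeff n (pairGF (k + 1)) := by
  rw [← map_add, pairGF_add_pairGF_succ, coeff_X_pow_mul', coeff_pairGF_zero_add_one]
  have hinj : Function.Injective (fun P : Nat.Partition n => P.parts) := fun P Q h =>
    Nat.Partition.ext h
  rw [← Set.ncard_image_of_injective _ hinj]
  have himg : ∀ s : Multiset ℕ, s ∈ (fun P : Nat.Partition n => P.parts) '' {P | k < partMex P} ↔
      ((∀ x ∈ s, 0 < x) ∧ s.sum = n) ∧ (Finset.Icc 1 k).val ≤ s := by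
    intro s
    rw [Finset.val_le_iff_val_subset]
    constructor
    · rintro ⟨P, hP, rfl⟩
      refine ⟨⟨fun _ hx => P.parts_pos hx, P.parts_sum⟩, fun i hi => ?_⟩
      have hi := Finset.mem_Icc.1 (Finset.mem_def.2 hi)
      exact (lt_partMex_iff P k).1 hP i hi.1 hi.2
    · rintro ⟨⟨h1, h2⟩, h3⟩
      exact ⟨(partitionEquiv n).symm ⟨s, h1, h2⟩,
        (lt_partMex_iff _ k).2 fun i hi hik =>
          h3 (Finset.mem_Icc.2 ⟨hi, hik⟩), rfl⟩
  split_ifs with h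
  · rw [← Set.ncard_image_of_injective (boundedParts _ _)
      (add_right_injective (Finset.Icc 1 k).val)]
    congr 2
    ext s
    rw [himg]
    constructor
    · rintro ⟨⟨h1, h2⟩, h3⟩
      obtain ⟨t, rfl⟩ := Multiset.le_iff_exists_add.1 h3
      rw [Multiset.sum_add, sum_Icc_one] at h2
      refine ⟨t, ⟨fun x hx => ⟨h1 x (Multiset.mem_add.2 (Or.inr hx)), ?_⟩, by omega⟩, rfl⟩
      have := Multiset.le_sum_of_mem hx
      omega
    · rintro ⟨t, ⟨h1, h2⟩, rfl⟩
      refine ⟨⟨fun x hx => ?_, ?_⟩, Multiset.le_add_right _ _⟩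
      · rcases Multiset.mem_add.1 hx with hx | hx
        · exact (Finset.mem_Icc.1 (Finset.mem_def.2 hx)).1
        · exact (h1 x hx).1
      · simp only [Multiset.sum_add, sum_Icc_one, h2]; omega
  · rw [Nat.cast_eq_zero]
    convert Set.ncard_empty (Multiset ℕ)
    refine Set.eq_empty_iff_forall_notMem.2 fun s hs => h ?_
    obtain ⟨⟨-, h2⟩, h3⟩ := (himg s).1 hs
    obtain ⟨t, rfl⟩ := Multiset.le_iff_exists_add.1 h3
    rw [Multiset.sum_add, sum_Icc_one] at h2
    omega

open PowerSeries in
lemma ncard_partMex_eq (n k : ℕ) :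
    (({P : Nat.Partition n | partMex P = k + 1}.ncard : ℕ) : ℤ) =
      coeff n (pairGF k) - coeff n (pairGF (k + 2)) := by
  have hun : {P : Nat.Partition n | k < partMex P} =
      {P | partMex P = k + 1} ∪ {P | k + 1 < partMex P} := by
    ext P
    simp only [Set.mem_ofPred_eq, Set.mem_union]
    omega
  have hdisj : Disjoint {P : Nat.Partition n | partMex P = k + 1} {P | k + 1 < partMex P} := by
    rw [Set.disjoint_left]
    intro P hP hP'
    simp only [Set.mem_ofPred_eq] at hP hP'
    omega
  have h1 := ncard_lt_partMex n k
  have h2 := ncard_lt_partMex n (k + 1)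
  rw [hun, Set.ncard_union_eq hdisj (Set.toFinite _) (Set.toFinite _)] at h1
  push_cast at h1
  linarith

open PowerSeries in
lemma ncard_partMex_mod_four (n : ℕ) :
    ((Nat.card {P : Nat.Partition n // partMex P % 4 = 3} : ℕ) : ℤ) =
      ∑ i ∈ Finset.range (n + 1),
        (coeff n (pairGF (4 * i + 2)) - coeff n (pairGF (4 * i + 4))) := by
  rw [show Nat.card {P : Nat.Partition n // partMex P % 4 = 3} =
      {P : Nat.Partition n | partMex P % 4 = 3}.ncard from Nat.card_coe_set_eq _,
    ncard_eq_sum_fiber _ (fun P => partMex P / 4) (Finset.range (n + 1))]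
  · push_cast
    refine Finset.sum_congr rfl fun i _ => ?_
    rw [← ncard_partMex_eq]
    congr 2
    ext P
    simp only [Set.mem_ofPred_eq]
    omega
  · intro P _
    have := partMex_le P
    rw [Finset.mem_range]
    omega
  · exact fun _ _ => Set.toFinite _

lemma sum_range_two_mul_alternating (c : ℕ → ℤ) (K : ℕ) :
    ∑ j ∈ Finset.range (2 * K), (-1) ^ (j + 1) * c (2 * (j + 1)) =
      - ∑ i ∈ Finset.range K, (c (4 * i + 2) - c (4 * i + 4)) := by
  induction K with
  | zero => simp
  | succ K ih =>
    rw [show 2 * (K + 1) = 2 * K + 1 + 1 by ring, Finset.sum_range_succ, Finset.sum_range_succ, ih,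
      Finset.sum_range_succ, show 2 * (2 * K + 1) = 4 * K + 2 by ring,
      show 2 * (2 * K + 1 + 1) = 4 * K + 4 by ring]
    have hpow : (-1 : ℤ) ^ (2 * K) = 1 := by rw [pow_mul, neg_one_sq, one_pow]
    linear_combination (c (4 * K + 4) - c (4 * K + 2)) * hpow

open PowerSeries in
lemma B_eq_coeff_of_lt {n N : ℕ} (hN : n < N) :
    (B n : ℤ) = ∑ d ∈ Finset.range N, coeff n (evenDistinctGF d) := by
  rw [B_eq_coeff]
  refine Finset.sum_subset (Finset.range_subset_range.2 hN) fun d _ hd => ?_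
  have := le_tri d
  rw [Finset.mem_range] at hd
  rw [evenDistinctGF, coeff_X_pow_mul', if_neg (by omega)]

end MexMod

/-- Twice the number of partitions of `n` with mex congruent to `3` modulo `4` equals
`A(n) - B(n)`. -/
theorem stmt_9 (n : ℕ) :
    (2 * Nat.card {P : Nat.Partition n // partMex P % 4 = 3} : ℤ) = (A n : ℤ) - B n := by
  have hN : n < 2 * (n + 1) := by omega
  rw [MexMod.ncard_partMex_mod_four, MexMod.A_eq_coeff, MexMod.B_eq_coeff_of_lt hN,
    MexMod.sum_coeff_evenDistinctGF hN,
    MexMod.sum_range_two_mul_alternating fun m => PowerSeries.coeff n (MexMod.pairGF m)]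
  ring
end

section
/- For every integer n ≥ 1: if n is odd then m^o_{1,4}(n) = m^e_{3,4}(n), and if n is even then m^o_{1,4}(n) = m^e_{3,4}(n) + q^o(n/2). Here m^o_{1,4}(n) counts partitions of n with mex ≡ 1 (mod 4) and an odd number of parts, m^e_{3,4}(n) counts partitions of n with mex ≡ 3 (mod 4) and an even number of parts, and q^o(m) counts partitions of m into distinct parts with an odd number of parts. -/
/-- `qOdd m` is the number of partitions of `m` into distinct parts having an odd number
of parts. -/
noncomputable def qOdd (m : ℕ) : ℕ :=
  Nat.card {P : Nat.Partition m // P.parts.Nodup ∧ Odd (Multiset.card P.parts)}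

open Finset PowerSeries Filter
open scoped PowerSeries.WithPiTopology Topology

/-- Cleared form of Shanks's finite version of Gauss's triangular number identity. -/
theorem shanks_identity {A : Type*} [CommRing A] (x : A) (n : ℕ) :
    (∏ i ∈ range n, (1 - x ^ (2 * i + 1))) * ∑ s ∈ range (2 * n), x ^ (s * (s + 1) / 2) =
      ∑ s ∈ range n, x ^ (s * (2 * n + 1)) * (∏ i ∈ range s, (1 - x ^ (2 * i + 1))) *
        ∏ i ∈ Ico s n, (1 - x ^ (2 * i + 2)) := by
  induction n with
  | zero => simp
  | succ n ih =>
    set O : ℕ → A := fun s => ∏ i ∈ range s, (1 - x ^ (2 * i + 1)) with hO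
    set a : ℕ → A := fun s => x ^ (s * (2 * n + 1)) * O s * ∏ i ∈ Ico s n, (1 - x ^ (2 * i + 2))
      with ha
    have hOs (s : ℕ) : O (s + 1) = O s * (1 - x ^ (2 * s + 1)) := prod_range_succ _ _
    have htel : ∑ s ∈ range n, (a (s + 1) * (1 - x ^ (2 * (s + 1))) - a s * (1 - x ^ (2 * s))) =
        a n * (1 - x ^ (2 * n)) - a 0 * (1 - x ^ (2 * 0)) :=
      sum_range_sub (fun s => a s * (1 - x ^ (2 * s))) n
    have hstep : ∀ s ∈ range n, x ^ (s * (2 * (n + 1) + 1)) * O s *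
        ∏ i ∈ Ico s (n + 1), (1 - x ^ (2 * i + 2)) = (1 - x ^ (2 * n + 1)) * a s +
          (a (s + 1) * (1 - x ^ (2 * (s + 1))) - a s * (1 - x ^ (2 * s))) := by
      intro s hs
      have hs' : s < n := by simpa using hs
      rw [prod_Ico_succ_top hs'.le]
      simp only [ha, hOs]
      rw [prod_eq_prod_Ico_succ_bot hs']
      ring
    have han : a n = x ^ (n * (2 * n + 1)) * O n := by simp [ha]
    have e1 : 2 * n * (2 * n + 1) / 2 = n * (2 * n + 1) := by
      rw [mul_assoc]; exact Nat.mul_div_cancel_left _ two_pos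
    have e2 : (2 * n + 1) * (2 * n + 1 + 1) / 2 = n * (2 * n + 1) + (2 * n + 1) := by
      rw [show (2 * n + 1) * (2 * n + 1 + 1) = 2 * (n * (2 * n + 1) + (2 * n + 1)) by ring]
      exact Nat.mul_div_cancel_left _ two_pos
    change O (n + 1) * _ = ∑ s ∈ range (n + 1), x ^ (s * (2 * (n + 1) + 1)) * O s *
        ∏ i ∈ Ico s (n + 1), (1 - x ^ (2 * i + 2))
    change O n * _ = ∑ s ∈ range n, a s at ih
    rw [sum_range_succ, sum_congr rfl hstep, sum_add_distrib, htel, ← mul_sum, ← ih, hOs, han,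
      show 2 * (n + 1) = 2 * n + 1 + 1 by ring, sum_range_succ, sum_range_succ, e1, e2]
    simp only [Nat.Ico_succ_singleton, prod_singleton]
    ring

theorem PowerSeries.tendsto_zero_of_X_pow_dvd {f : ℕ → ℤ⟦X⟧} (h : ∀ n, X ^ n ∣ f n) :
    Tendsto f atTop (𝓝 0) := by
  rw [WithPiTopology.tendsto_iff_coeff_tendsto]
  refine fun d => tendsto_atTop_of_eventually_const (i₀ := d + 1) fun n hn => ?_
  rw [map_zero]
  exact X_pow_dvd_iff.mp (h n) d (by omega)

theorem PowerSeries.tendsto_order_C_mul_X_pow (e : ℕ → ℕ) (he : ∀ i, i ≤ e i) (z : ℕ → ℤ) :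
    Tendsto (fun i => (C (z i) * (X : ℤ⟦X⟧) ^ e i).order) atTop (𝓝 ⊤) := by
  refine ENat.tendsto_nhds_top_iff_natCast_lt.mpr fun n =>
    eventually_atTop.mpr ⟨n + 1, fun m hm => ?_⟩
  grw [← le_order_mul, order_X_pow]
  refine lt_add_of_nonneg_of_lt (by simp) ?_
  have := he m
  norm_cast
  omega

/-- The infinite product of the factors `1 - z * X ^ e i`. -/
noncomputable def eulerProd (e : ℕ → ℕ) (z : ℤ) : ℤ⟦X⟧ := ∏' i, (1 - C z * X ^ e i)

theorem hasProd_eulerProd {e : ℕ → ℕ} (he : ∀ i, i < e i) (z : ℤ) :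
    HasProd (fun i => 1 - C z * (X : ℤ⟦X⟧) ^ e i) (eulerProd e z) := by
  have h := WithPiTopology.multipliable_one_add_of_tendsto_order_atTop_nhds_top ℤ
    (tendsto_order_C_mul_X_pow e (fun i => (he i).le) fun _ => -z)
  simp only [map_neg, neg_mul, ← sub_eq_add_neg] at h
  exact h.hasProd

theorem tendsto_eulerProd {e : ℕ → ℕ} (he : ∀ i, i < e i) (z : ℤ) :
    Tendsto (fun n => ∏ i ∈ range n, (1 - C z * (X : ℤ⟦X⟧) ^ e i)) atTop (𝓝 (eulerProd e z)) :=
  (hasProd_eulerProd he z).tendsto_prod_nat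

theorem eulerProd_split (z : ℤ) : eulerProd (fun i => i + 1) z =
    eulerProd (fun i => 2 * i + 1) z * eulerProd (fun i => 2 * i + 2) z := by
  have h1 := (tendsto_eulerProd (e := fun i => i + 1) (by omega) z).comp
    (tendsto_id.const_mul_atTop' two_pos)
  have h2 := (tendsto_eulerProd (e := fun i => 2 * i + 1) (by omega) z).mul
    (tendsto_eulerProd (e := fun i => 2 * i + 2) (by omega) z)
  refine tendsto_nhds_unique h1 (h2.congr fun n => ?_)
  simp only [Function.comp, id]
  induction n with
  | zero => simp
  | succ n ih =>
    rw [prod_range_succ, prod_range_succ, mul_mul_mul_comm, ih,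
      show 2 * (n + 1) = 2 * n + 1 + 1 by ring, prod_range_succ, prod_range_succ]
    ring

theorem eulerProd_ne_zero {e : ℕ → ℕ} (he : ∀ i, i < e i) (z : ℤ) : eulerProd e z ≠ 0 := by
  have h := ((WithPiTopology.continuous_constantCoeff ℤ).tendsto _).comp (tendsto_eulerProd he z)
  have h' : constantCoeff (eulerProd e z) = 1 := by
    refine tendsto_nhds_unique h (tendsto_const_nhds.congr fun n => ?_)
    have h0 (i : ℕ) : e i ≠ 0 := by have := he i; omega
    simp [map_prod, h0]
  intro h0
  simp [h0] at h'

theorem eulerProd_odd_mul_odd_mul_even : eulerProd (fun i => 2 * i + 1) 1 *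
    eulerProd (fun i => 2 * i + 1) (-1) * eulerProd (fun i => 2 * i + 2) (-1) = 1 := by
  have key : eulerProd (fun i => i + 1) 1 * eulerProd (fun i => i + 1) (-1) =
      eulerProd (fun i => 2 * i + 2) 1 := by
    have h1 := (tendsto_eulerProd (e := fun i => i + 1) (by omega) 1).mul
      (tendsto_eulerProd (e := fun i => i + 1) (by omega) (-1))
    refine tendsto_nhds_unique h1
      ((tendsto_eulerProd (e := fun i => 2 * i + 2) (by omega) 1).congr fun n => ?_)
    rw [← prod_mul_distrib]
    refine prod_congr rfl fun i _ => ?_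
    simp only [map_neg, map_one]
    ring
  rw [eulerProd_split, eulerProd_split] at key
  refine mul_left_cancel₀ (eulerProd_ne_zero (e := fun i => 2 * i + 2) (by omega) 1) ?_
  linear_combination key

/-- The theta series `∑ (z * X) ^ (k * (k + 1) / 2)`. -/
noncomputable def triangleSeries (z : ℤ) : ℤ⟦X⟧ := ∑' k : ℕ, (C z * X) ^ (k * (k + 1) / 2)

theorem hasSum_triangleSeries (z : ℤ) :
    HasSum (fun k : ℕ => (C z * X : ℤ⟦X⟧) ^ (k * (k + 1) / 2)) (triangleSeries z) := by
  simp_rw [triangleSeries, mul_pow, ← map_pow]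
  refine (WithPiTopology.summable_of_tendsto_order_atTop_nhds_top ℤ
    (tendsto_order_C_mul_X_pow _ (fun k => ?_) _)).hasSum
  rw [Nat.le_div_iff_mul_le two_pos]
  rcases k with _ | k
  · simp
  · gcongr
    omega

theorem triangleSeries_mul_eulerProd {z : ℤ} (hz : z ^ 2 = 1) :
    triangleSeries z * eulerProd (fun i => 2 * i + 1) z = eulerProd (fun i => 2 * i + 2) 1 := by
  have hodd (i : ℕ) : C z * (X : ℤ⟦X⟧) ^ (2 * i + 1) = (C z * X) ^ (2 * i + 1) := by
    rw [mul_pow, ← map_pow, pow_succ z, pow_mul z, hz]; simp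
  have heven (i : ℕ) : C 1 * (X : ℤ⟦X⟧) ^ (2 * i + 2) = (C z * X) ^ (2 * i + 2) := by
    rw [mul_pow, ← map_pow, show 2 * i + 2 = 2 * (i + 1) by ring, pow_mul z, hz]; simp
  have h1 := ((hasSum_triangleSeries z).tendsto_sum_nat.comp
    (tendsto_id.const_mul_atTop' two_pos)).mul
    (tendsto_eulerProd (e := fun i => 2 * i + 1) (by omega) z)
  have h2 := tendsto_eulerProd (e := fun i => 2 * i + 2) (by omega) 1
  refine eq_of_sub_eq_zero (tendsto_nhds_unique (h1.sub h2) (tendsto_zero_of_X_pow_dvd fun n => ?_))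
  simp only [Function.comp, id, hodd, heven]
  rw [mul_comm, shanks_identity]
  rcases n with _ | n
  · simp
  rw [sum_range_succ', add_sub_assoc]
  refine dvd_add (dvd_sum fun s _ => ?_) (by simp)
  refine Dvd.dvd.mul_right (Dvd.dvd.mul_right ?_ _) _
  rw [mul_pow]
  exact Dvd.dvd.mul_left (pow_dvd_pow _ (by nlinarith)) _

open Nat.Partition in
/-- Generating function of partitions weighted by `z ^ (number of parts)`. -/
theorem genFun_pow_mul_eulerProd (z : ℤ) :
    genFun (fun _ c => z ^ c) * eulerProd (fun i => i + 1) z = 1 := by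
  have h := (hasProd_genFun (fun _ c => z ^ c)).mul
    (hasProd_eulerProd (e := fun i => i + 1) (by omega) z)
  refine h.unique ?_
  convert! hasProd_one with i
  have hx : constantCoeff (C z * (X : ℤ⟦X⟧) ^ (i + 1)) = 0 := by simp
  have hgeom := WithPiTopology.tsum_pow_mul_one_sub_of_constantCoeff_eq_zero hx
  rw [(WithPiTopology.summable_pow_of_constantCoeff_eq_zero hx).tsum_eq_zero_add, pow_zero] at hgeom
  simp_rw [mul_pow, ← map_pow, ← pow_mul, ← smul_eq_C_mul] at hgeom
  simpa only [smul_eq_C_mul] using hgeom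

open Nat.Partition in
theorem expand_genFun_distinct (z : ℤ) :
    expand 2 two_ne_zero (genFun fun _ c => if c = 1 then z else 0) =
      eulerProd (fun i => 2 * i + 2) (-z) := by
  have h := (hasProd_genFun (fun _ c => if c = 1 then z else 0)).tendsto_prod_nat
  have h' : Tendsto (fun n => expand 2 two_ne_zero (∏ i ∈ range n, ((1 : ℤ⟦X⟧) +
      ∑' j, (if j + 1 = 1 then z else 0) • X ^ ((i + 1) * (j + 1))))) atTop
      (𝓝 (expand 2 two_ne_zero (genFun fun _ c => if c = 1 then z else 0))) := by
    rw [WithPiTopology.tendsto_iff_coeff_tendsto] at h ⊢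
    intro d
    simp only [coeff_expand]
    split_ifs
    · exact h _
    · exact tendsto_const_nhds
  refine tendsto_nhds_unique h'
    ((tendsto_eulerProd (e := fun i => 2 * i + 2) (by omega) (-z)).congr fun n => ?_)
  rw [map_prod]
  refine prod_congr rfl fun i _ => ?_
  rw [tsum_eq_single 0 (by simp +contextual)]
  simp [← pow_mul, mul_add]

open Nat.Partition in
theorem genFun_mul_triangleSeries {z : ℤ} (hz : z = 1 ∨ z = -1) :
    genFun (fun _ c => z ^ c) * triangleSeries (-z) =
      expand 2 two_ne_zero (genFun fun _ c => if c = 1 then z else 0) := by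
  have h1 := genFun_pow_mul_eulerProd z
  have h2 := triangleSeries_mul_eulerProd (z := -z) (by rcases hz with rfl | rfl <;> rfl)
  have h3 := eulerProd_odd_mul_odd_mul_even
  rw [eulerProd_split] at h1
  rw [expand_genFun_distinct]
  have h4 : eulerProd (fun i => 2 * i + 1) z * eulerProd (fun i => 2 * i + 1) (-z) *
      eulerProd (fun i => 2 * i + 2) (-1) = 1 := by
    rcases hz with rfl | rfl
    · exact h3
    · rw [neg_neg, mul_comm (eulerProd _ (-1))]; exact h3
  have h5 : eulerProd (fun i => 2 * i + 2) 1 * eulerProd (fun i => 2 * i + 2) (-1) =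
      eulerProd (fun i => 2 * i + 2) z * eulerProd (fun i => 2 * i + 2) (-z) := by
    rcases hz with rfl | rfl
    · rfl
    · rw [neg_neg, mul_comm]
  linear_combination (-genFun (fun _ c => z ^ c) * triangleSeries (-z)) * h4 +
    (genFun (fun _ c => z ^ c) * eulerProd (fun i => 2 * i + 1) z *
      eulerProd (fun i => 2 * i + 2) (-1)) * h2 +
    (genFun (fun _ c => z ^ c) * eulerProd (fun i => 2 * i + 1) z) * h5 +
    eulerProd (fun i => 2 * i + 2) (-z) * h1

namespace Nat.Partition

theorem coeff_genFun_pow (z : ℤ) (n : ℕ) :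
    (genFun fun _ c => z ^ c).coeff n = ∑ P : n.Partition, z ^ P.parts.card := by
  rw [coeff_genFun]
  refine sum_congr rfl fun P _ => ?_
  simp only [Finsupp.prod, Multiset.toFinsupp_support, Multiset.toFinsupp_apply]
  rw [prod_pow_eq_pow_sum, Multiset.toFinset_sum_count_eq]

theorem coeff_genFun_distinct (z : ℤ) (n : ℕ) :
    (genFun fun _ c => if c = 1 then z else 0).coeff n =
      ∑ P : n.Partition, if P.parts.Nodup then z ^ P.parts.card else 0 := by
  rw [coeff_genFun]
  refine sum_congr rfl fun P _ => ?_
  simp only [Finsupp.prod, Multiset.toFinsupp_support, Multiset.toFinsupp_apply]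
  split_ifs with h
  · rw [← Multiset.toFinset_card_of_nodup h, ← prod_const]
    exact prod_congr rfl fun i hi =>
      if_pos (Multiset.count_eq_one_of_mem h (Multiset.mem_toFinset.mp hi))
  · rw [Multiset.nodup_iff_count_eq_one] at h
    push Not at h
    obtain ⟨i, hi, hi'⟩ := h
    exact prod_eq_zero (Multiset.mem_toFinset.mpr hi) (if_neg hi')

theorem sum_val_Icc_one (k : ℕ) : (Icc 1 k).val.sum = k * (k + 1) / 2 := by
  have h : (Icc 1 k).val.sum = ∑ i ∈ range (k + 1), i := by
    rw [sum_range_succ', sum_val, range_eq_Ico, sum_Ico_add' (fun i => i) 0 k 1]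
    rfl
  rw [h, sum_range_id, Nat.add_sub_cancel, mul_comm]

/-- Removing one copy of each of `1, …, k`. -/
theorem sum_pow_card_filter_Icc (z : ℤ) (n k : ℕ) :
    ∑ P : n.Partition, (if ∀ j ∈ Icc 1 k, j ∈ P.parts then z ^ P.parts.card else 0) =
      if k * (k + 1) / 2 ≤ n then
        z ^ k * ∑ Q : (n - k * (k + 1) / 2).Partition, z ^ Q.parts.card else 0 := by
  have hle (P : n.Partition) : (∀ j ∈ Icc 1 k, j ∈ P.parts) ↔ (Icc 1 k).val ≤ P.parts :=
    (Multiset.le_iff_subset (Icc 1 k).nodup).symm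
  have hsum {P : n.Partition} (h : (Icc 1 k).val ≤ P.parts) :
      (P.parts - (Icc 1 k).val).sum + k * (k + 1) / 2 = n := by
    rw [← sum_val_Icc_one, ← Multiset.sum_add, Multiset.sub_add_cancel h, P.parts_sum]
  rw [← sum_filter]
  split_ifs with hk
  · rw [mul_sum]
    refine sum_bij' (fun P hP => ⟨P.parts - (Icc 1 k).val, fun {i} hi =>
        P.parts_pos (Multiset.mem_of_le (Multiset.sub_le_self _ _) hi), ?_⟩)
      (fun Q _ => ⟨Q.parts + (Icc 1 k).val, fun {i} hi => ?_, ?_⟩) ?_ ?_ ?_ ?_ ?_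
    · have := hsum ((hle P).mp (mem_filter.mp hP).2)
      omega
    · rcases Multiset.mem_add.mp hi with hi | hi
      · exact Q.parts_pos hi
      · have : i ∈ Icc 1 k := hi
        grind
    · rw [Multiset.sum_add, Q.parts_sum, sum_val_Icc_one]
      omega
    · simp
    · intro Q _
      simp only [mem_filter, mem_univ, true_and, hle]
      exact Multiset.le_add_left _ _
    · intro P hP
      have := (hle P).mp (mem_filter.mp hP).2
      ext1
      exact Multiset.sub_add_cancel this
    · intro Q _
      ext1
      simp
    · intro P hP
      have := (hle P).mp (mem_filter.mp hP).2
      have hc : Multiset.card (Icc 1 k).val = k := by simp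
      nth_rw 1 [← Multiset.sub_add_cancel this]
      rw [Multiset.card_add, hc, pow_add, mul_comm]
  · refine sum_eq_zero fun P hP => absurd (hsum ((hle P).mp (mem_filter.mp hP).2)) (by omega)

theorem partMex_spec {n : ℕ} (P : n.Partition) :
    0 < partMex P ∧ partMex P ≤ n + 1 ∧ ∀ k, (∀ j ∈ Icc 1 k, j ∈ P.parts) ↔ k < partMex P := by
  have hmem : n + 1 ∈ {k : ℕ | 0 < k ∧ k ∉ P.parts} :=
    ⟨by omega, fun h => by have := P.le_of_mem_parts h; omega⟩
  have h := Nat.sInf_mem ⟨_, hmem⟩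
  refine ⟨h.1, Nat.sInf_le hmem, fun k => ⟨fun hk => ?_, fun hk j hj => ?_⟩⟩
  · by_contra! hlt
    exact h.2 (hk _ (mem_Icc.mpr ⟨h.1, hlt⟩))
  · by_contra hj'
    have : partMex P ≤ j := Nat.sInf_le ⟨(mem_Icc.mp hj).1, hj'⟩
    grind

/-- The weight of a mex: `1` on the class of `1` and `-z` on the class of `3` modulo `4`. -/
def mexWeight (z : ℤ) (m : ℕ) : ℤ :=
  if m % 4 = 1 then 1 else if m % 4 = 3 then -z else 0

theorem mexWeight_succ_sub {z : ℤ} (hz : z = 1 ∨ z = -1) (k : ℕ) :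
    (mexWeight z (k + 1) - mexWeight z k) * z ^ k = (-z) ^ (k * (k + 1) / 2) := by
  obtain ⟨q, r, hr, rfl⟩ : ∃ q r, r < 4 ∧ k = 4 * q + r :=
    ⟨k / 4, k % 4, Nat.mod_lt _ (by omega), by omega⟩
  have hT : (4 * q + r) * (4 * q + r + 1) / 2 = 2 * (4 * q ^ 2 + 2 * q * r + q) + r * (r + 1) / 2 := by
    rw [show (4 * q + r) * (4 * q + r + 1) =
      r * (r + 1) + 2 * (2 * (4 * q ^ 2 + 2 * q * r + q)) by ring, Nat.add_mul_div_left _ _ two_pos]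
    ring
  have h4 : z ^ 4 = 1 := by rcases hz with rfl | rfl <;> rfl
  have h2 : (-z) ^ 2 = 1 := by rcases hz with rfl | rfl <;> rfl
  rw [hT, pow_add, pow_add, pow_mul, pow_mul, h4, h2, one_pow, one_pow]
  interval_cases r <;> rcases hz with rfl | rfl <;>
    simp [mexWeight, Nat.add_mod, add_assoc]

theorem sum_mexWeight {z : ℤ} (hz : z = 1 ∨ z = -1) (n : ℕ) :
    ∑ P : n.Partition, mexWeight z (partMex P) * z ^ P.parts.card =
      (expand 2 two_ne_zero (genFun fun _ c => if c = 1 then z else 0)).coeff n := by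
  have hP (P : n.Partition) : mexWeight z (partMex P) = ∑ k ∈ range (n + 1),
      if ∀ j ∈ Icc 1 k, j ∈ P.parts then mexWeight z (k + 1) - mexWeight z k else 0 := by
    obtain ⟨_, h2, h3⟩ := partMex_spec P
    simp only [h3]
    rw [← sum_filter, show (range (n + 1)).filter (· < partMex P) = range (partMex P) by
      ext; simp; omega, sum_range_sub]
    simp [mexWeight]
  have hcoeff := ((WithPiTopology.continuous_coeff ℤ n).tendsto _).comp
    ((hasSum_triangleSeries (-z)).mul_left (genFun fun _ c => z ^ c)).tendsto_sum_nat
  rw [← genFun_mul_triangleSeries hz]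
  refine tendsto_nhds_unique (tendsto_atTop_of_eventually_const (i₀ := n + 1) fun N hN => ?_) hcoeff
  have hterm (k : ℕ) :
      (genFun (fun _ c => z ^ c) * (C (-z) * X) ^ (k * (k + 1) / 2)).coeff n =
        ∑ P : n.Partition, (if ∀ j ∈ Icc 1 k, j ∈ P.parts then
          mexWeight z (k + 1) - mexWeight z k else 0) * z ^ P.parts.card := by
    simp_rw [ite_mul, zero_mul, ← mul_ite_zero, ← mul_sum]
    rw [sum_pow_card_filter_Icc, mul_ite_zero, ← mul_assoc, mexWeight_succ_sub hz, mul_pow,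
      ← map_pow, mul_left_comm, coeff_C_mul, coeff_mul_X_pow']
    simp only [coeff_genFun_pow, mul_ite_zero]
  simp only [Function.comp, map_sum, hterm]
  rw [sum_comm]
  refine sum_congr rfl fun P _ => ?_
  rw [hP, sum_mul]
  refine (sum_subset (range_subset_range.mpr hN) fun k _ hk => ?_).symm
  obtain ⟨_, h2, h3⟩ := partMex_spec P
  rw [if_neg, zero_mul]
  rw [h3]
  simp only [mem_range] at hk
  omega

end Nat.Partition

namespace Nat.Partition

theorem natCast_card_subtype {n : ℕ} (p : n.Partition → Prop) [DecidablePred p] :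
    ((Nat.card {P : n.Partition // p P} : ℕ) : ℤ) = ∑ P : n.Partition, if p P then 1 else 0 := by
  rw [Nat.card_eq_fintype_card, Fintype.card_subtype, sum_boole]

theorem two_mul_card_mex_sub (n : ℕ) :
    2 * ((Nat.card {P : n.Partition // partMex P % 4 = 1 ∧ Odd P.parts.card} : ℕ) : ℤ) -
        2 * ((Nat.card {P : n.Partition // partMex P % 4 = 3 ∧ Even P.parts.card} : ℕ) : ℤ) =
      (∑ P : n.Partition, mexWeight 1 (partMex P) * 1 ^ P.parts.card) -
        ∑ P : n.Partition, mexWeight (-1) (partMex P) * (-1) ^ P.parts.card := by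
  rw [natCast_card_subtype, natCast_card_subtype, mul_sum, mul_sum, ← sum_sub_distrib,
    ← sum_sub_distrib]
  refine sum_congr rfl fun P _ => ?_
  rcases Nat.even_or_odd P.parts.card with h | h
  · rw [h.neg_one_pow]
    simp only [mexWeight, h, Nat.not_odd_iff_even.mpr h]
    grind
  · rw [h.neg_one_pow]
    simp only [mexWeight, h, Nat.not_even_iff_odd.mpr h]
    grind

theorem two_mul_qOdd (m : ℕ) : 2 * (qOdd m : ℤ) =
    (∑ P : m.Partition, if P.parts.Nodup then (1 : ℤ) ^ P.parts.card else 0) -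
      ∑ P : m.Partition, if P.parts.Nodup then (-1 : ℤ) ^ P.parts.card else 0 := by
  rw [qOdd, natCast_card_subtype, mul_sum, ← sum_sub_distrib]
  refine sum_congr rfl fun P _ => ?_
  rcases Nat.even_or_odd P.parts.card with h | h
  · rw [h.neg_one_pow]
    simp [Nat.not_odd_iff_even.mpr h]
  · rw [h.neg_one_pow]
    split_ifs <;> simp_all

end Nat.Partition

/-- For `n ≥ 1`: if `n` is odd then `m^o_{1,4}(n) = m^e_{3,4}(n)`, and if `n` is even then
`m^o_{1,4}(n) = m^e_{3,4}(n) + q^o(n/2)`. -/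
theorem stmt_11 (n : ℕ) (hn : 1 ≤ n) :
    (Odd n →
      Nat.card {P : Nat.Partition n // partMex P % 4 = 1 ∧ Odd (Multiset.card P.parts)} =
        Nat.card {P : Nat.Partition n // partMex P % 4 = 3 ∧ Even (Multiset.card P.parts)}) ∧
    (Even n →
      Nat.card {P : Nat.Partition n // partMex P % 4 = 1 ∧ Odd (Multiset.card P.parts)} =
        Nat.card {P : Nat.Partition n // partMex P % 4 = 3 ∧ Even (Multiset.card P.parts)} +
          qOdd (n / 2)) := by
  have h := Nat.Partition.two_mul_card_mex_sub n
  rw [Nat.Partition.sum_mexWeight (Or.inl rfl), Nat.Partition.sum_mexWeight (Or.inr rfl),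
    coeff_expand, coeff_expand] at h
  refine ⟨fun ho => ?_, fun he => ?_⟩
  · have h2 : ¬ 2 ∣ n := fun h2 => Nat.not_even_iff_odd.mpr ho (even_iff_two_dvd.mpr h2)
    rw [if_neg h2, if_neg h2] at h
    omega
  · have h2 : 2 ∣ n := even_iff_two_dvd.mp he
    rw [if_pos h2, if_pos h2, Nat.Partition.coeff_genFun_distinct,
      Nat.Partition.coeff_genFun_distinct, ← Nat.Partition.two_mul_qOdd] at h
    omega
end
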